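/- Let $C\subset\mathbb P^2$ be a smooth complex plane quartic, i.e. a smooth non-hyperelliptic complex projective curve of genus $3$ in its canonical embedding, with canonical bundle $\omega_C$. Consider the bicanonical curve $C\subset\mathbb P^5=\mathbb P H^0(\omega_C^{\otimes 2})^*$ and the linear system $\mathbb P^6=|\mathcal I_{C|\mathbb P^5}(2)|=\mathbb P H^0(\mathcal I_{C|\mathbb P^5}(2))$ of quadrics through it, where indeed $h^0(\omega_C^{\otimes 2})=6$ and $h^0(\mathcal I_{C|\mathbb P^5}(2))=7$. Let $C^{[3]}$ be the symmetric product parametrizing effective divisors of degree $3$ on $C$, let $U=\{t\in C^{[3]} : h^0(\omega_C(-t))=0\}$, for $t\in U$ let $P_t\subset\mathbb P^5$ be the linear span of the divisor $t$ of the bicanonical curve, and let $Q=\{(t,G)\in U\times\mathbb P^6 : P_t\subset G\}$. Then: 1. for every $t\in U$ the linear space $P_t$ is a plane; 2. $U$ is Zariski open in $C^{[3]}$ and the first projection $p:Q\to U$ is a $\mathbb P^3$-bundle, Zariski locally trivial and embedded linearly on fibres in $U\times\mathbb P^6$; 3. for every $t\in U$ the fibre of $p$ over $t$ is the linear system of all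 quadrics through $C\cup P_t$, which has projective dimension $3$; 4. the second projection $q:Q\to\mathbb P^6$ has finite (possibly empty) fibre over a general quadric, i.e. over every point of some non-empty Zariski open subset of $\mathbb P^6$. -/

import Mathlib

open scoped LinearAlgebra.Projectivization TensorProduct

noncomputable section

/-- A smooth complex plane quartic curve `F = 0` in `ℙ²`: a smooth non-hyperelliptic complex
projective curve of genus `3`, in its canonical embedding. -/
structure SmoothPlaneQuartic where
  /-- the equation -/
  F : MvPolynomial (Fin 3) ℂ
  homogeneous : F.IsHomogeneous 4
  /-- a curve is integral (for a smooth plane curve this is automatic) -/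
  irreducible : Irreducible F
  /-- at every point of the curve some partial derivative of `F` is nonzero -/
  smooth : ∀ v : Fin 3 → ℂ, v ≠ 0 → MvPolynomial.eval v F = 0 →
    ∃ i, MvPolynomial.eval v (MvPolynomial.pderiv i F) ≠ 0

namespace SmoothPlaneQuartic

variable (C : SmoothPlaneQuartic)

/-! ### The curve, its function field and its local rings -/

/-- The (closed) points of the curve. -/
def Point : Type := {p : ℙ ℂ (Fin 3 → ℂ) // MvPolynomial.eval p.rep C.F = 0}

/-- The homogeneous coordinate ring `ℂ[x₀, x₁, x₂] / (F)`. -/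
abbrev CoordRing : Type := MvPolynomial (Fin 3) ℂ ⧸ Ideal.span {C.F}

instance : IsDomain C.CoordRing :=
  (Ideal.Quotient.isDomain_iff_prime _).2
    ((Ideal.span_singleton_prime C.irreducible.ne_zero).2 C.irreducible.prime)

/-- The polynomials as elements of the fraction field of the homogeneous coordinate ring. -/
def toFrac : MvPolynomial (Fin 3) ℂ →ₐ[ℂ] FractionRing C.CoordRing :=
  (Algebra.algHom ℂ C.CoordRing (FractionRing C.CoordRing)).comp
    (Ideal.Quotient.mkₐ ℂ (Ideal.span {C.F}))

theorem toFrac_ne_zero {v : Fin 3 → ℂ} (hv : MvPolynomial.eval v C.F = 0)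
    {H : MvPolynomial (Fin 3) ℂ} (hH : MvPolynomial.eval v H ≠ 0) : C.toFrac H ≠ 0 := by
  intro h
  have h1 : algebraMap C.CoordRing (FractionRing C.CoordRing)
      (Ideal.Quotient.mk (Ideal.span {C.F}) H) = 0 := h
  have h2 := (IsFractionRing.to_map_eq_zero_iff (K := FractionRing C.CoordRing)).1 h1
  obtain ⟨A, rfl⟩ := Ideal.mem_span_singleton.1 (Ideal.Quotient.eq_zero_iff_mem.1 h2)
  exact hH (by simp [hv])

/-- The field `ℂ(C)` of rational functions: quotients of forms of the same degree. -/
def functionField : IntermediateField ℂ (FractionRing C.CoordRing) where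
  carrier := {f | ∃ (n : ℕ) (G H : MvPolynomial (Fin 3) ℂ), G.IsHomogeneous n ∧
    H.IsHomogeneous n ∧ C.toFrac H ≠ 0 ∧ f = C.toFrac G / C.toFrac H}
  mul_mem' := by
    rintro _ _ ⟨n, G, H, hG, hH, h0, rfl⟩ ⟨m, G', H', hG', hH', h0', rfl⟩
    exact ⟨n + m, G * G', H * H', hG.mul hG', hH.mul hH', by simp [h0, h0'],
      by simp [div_mul_div_comm]⟩
  add_mem' := by
    rintro _ _ ⟨n, G, H, hG, hH, h0, rfl⟩ ⟨m, G', H', hG', hH', h0', rfl⟩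
    exact ⟨n + m, G * H' + H * G', H * H', (hG.mul hH').add (hH.mul hG'), hH.mul hH',
      by simp [h0, h0'], by simp [div_add_div _ _ h0 h0']⟩
  algebraMap_mem' := fun c =>
    ⟨0, MvPolynomial.C c, 1, MvPolynomial.isHomogeneous_C _ _, MvPolynomial.isHomogeneous_one _ _,
      by simp, by
        rw [map_one, div_one]
        exact (C.toFrac.commutes c).symm⟩
  inv_mem' := by
    rintro _ ⟨n, G, H, hG, hH, h0, rfl⟩
    by_cases hz : C.toFrac G = 0
    · exact ⟨0, 0, 1, MvPolynomial.isHomogeneous_zero _ _ _, MvPolynomial.isHomogeneous_one _ _,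
        by simp, by simp [hz]⟩
    · exact ⟨n, H, G, hH, hG, hz, by simp⟩

/-- The function field as a type. -/
def FunField : Type := C.functionField

instance : Field C.FunField := inferInstanceAs (Field C.functionField)

instance : Algebra ℂ C.FunField := inferInstanceAs (Algebra ℂ C.functionField)

/-- The inclusion of the function field in the fraction field of the homogeneous coordinate ring. -/
def incl : C.FunField →ₐ[ℂ] FractionRing C.CoordRing := C.functionField.val

/-- The local ring `𝒪_{C,p}`: quotients of forms of the same degree whose denominator does not
vanish at `p`. -/
def localRing (p : C.Point) : Subalgebra ℂ C.FunField where
  carrier := {f | ∃ (n : ℕ) (G H : MvPolynomial (Fin 3) ℂ), G.IsHomogeneous n ∧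
    H.IsHomogeneous n ∧ MvPolynomial.eval p.1.rep H ≠ 0 ∧
    C.incl f = C.toFrac G / C.toFrac H}
  mul_mem' := by
    rintro _ _ ⟨n, G, H, hG, hH, h0, hf⟩ ⟨m, G', H', hG', hH', h0', hf'⟩
    exact ⟨n + m, G * G', H * H', hG.mul hG', hH.mul hH', by simp [h0, h0'],
      by simp [hf, hf', div_mul_div_comm]⟩
  add_mem' := by
    rintro _ _ ⟨n, G, H, hG, hH, h0, hf⟩ ⟨m, G', H', hG', hH', h0', hf'⟩
    exact ⟨n + m, G * H' + H * G', H * H', (hG.mul hH').add (hH.mul hG'), hH.mul hH',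
      by simp [h0, h0'], by
        simp [hf, hf', div_add_div _ _ (C.toFrac_ne_zero p.2 h0) (C.toFrac_ne_zero p.2 h0')]⟩
  algebraMap_mem' := fun c =>
    ⟨0, MvPolynomial.C c, 1, MvPolynomial.isHomogeneous_C _ _, MvPolynomial.isHomogeneous_one _ _,
      by simp, by
        rw [map_one, div_one, C.incl.commutes]
        exact (C.toFrac.commutes c).symm⟩

/-- The maximal ideal `𝔪_p` of `𝒪_{C,p}`: the functions that vanish at `p`. -/
def maxIdeal (p : C.Point) : Ideal (C.localRing p) where
  carrier := {f | ∃ (n : ℕ) (G H : MvPolynomial (Fin 3) ℂ), G.IsHomogeneous n ∧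
    H.IsHomogeneous n ∧ MvPolynomial.eval p.1.rep H ≠ 0 ∧ MvPolynomial.eval p.1.rep G = 0 ∧
    C.incl f = C.toFrac G / C.toFrac H}
  add_mem' := by
    rintro _ _ ⟨n, G, H, hG, hH, h0, hz, hf⟩ ⟨m, G', H', hG', hH', h0', hz', hf'⟩
    exact ⟨n + m, G * H' + H * G', H * H', (hG.mul hH').add (hH.mul hG'), hH.mul hH',
      by simp [h0, h0'], by simp [hz, hz'], by
        simp [hf, hf', div_add_div _ _ (C.toFrac_ne_zero p.2 h0) (C.toFrac_ne_zero p.2 h0')]⟩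
  zero_mem' := ⟨0, 0, 1, MvPolynomial.isHomogeneous_zero _ _ _,
    MvPolynomial.isHomogeneous_one _ _, by simp, by simp, by simp⟩
  smul_mem' := by
    rintro ⟨c, n, G, H, hG, hH, h0, hf⟩ _ ⟨m, G', H', hG', hH', h0', hz', hf'⟩
    exact ⟨n + m, G * G', H * H', hG.mul hG', hH.mul hH', by simp [h0, h0'], by simp [hz'],
      by simp [hf, hf', div_mul_div_comm]⟩

/-! ### Differentials and pluricanonical sections -/

/-- Rational differentials on `C`. -/
abbrev RatDiff : Type := Ω[C.FunField⁄ℂ]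

/-- Rational quadratic differentials on `C`, i.e. rational sections of `ω_C^⊗2`. -/
abbrev RatQuadDiff : Type := C.RatDiff ⊗[C.FunField] C.RatDiff

/-- The stalk of `ω_C` at `p`: the `𝒪_{C,p}`-module of rational differentials spanned by the `df`,
`f ∈ 𝒪_{C,p}`. -/
def stalkDiff (p : C.Point) : Submodule (C.localRing p) C.RatDiff :=
  Submodule.span (C.localRing p)
    (Set.range fun f : C.localRing p => KaehlerDifferential.D ℂ C.FunField f)

/-- The stalk of `ω_C^⊗2` at `p`. -/
def stalkQuadDiff (p : C.Point) : Submodule (C.localRing p) C.RatQuadDiff :=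
  Submodule.span (C.localRing p)
    {η | ∃ α ∈ C.stalkDiff p, ∃ β ∈ C.stalkDiff p, η = α ⊗ₜ[C.FunField] β}

/-- The symmetric product `C^[3]`: effective divisors of degree three, i.e. multisets of three
points. -/
abbrev Sym3 : Type := Sym C.Point 3

open Classical in
/-- The global sections of `L(-t)`, for a line bundle `L` given by its rational sections `N` and its
stalks `M p ⊆ N`, and an effective divisor `t`: the elements of `N` that lie in
`𝔪_p ^ (mult_p t) · M p` for every point `p` of `C`. -/
def globalSections {N : Type} [AddCommGroup N] [Module ℂ N] [Module C.FunField N]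
    [IsScalarTower ℂ C.FunField N] (M : (p : C.Point) → Submodule (C.localRing p) N)
    (t : Multiset C.Point) : Submodule ℂ N :=
  ⨅ p : C.Point, (C.maxIdeal p ^ t.count p • M p).restrictScalars ℂ

/-- `H⁰(ω_C(-t))` for an effective divisor `t`. -/
def canonicalSections (t : Multiset C.Point) : Submodule ℂ C.RatDiff :=
  C.globalSections C.stalkDiff t

/-- `H⁰(ω_C^⊗2(-t))` for an effective divisor `t`. -/
def bicanonicalSections (t : Multiset C.Point) : Submodule ℂ C.RatQuadDiff :=
  C.globalSections C.stalkQuadDiff t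

/-! ### The bicanonical space and the quadrics through the bicanonical curve -/

/-- The vector space `H⁰(ω_C^⊗2)*`. -/
abbrev BicanDual : Type := Module.Dual ℂ (C.bicanonicalSections 0)

/-- `ℙ⁵ = ℙ H⁰(ω_C^⊗2)*`. Its hyperplanes are the nonzero sections of `ω_C^⊗2` up to scalars. -/
abbrev P5 : Type := ℙ ℂ C.BicanDual

/-- The linear span of an effective divisor `t` of the bicanonical curve, as a vector subspace of
`H⁰(ω_C^⊗2)*`: the common zeros of the sections of `ω_C^⊗2` that vanish on `t`. -/
def spanDual (t : Multiset C.Point) : Submodule ℂ C.BicanDual :=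
  ((C.bicanonicalSections t).comap (C.bicanonicalSections 0).subtype).dualAnnihilator

/-- The linear span in `ℙ⁵` of an effective divisor `t` of the bicanonical curve. -/
def linSpan (t : Multiset C.Point) : Set C.P5 := {φ | φ.submodule ≤ C.spanDual t}

/-- The bicanonical curve in `ℙ⁵`: a point `x` of `C` goes to the point of `ℙ⁵` which is its span. -/
def bicanonicalCurve : Set C.P5 := ⋃ x : C.Point, C.linSpan {x}

/-- Quadratic forms on `H⁰(ω_C^⊗2)*`, i.e. elements of `H⁰(𝒪_{ℙ⁵}(2))`, that vanish on `Z ⊆ ℙ⁵`. -/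
def quadricsThrough (Z : Set C.P5) : Submodule ℂ (QuadraticForm ℂ C.BicanDual) where
  carrier := {q | ∀ φ ∈ Z, q φ.rep = 0}
  add_mem' := fun ha hb φ hφ => by simp [ha φ hφ, hb φ hφ]
  zero_mem' := fun φ _ => by simp
  smul_mem' := fun c q hq φ hφ => by simp [hq φ hφ]

/-- `H⁰(I_{C|ℙ⁵}(2))`. -/
abbrev QuadricSpace : Type := C.quadricsThrough C.bicanonicalCurve

/-- `ℙ⁶ = |I_{C|ℙ⁵}(2)|`. -/
abbrev P6 : Type := ℙ ℂ C.QuadricSpace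

/-- The quadric hypersurface of `ℙ⁵` given by a point of `ℙ⁶`. -/
def quadric (G : C.P6) : Set C.P5 :=
  {φ | (G.rep : QuadraticForm ℂ C.BicanDual) φ.rep = 0}

/-- `U = {t ∈ C^[3] : h⁰(ω_C(-t)) = 0}`. -/
def U : Set C.Sym3 := {t | C.canonicalSections t = ⊥}

/-- `Q = {(t, G) ∈ U × ℙ⁶ : P_t ⊆ G}`. -/
def Q : Set (C.Sym3 × C.P6) := {x | x.1 ∈ C.U ∧ C.linSpan x.1 ⊆ C.quadric x.2}

/-! ### The variety `C^[3] = C³ / S₃` -/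

/-- The quotient map `C³ → C^[3]`. -/
def sumOf (P : Fin 3 → C.Point) : C.Sym3 := ⟨Finset.univ.val.map P, by simp⟩

/-- Polynomials in three groups of three variables, homogeneous of degree `d i` in the `i`-th
group. -/
def IsMultiHomogeneous (A : MvPolynomial (Fin 3 × Fin 3) ℂ) (d : Fin 3 → ℕ) : Prop :=
  ∀ i, A.IsWeightedHomogeneous (fun jk => if jk.1 = i then 1 else 0) (d i)

/-- The value of a multihomogeneous polynomial at (the chosen representatives of) a point of
`C³ ⊆ (ℙ²)³`. -/
def evalTriple (P : Fin 3 → C.Point) (A : MvPolynomial (Fin 3 × Fin 3) ℂ) : ℂ :=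
  MvPolynomial.eval (fun jk => (P jk.1).1.rep jk.2) A

/-- Zariski open subsets of `C^[3]`: the preimage in `C³ ⊆ (ℙ²)³` is the complement of the zero locus
of multihomogeneous polynomials. -/
def IsOpenSym3 (W : Set C.Sym3) : Prop :=
  ∃ T : Set (MvPolynomial (Fin 3 × Fin 3) ℂ), (∀ A ∈ T, ∃ d, IsMultiHomogeneous A d) ∧
    ∀ P, C.sumOf P ∈ W ↔ ∃ A ∈ T, C.evalTriple P A ≠ 0

/-- Regular functions on an open subset `W` of `C^[3]`: the pullback to `C³` is locally a quotient of
multihomogeneous polynomials of the same multidegree. -/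
def IsRegularOn (W : Set C.Sym3) (f : C.Sym3 → ℂ) : Prop :=
  ∀ P, C.sumOf P ∈ W → ∃ (d : Fin 3 → ℕ) (A B : MvPolynomial (Fin 3 × Fin 3) ℂ),
    IsMultiHomogeneous A d ∧ IsMultiHomogeneous B d ∧ C.evalTriple P B ≠ 0 ∧
    ∀ P', C.sumOf P' ∈ W → C.evalTriple P' B ≠ 0 →
      f (C.sumOf P') = C.evalTriple P' A / C.evalTriple P' B

/-- A family of linear maps over `W ⊆ C^[3]` all of whose matrix entries are regular functions. -/
def IsRegularFamily {E E' : Type} [AddCommGroup E] [Module ℂ E] [AddCommGroup E'] [Module ℂ E']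
    (W : Set C.Sym3) (s : C.Sym3 → E →ₗ[ℂ] E') : Prop :=
  ∀ (v : E) (l : Module.Dual ℂ E'), C.IsRegularOn W fun t => l (s t v)

/-- The first projection from `R ⊆ V × ℙ(E)` to the open set `V ⊆ C^[3]` is a Zariski locally trivial
`ℙⁿ`-bundle, embedded fibrewise linearly in the trivial bundle `V × ℙ(E)`: around every point of `V`
there are an open `W ⊆ V` and regular families of linear maps `s t : ℂⁿ⁺¹ → E` and
`r t : E → ℂⁿ⁺¹` such that `(t, [v]) ↦ (t, [s t v])` is an isomorphism over `W` from `W × ℙⁿ` to the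
part of `R` over `W`, with inverse `(t, [e]) ↦ (t, [r t e])`. -/
def IsProjectiveBundle {E : Type} [AddCommGroup E] [Module ℂ E] (n : ℕ) (V : Set C.Sym3)
    (R : Set (C.Sym3 × ℙ ℂ E)) : Prop :=
  (∀ x ∈ R, x.1 ∈ V) ∧
  ∀ t₀ ∈ V, ∃ W : Set C.Sym3, C.IsOpenSym3 W ∧ t₀ ∈ W ∧ W ⊆ V ∧
    ∃ (s : C.Sym3 → (Fin (n + 1) → ℂ) →ₗ[ℂ] E) (r : C.Sym3 → E →ₗ[ℂ] (Fin (n + 1) → ℂ)),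
      C.IsRegularFamily W s ∧ C.IsRegularFamily W r ∧
      ∀ t ∈ W, r t ∘ₗ s t = LinearMap.id ∧
        ∀ e : ℙ ℂ E, (t, e) ∈ R ↔ e.submodule ≤ LinearMap.range (s t)

end SmoothPlaneQuartic

/-- Zariski open subsets of a projective space `ℙ(E)`: complements of zero loci of homogeneous
polynomials in linear forms on `E`. -/
def IsZariskiOpenProj {E : Type} [AddCommGroup E] [Module ℂ E] (O : Set (ℙ ℂ E)) : Prop :=
  ∃ T : Set (MvPolynomial (Module.Dual ℂ E) ℂ), (∀ A ∈ T, ∃ d, A.IsHomogeneous d) ∧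
    ∀ x : ℙ ℂ E, x ∈ O ↔ ∃ A ∈ T, MvPolynomial.eval (fun l => l x.rep) A ≠ 0

end

open scoped LinearAlgebra.Projectivization TensorProduct

noncomputable section

open MvPolynomial

/-- A derivation from a domain to its fraction field extends to the fraction field. -/
theorem exists_derivation_extension {A L : Type*} [CommRing A] [IsDomain A] [Algebra ℂ A] [Field L]
    [Algebra ℂ L] [Algebra A L] [IsScalarTower ℂ A L] [IsFractionRing A L]
    (d : Derivation ℂ A L) :
    ∃ D : Derivation ℂ L L, ∀ a, D (algebraMap A L a) = d a := by
  let φ : A →+* TrivSqZeroExt L L :=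
    { toFun := fun a => TrivSqZeroExt.inl (algebraMap A L a) + TrivSqZeroExt.inr (d a)
      map_one' := by simp
      map_zero' := by simp
      map_add' := fun a b => by
        ext <;> simp
      map_mul' := fun a b => by
        ext
        · simp
        · simp only [TrivSqZeroExt.snd_mul, TrivSqZeroExt.snd_add, TrivSqZeroExt.snd_inl,
            TrivSqZeroExt.snd_inr, TrivSqZeroExt.fst_add, TrivSqZeroExt.fst_inl,
            TrivSqZeroExt.fst_inr, Derivation.leibniz, Algebra.smul_def, MulOpposite.smul_eq_mul_unop,
            MulOpposite.unop_op, Algebra.algebraMap_self, RingHom.id_apply, zero_add, add_zero]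
          ring }
  have hu : ∀ y : nonZeroDivisors A, IsUnit (φ y) := by
    intro y
    rw [TrivSqZeroExt.isUnit_iff_isUnit_fst]
    simp [φ]
  let ψ : L →+* TrivSqZeroExt L L := IsLocalization.lift (M := nonZeroDivisors A) hu
  have hψ : ∀ a, ψ (algebraMap A L a) = φ a := fun a => IsLocalization.lift_eq _ _
  have hfst : ∀ x, (ψ x).fst = x := by
    intro x
    have : ((TrivSqZeroExt.fstHom ℂ L L : _ →ₐ[ℂ] L) : _ →+* L).comp ψ = RingHom.id L := by
      apply IsLocalization.ringHom_ext (nonZeroDivisors A)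
      ext a
      simp [hψ, φ]
    exact congrArg (fun f => f x) this
  have hc : ∀ c : ℂ, (ψ (algebraMap ℂ L c)).snd = 0 := by
    intro c
    rw [IsScalarTower.algebraMap_apply ℂ A L, hψ]
    simp [φ]
  let ℓ : L →ₗ[ℂ] L :=
    { toFun := fun x => (ψ x).snd
      map_add' := fun x y => by simp
      map_smul' := fun c x => by
        simp only [Algebra.smul_def, map_mul, TrivSqZeroExt.snd_mul, hc, hfst,
          RingHom.id_apply, smul_zero, add_zero, Algebra.algebraMap_self] }
  refine ⟨Derivation.mk' ℓ fun x y => ?_, fun a => ?_⟩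
  · change (ψ (x * y)).snd = x * (ψ y).snd + y * (ψ x).snd
    simp only [map_mul, TrivSqZeroExt.snd_mul, hfst, smul_eq_mul, MulOpposite.smul_eq_mul_unop,
      MulOpposite.unop_op]
    ring
  · change (ψ (algebraMap A L a)).snd = d a
    simp [hψ, φ]

namespace SmoothPlaneQuartic

variable (C : SmoothPlaneQuartic)

theorem toFrac_eq_zero_iff {G : MvPolynomial (Fin 3) ℂ} : C.toFrac G = 0 ↔ C.F ∣ G := by
  have : C.toFrac G = algebraMap C.CoordRing (FractionRing C.CoordRing)
      (Ideal.Quotient.mk (Ideal.span {C.F}) G) := rfl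
  rw [this, IsFractionRing.to_map_eq_zero_iff (K := FractionRing C.CoordRing),
    Ideal.Quotient.eq_zero_iff_mem, Ideal.mem_span_singleton]

theorem toFrac_F : C.toFrac C.F = 0 := C.toFrac_eq_zero_iff.2 dvd_rfl

theorem F_ne_zero : C.F ≠ 0 := C.irreducible.ne_zero

theorem toFrac_ne_zero_of_isHomogeneous {G : MvPolynomial (Fin 3) ℂ} {n : ℕ}
    (hG : G.IsHomogeneous n) (h0 : G ≠ 0) (hn : n < 4) : C.toFrac G ≠ 0 := by
  rw [Ne, toFrac_eq_zero_iff]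
  rintro ⟨A, rfl⟩
  have h1 := hG.totalDegree h0
  rw [totalDegree_mul_of_isDomain C.F_ne_zero (right_ne_zero_of_mul h0),
    C.homogeneous.totalDegree C.F_ne_zero] at h1
  omega

theorem toFrac_X_ne_zero (i : Fin 3) : C.toFrac (X i) ≠ 0 :=
  C.toFrac_ne_zero_of_isHomogeneous (isHomogeneous_X ℂ i) (X_ne_zero i) (by norm_num)

/-- Euler's identity on the curve. -/
theorem sum_X_mul_pderiv_toFrac {G : MvPolynomial (Fin 3) ℂ} {n : ℕ} (hG : G.IsHomogeneous n) :
    C.toFrac (X 0) * C.toFrac (pderiv 0 G) + C.toFrac (X 1) * C.toFrac (pderiv 1 G) +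
      C.toFrac (X 2) * C.toFrac (pderiv 2 G) = n * C.toFrac G := by
  have h := congrArg C.toFrac hG.sum_X_mul_pderiv
  simpa [Fin.sum_univ_three] using h

/-- Coordinates of the vector product of the gradients of `G` and `F`. -/
theorem exists_cross_derivation (a : Fin 3) : ∃ D : Derivation ℂ (FractionRing C.CoordRing)
    (FractionRing C.CoordRing), ∀ G : MvPolynomial (Fin 3) ℂ, D (C.toFrac G) =
      C.toFrac (pderiv (a + 1) G) * C.toFrac (pderiv (a + 2) C.F) -
        C.toFrac (pderiv (a + 2) G) * C.toFrac (pderiv (a + 1) C.F) := by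
  let d : Derivation ℂ (MvPolynomial (Fin 3) ℂ) (MvPolynomial (Fin 3) ℂ) :=
    pderiv (a + 2) C.F • pderiv (a + 1) - pderiv (a + 1) C.F • pderiv (a + 2)
  have hd : ∀ x, Ideal.Quotient.mkₐ ℂ (Ideal.span {C.F}) x = 0 →
      Ideal.Quotient.mkₐ ℂ (Ideal.span {C.F}) (d x) = 0 := by
    intro x hx
    obtain ⟨A, rfl⟩ := Ideal.mem_span_singleton.1 (Ideal.Quotient.eq_zero_iff_mem.1 hx)
    refine Ideal.Quotient.eq_zero_iff_mem.2 (Ideal.mem_span_singleton.2 ⟨d A, ?_⟩)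
    simp only [d, Derivation.sub_apply, Derivation.smul_apply, Derivation.leibniz, smul_eq_mul]
    ring
  let d' : Derivation ℂ C.CoordRing C.CoordRing :=
    Derivation.liftOfSurjective (Ideal.Quotient.mkₐ_surjective ℂ (Ideal.span {C.F})) hd
  let d'' : Derivation ℂ C.CoordRing (FractionRing C.CoordRing) :=
    (Algebra.linearMap C.CoordRing (FractionRing C.CoordRing)).compDer d'
  obtain ⟨D, hD⟩ := exists_derivation_extension d''
  refine ⟨D, fun G => ?_⟩
  have h1 : C.toFrac G = algebraMap C.CoordRing (FractionRing C.CoordRing)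
      (Ideal.Quotient.mkₐ ℂ (Ideal.span {C.F}) G) := rfl
  rw [h1, hD]
  have h2 : d'' (Ideal.Quotient.mkₐ ℂ (Ideal.span {C.F}) G) =
      algebraMap C.CoordRing (FractionRing C.CoordRing)
        (d' (Ideal.Quotient.mkₐ ℂ (Ideal.span {C.F}) G)) := rfl
  rw [h2, Derivation.liftOfSurjective_apply]
  change C.toFrac (d G) = _
  simp [d]
  ring

/-- The derivation `G ↦ (∇G × ∇F)ₐ` of the fraction field of the homogeneous coordinate ring. -/
def crossDer (a : Fin 3) : Derivation ℂ (FractionRing C.CoordRing) (FractionRing C.CoordRing) :=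
  (C.exists_cross_derivation a).choose

theorem crossDer_toFrac (a : Fin 3) (G : MvPolynomial (Fin 3) ℂ) : C.crossDer a (C.toFrac G) =
    C.toFrac (pderiv (a + 1) G) * C.toFrac (pderiv (a + 2) C.F) -
      C.toFrac (pderiv (a + 2) G) * C.toFrac (pderiv (a + 1) C.F) :=
  (C.exists_cross_derivation a).choose_spec G

theorem X_mul_crossDer_toFrac {G : MvPolynomial (Fin 3) ℂ} {n : ℕ} (hG : G.IsHomogeneous n)
    (a : Fin 3) :
    C.toFrac (X (a + 1)) * C.crossDer a (C.toFrac G) -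
      C.toFrac (X a) * C.crossDer (a + 1) (C.toFrac G) =
      n * C.toFrac G * C.toFrac (pderiv (a + 2) C.F) := by
  have h1 := C.sum_X_mul_pderiv_toFrac hG
  have h2 := C.sum_X_mul_pderiv_toFrac C.homogeneous
  rw [toFrac_F] at h2
  simp only [crossDer_toFrac]
  fin_cases a <;> simp [show (1 : Fin 3) + 1 = 2 from rfl, show (2 : Fin 3) + 1 = 0 from rfl,
    show (1 : Fin 3) + 2 = 0 from rfl, show (2 : Fin 3) + 2 = 1 from rfl] at * <;> grind

instance : Algebra C.FunField (FractionRing C.CoordRing) :=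
  inferInstanceAs (Algebra C.functionField (FractionRing C.CoordRing))

instance : IsScalarTower ℂ C.FunField (FractionRing C.CoordRing) :=
  inferInstanceAs (IsScalarTower ℂ C.functionField (FractionRing C.CoordRing))

theorem exists_incl_eq (f : C.FunField) : ∃ (n : ℕ) (G H : MvPolynomial (Fin 3) ℂ),
    G.IsHomogeneous n ∧ H.IsHomogeneous n ∧ C.toFrac H ≠ 0 ∧
      C.incl f = C.toFrac G / C.toFrac H := f.2

/-- The rational function `G / H`. -/
theorem exists_funField {n : ℕ} {G H : MvPolynomial (Fin 3) ℂ} (hG : G.IsHomogeneous n)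
    (hH : H.IsHomogeneous n) (h0 : C.toFrac H ≠ 0) :
    ∃ f : C.FunField, C.incl f = C.toFrac G / C.toFrac H :=
  ⟨⟨_, n, G, H, hG, hH, h0, rfl⟩, rfl⟩

theorem incl_injective : Function.Injective C.incl := C.incl.injective

theorem X_mul_crossDer_incl (f : C.FunField) (a b : Fin 3) :
    C.toFrac (X b) * C.crossDer a (C.incl f) = C.toFrac (X a) * C.crossDer b (C.incl f) := by
  have key : ∀ a : Fin 3, C.toFrac (X (a + 1)) * C.crossDer a (C.incl f) =
      C.toFrac (X a) * C.crossDer (a + 1) (C.incl f) := by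
    intro a
    obtain ⟨n, G, H, hG, hH, h0, hf⟩ := C.exists_incl_eq f
    have h1 := C.X_mul_crossDer_toFrac hG a
    have h2 := C.X_mul_crossDer_toFrac hH a
    rw [hf, Derivation.leibniz_div, Derivation.leibniz_div]
    simp only [smul_eq_mul]
    grind
  have h0 := key 0
  have h1 := key 1
  have h2 := key 2
  simp only [show (1 : Fin 3) + 1 = 2 from rfl, show (2 : Fin 3) + 1 = 0 from rfl, zero_add]
    at h0 h1 h2
  fin_cases a <;> fin_cases b <;> simp [h0, h1, h2]

theorem smul_eq_incl_mul (f : C.FunField) (x : FractionRing C.CoordRing) : f • x = C.incl f * x :=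
  rfl

/-- The derivation `f ↦ (∇f × ∇F)₀ / X₀` of the function field, with values in the elements of
degree one. -/
def resDer : Derivation ℂ C.FunField (FractionRing C.CoordRing) :=
  Derivation.mk' { toFun := fun f => C.crossDer 0 (C.incl f) / C.toFrac (X 0)
                   map_add' := fun f g => by simp [add_div]
                   map_smul' := fun c f => by simp [smul_div_assoc] }
    (fun f g => by simp [smul_eq_incl_mul]; ring)

theorem resDer_apply (f : C.FunField) (a : Fin 3) :
    C.resDer f = C.crossDer a (C.incl f) / C.toFrac (X a) := by
  have := C.X_mul_crossDer_incl f 0 a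
  change C.crossDer 0 (C.incl f) / C.toFrac (X 0) = _
  rw [div_eq_div_iff (C.toFrac_X_ne_zero _) (C.toFrac_X_ne_zero _)]
  linear_combination this

/-- The isomorphism `ω_C ≅ 𝒪_C(1)` on rational sections. -/
def res : C.RatDiff →ₗ[C.FunField] FractionRing C.CoordRing := C.resDer.liftKaehlerDifferential

theorem res_D (f : C.FunField) : C.res (KaehlerDifferential.D ℂ C.FunField f) = C.resDer f :=
  Derivation.liftKaehlerDifferential_comp_D _ _

end SmoothPlaneQuartic
end

open scoped LinearAlgebra.Projectivization TensorProduct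

noncomputable section

open MvPolynomial

theorem MvPolynomial.IsHomogeneous.of_eq {σ R : Type*} [CommSemiring R] {φ : MvPolynomial σ R}
    {m n : ℕ} (h : φ.IsHomogeneous m) (e : m = n) : φ.IsHomogeneous n := e ▸ h

theorem MvPolynomial.IsHomogeneous.aeval_mul_left {σ R A : Type*} [Fintype σ] [CommSemiring R]
    [CommSemiring A] [Algebra R A] {φ : MvPolynomial σ R} {n : ℕ} (h : φ.IsHomogeneous n) (c : A)
    (f : σ → A) :
    MvPolynomial.aeval (fun i => c * f i) φ = c ^ n * MvPolynomial.aeval f φ := by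
  simp only [aeval_def, eval₂_eq', Finset.mul_sum]
  refine Finset.sum_congr rfl fun d hd => ?_
  have h1 : ∑ i, d i = n := by
    rw [← Finsupp.degree_eq_sum, Finsupp.degree_eq_weight_one]
    exact h (mem_support_iff.1 hd)
  simp only [mul_pow, Finset.prod_mul_distrib, Finset.prod_pow_eq_pow_sum, h1]
  ring

namespace SmoothPlaneQuartic

variable (C : SmoothPlaneQuartic)

instance (p : C.Point) : CommSemiring (C.localRing p) :=
  inferInstanceAs (CommSemiring (C.localRing p))

instance (p : C.Point) : Module (C.localRing p) (FractionRing C.CoordRing) :=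
  inferInstanceAs (Module (C.localRing p) (FractionRing C.CoordRing))

theorem localRing_smul_def {p : C.Point} (f : C.localRing p) (u : FractionRing C.CoordRing) :
    f • u = C.incl f * u := rfl

/-- The stalk of `𝒪_C(d)` at `p`: quotients of forms whose degrees differ by `d`. -/
def twist (d : ℕ) (p : C.Point) : Submodule (C.localRing p) (FractionRing C.CoordRing) where
  carrier := {u | ∃ (n : ℕ) (G H : MvPolynomial (Fin 3) ℂ), G.IsHomogeneous (n + d) ∧
    H.IsHomogeneous n ∧ eval p.1.rep H ≠ 0 ∧ u = C.toFrac G / C.toFrac H}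
  add_mem' := by
    rintro _ _ ⟨n, G, H, hG, hH, h0, rfl⟩ ⟨m, G', H', hG', hH', h0', rfl⟩
    refine ⟨n + m, G * H' + H * G', H * H', ?_, hH.mul hH', by simp [h0, h0'], by
      simp [div_add_div _ _ (C.toFrac_ne_zero p.2 h0) (C.toFrac_ne_zero p.2 h0')]⟩
    convert (hG.mul hH').add ((hH.mul hG').of_eq (by omega)) using 1
    omega
  zero_mem' := ⟨0, 0, 1, isHomogeneous_zero _ _ _, isHomogeneous_one _ _, by simp, by simp⟩
  smul_mem' := by
    rintro ⟨c, n, G, H, hG, hH, h0, hf⟩ _ ⟨m, G', H', hG', hH', h0', rfl⟩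
    refine ⟨n + m, G * G', H * H', ?_, hH.mul hH', by simp [h0, h0'], ?_⟩
    · convert hG.mul hG' using 1
      omega
    · simp [localRing_smul_def, hf, div_mul_div_comm]

theorem toFrac_mem_twist {d : ℕ} {G : MvPolynomial (Fin 3) ℂ} (hG : G.IsHomogeneous d)
    (p : C.Point) : C.toFrac G ∈ C.twist d p :=
  ⟨0, G, 1, by simpa using hG, isHomogeneous_one _ _, by simp, by simp⟩

theorem mul_mem_twist {d e : ℕ} {p : C.Point} {u v : FractionRing C.CoordRing}
    (hu : u ∈ C.twist d p) (hv : v ∈ C.twist e p) : u * v ∈ C.twist (d + e) p := by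
  obtain ⟨n, G, H, hG, hH, h0, rfl⟩ := hu
  obtain ⟨m, G', H', hG', hH', h0', rfl⟩ := hv
  refine ⟨n + m, G * G', H * H', ?_, hH.mul hH', by simp [h0, h0'], by
    simp [div_mul_div_comm]⟩
  convert hG.mul hG' using 1
  omega

/-- The quotient `G / H` as an element of the local ring. -/
theorem exists_localRing {p : C.Point} {n : ℕ} {G H : MvPolynomial (Fin 3) ℂ}
    (hG : G.IsHomogeneous n) (hH : H.IsHomogeneous n) (h0 : eval p.1.rep H ≠ 0) :
    ∃ f : C.localRing p, C.incl f = C.toFrac G / C.toFrac H := by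
  obtain ⟨f, hf⟩ := C.exists_funField hG hH (C.toFrac_ne_zero p.2 h0)
  exact ⟨⟨f, n, G, H, hG, hH, h0, hf⟩, hf⟩

/-- A section that does not vanish at `p` generates the stalk. -/
theorem exists_smul_eq_of_mem_twist {p : C.Point} {d n : ℕ} {A B : MvPolynomial (Fin 3) ℂ}
    (hA : A.IsHomogeneous (n + d)) (hB : B.IsHomogeneous n) (hA0 : eval p.1.rep A ≠ 0)
    (hB0 : eval p.1.rep B ≠ 0) {u : FractionRing C.CoordRing} (hu : u ∈ C.twist d p) :
    ∃ f : C.localRing p, u = f • (C.toFrac A / C.toFrac B) := by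
  obtain ⟨m, G, H, hG, hH, h0, rfl⟩ := hu
  obtain ⟨f, hf⟩ := C.exists_localRing (p := p) (G := G * B) (H := H * A) (n := m + d + n)
    (hG.mul hB) ((hH.mul hA).of_eq (by omega)) (by simp [h0, hA0])
  refine ⟨f, ?_⟩
  rw [localRing_smul_def, hf]
  have h1 := C.toFrac_ne_zero p.2 hA0
  have h2 := C.toFrac_ne_zero p.2 hB0
  have h3 := C.toFrac_ne_zero p.2 h0
  simp only [map_mul]
  field_simp

theorem exists_rep_ne_zero (p : C.Point) : ∃ a, p.1.rep a ≠ 0 := by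
  by_contra! h
  exact p.1.rep_nonzero (funext h)

theorem eval_sum_pderiv {G : MvPolynomial (Fin 3) ℂ} {n : ℕ} (hG : G.IsHomogeneous n)
    (v : Fin 3 → ℂ) : ∑ i, v i * eval v (pderiv i G) = n * eval v G := by
  have h := congrArg (eval v) hG.sum_X_mul_pderiv
  simpa using h

theorem pderiv_F_ne_zero (p : C.Point) {a : Fin 3} (ha : p.1.rep a ≠ 0) :
    eval p.1.rep (pderiv (a + 2) C.F) ≠ 0 ∨ eval p.1.rep (pderiv (a + 1) C.F) ≠ 0 := by
  by_contra! h
  have h1 := eval_sum_pderiv C.homogeneous p.1.rep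
  obtain ⟨i, hi⟩ := C.smooth _ p.1.rep_nonzero p.2
  rw [p.2, Fin.sum_univ_three] at h1
  fin_cases a <;> simp [show (1 : Fin 3) + 1 = 2 from rfl, show (2 : Fin 3) + 1 = 0 from rfl,
    show (1 : Fin 3) + 2 = 0 from rfl, show (2 : Fin 3) + 2 = 1 from rfl] at h ha <;>
    fin_cases i <;> simp_all

theorem isHomogeneous_cross {G : MvPolynomial (Fin 3) ℂ} {n : ℕ} (hG : G.IsHomogeneous n)
    (i j : Fin 3) : (pderiv i G * pderiv j C.F).IsHomogeneous (n + 2) := by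
  obtain _ | n := n
  · rw [← totalDegree_zero_iff_isHomogeneous, totalDegree_eq_zero_iff_eq_C] at hG
    rw [hG, pderiv_C, zero_mul]
    exact isHomogeneous_zero _ _ _
  · exact (hG.pderiv.mul C.homogeneous.pderiv).of_eq (by omega)

theorem resDer_mem_twist {p : C.Point} (f : C.localRing p) : C.resDer f ∈ C.twist 1 p := by
  obtain ⟨a, ha⟩ := C.exists_rep_ne_zero p
  obtain ⟨f, n, G, H, hG, hH, h0, hf⟩ := f
  have h1 := C.toFrac_ne_zero p.2 h0
  have h2 := C.toFrac_X_ne_zero a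
  refine ⟨n + n + 1, H * (pderiv (a + 1) G * pderiv (a + 2) C.F -
    pderiv (a + 2) G * pderiv (a + 1) C.F) - G * (pderiv (a + 1) H * pderiv (a + 2) C.F -
    pderiv (a + 2) H * pderiv (a + 1) C.F), H * H * X a, ?_, ?_, by simp [h0, ha], ?_⟩
  · refine IsHomogeneous.sub ?_ ?_
    · exact (hH.mul ((C.isHomogeneous_cross hG _ _).sub (C.isHomogeneous_cross hG _ _))).of_eq
        (by omega)
    · exact (hG.mul ((C.isHomogeneous_cross hH _ _).sub (C.isHomogeneous_cross hH _ _))).of_eq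
        (by omega)
  · exact (hH.mul hH).mul (isHomogeneous_X _ _)
  · rw [C.resDer_apply _ a, hf, Derivation.leibniz_div, crossDer_toFrac, crossDer_toFrac]
    simp only [smul_eq_mul, map_mul, map_sub]
    field_simp

theorem resDer_X_div (a : Fin 3) {f g : C.FunField}
    (hf : C.incl f = C.toFrac (X (a + 1)) / C.toFrac (X a))
    (hg : C.incl g = C.toFrac (X (a + 2)) / C.toFrac (X a)) :
    C.resDer f = C.toFrac (pderiv (a + 2) C.F) / C.toFrac (X a) ^ 2 ∧
    C.resDer g = - C.toFrac (pderiv (a + 1) C.F) / C.toFrac (X a) ^ 2 := by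
  have h2 := C.toFrac_X_ne_zero a
  have e1 : a + 1 ≠ a := by fin_cases a <;> decide
  have e2 : a + 2 ≠ a := by fin_cases a <;> decide
  have e3 : a + 1 ≠ a + 2 := by fin_cases a <;> decide
  rw [C.resDer_apply _ a, C.resDer_apply _ a, hf, hg, Derivation.leibniz_div,
    Derivation.leibniz_div, crossDer_toFrac, crossDer_toFrac, crossDer_toFrac]
  simp only [pderiv_X_self, pderiv_X_of_ne e1.symm, pderiv_X_of_ne e2.symm,
    pderiv_X_of_ne e3, pderiv_X_of_ne e3.symm, smul_eq_mul, map_zero,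
    map_one]
  constructor <;> field_simp <;> ring

theorem map_stalkDiff (p : C.Point) :
    (C.stalkDiff p).map (C.res.restrictScalars (C.localRing p)) = C.twist 1 p := by
  apply le_antisymm
  · rw [stalkDiff, Submodule.map_span, Submodule.span_le]
    rintro _ ⟨_, ⟨f, rfl⟩, rfl⟩
    change C.res _ ∈ C.twist 1 p
    rw [res_D]
    exact C.resDer_mem_twist f
  · intro u hu
    obtain ⟨a, ha⟩ := C.exists_rep_ne_zero p
    obtain ⟨f, hf⟩ := C.exists_localRing (p := p) (isHomogeneous_X ℂ (a + 1)) (isHomogeneous_X ℂ a)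
      (by simpa using ha)
    obtain ⟨g, hg⟩ := C.exists_localRing (p := p) (isHomogeneous_X ℂ (a + 2)) (isHomogeneous_X ℂ a)
      (by simpa using ha)
    obtain ⟨h1, h2⟩ := C.resDer_X_div a hf hg
    have key : ∀ h : C.localRing p, ∀ A : MvPolynomial (Fin 3) ℂ, A.IsHomogeneous 3 →
        eval p.1.rep A ≠ 0 → C.resDer h = C.toFrac A / C.toFrac (X a) ^ 2 →
        u ∈ (C.stalkDiff p).map (C.res.restrictScalars (C.localRing p)) := by
      intro h A hA hA0 hh
      obtain ⟨c, hc⟩ := C.exists_smul_eq_of_mem_twist (n := 2) (d := 1) (A := A) (B := X a ^ 2) hA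
        (isHomogeneous_X_pow a 2) hA0 (by simpa using ha) hu
      refine ⟨c • KaehlerDifferential.D ℂ C.FunField h,
        Submodule.smul_mem _ _ (Submodule.subset_span ⟨h, rfl⟩), ?_⟩
      rw [map_smul, hc, map_pow, ← hh, ← res_D]
      rfl
    rcases C.pderiv_F_ne_zero p ha with h0 | h0
    · exact key f _ C.homogeneous.pderiv h0 h1
    · refine key g (-pderiv (a + 1) C.F) C.homogeneous.pderiv.neg (by simpa using h0) ?_
      rw [h2, map_neg]

/-- The coordinate functions `Xᵢ / X₀`. -/
theorem exists_coordFun (i : Fin 3) : ∃ f : C.FunField,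
    C.incl f = C.toFrac (X i) / C.toFrac (X 0) :=
  C.exists_funField (isHomogeneous_X ℂ i) (isHomogeneous_X ℂ 0) (C.toFrac_X_ne_zero 0)

/-- The coordinate functions `Xᵢ / X₀`. -/
def coordFun (i : Fin 3) : C.FunField := (C.exists_coordFun i).choose

theorem incl_coordFun (i : Fin 3) : C.incl (C.coordFun i) = C.toFrac (X i) / C.toFrac (X 0) :=
  (C.exists_coordFun i).choose_spec

theorem coordFun_zero : C.coordFun 0 = 1 := by
  apply C.incl_injective
  rw [incl_coordFun, map_one, div_self (C.toFrac_X_ne_zero 0)]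

theorem incl_aeval_coordFun {G : MvPolynomial (Fin 3) ℂ} {n : ℕ} (hG : G.IsHomogeneous n) :
    C.incl (aeval C.coordFun G) = C.toFrac G / C.toFrac (X 0) ^ n := by
  have h1 : C.incl (aeval C.coordFun G) =
      aeval (fun i => (C.toFrac (X 0))⁻¹ * C.toFrac (X i)) G := by
    rw [← AlgHom.comp_apply, comp_aeval]
    congr 2
    ext i
    rw [incl_coordFun, div_eq_inv_mul]
  have h2 : aeval (fun i => C.toFrac (X i)) = C.toFrac := (aeval_unique C.toFrac).symm
  rw [h1, hG.aeval_mul_left, h2, inv_pow, div_eq_inv_mul]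

/-- The chain rule. -/
theorem _root_.Derivation.map_mvPolynomial_aeval {R A M σ : Type*} [CommRing R] [CommRing A]
    [Algebra R A] [AddCommGroup M] [Module R M] [Module A M] [IsScalarTower R A M] [Fintype σ]
    (D : Derivation R A M) (f : σ → A) (G : MvPolynomial σ R) :
    D (aeval f G) = ∑ i, aeval f (pderiv i G) • D (f i) := by
  classical
  induction G using MvPolynomial.induction_on with
  | C a => simp
  | add p q hp hq => simp [hp, hq, add_smul, Finset.sum_add_distrib]
  | mul_X p j hp =>
    simp only [map_mul, aeval_X, Derivation.leibniz, hp, smul_eq_mul, map_add, pderiv_X, add_smul,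
      Finset.sum_add_distrib, Finset.smul_sum, smul_smul]
    congr 1
    simp [Pi.single_apply]

theorem coordFun_relation : ∑ i, aeval C.coordFun (pderiv i C.F) •
    KaehlerDifferential.D ℂ C.FunField (C.coordFun i) = 0 := by
  rw [← Derivation.map_mvPolynomial_aeval]
  have : aeval C.coordFun C.F = 0 := by
    apply C.incl_injective
    rw [C.incl_aeval_coordFun C.homogeneous, toFrac_F, zero_div, map_zero]
  rw [this, map_zero]

theorem D_mem_span (f : C.FunField) : KaehlerDifferential.D ℂ C.FunField f ∈
    Submodule.span C.FunField (Set.range fun i => KaehlerDifferential.D ℂ C.FunField (C.coordFun i)) := by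
  obtain ⟨n, G, H, hG, hH, h0, hf⟩ := C.exists_incl_eq f
  have h1 : f = aeval C.coordFun G / aeval C.coordFun H := by
    apply C.incl_injective
    rw [hf, map_div₀, C.incl_aeval_coordFun hG, C.incl_aeval_coordFun hH,
      div_div_div_cancel_right₀ (pow_ne_zero _ (C.toFrac_X_ne_zero 0))]
  have key : ∀ P : MvPolynomial (Fin 3) ℂ, KaehlerDifferential.D ℂ C.FunField (aeval C.coordFun P) ∈
      Submodule.span C.FunField
        (Set.range fun i => KaehlerDifferential.D ℂ C.FunField (C.coordFun i)) := by
    intro P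
    rw [Derivation.map_mvPolynomial_aeval]
    exact Submodule.sum_mem _ fun i _ => Submodule.smul_mem _ _ (Submodule.subset_span ⟨i, rfl⟩)
  rw [h1, Derivation.leibniz_div]
  exact Submodule.smul_mem _ _ (Submodule.sub_mem _ (Submodule.smul_mem _ _ (key _))
    (Submodule.smul_mem _ _ (key _)))

theorem toFrac_pderiv_ne_zero :
    C.toFrac (pderiv 1 C.F) ≠ 0 ∨ C.toFrac (pderiv 2 C.F) ≠ 0 := by
  by_contra! h
  have h1 := C.sum_X_mul_pderiv_toFrac C.homogeneous
  rw [toFrac_F, h.1, h.2] at h1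
  have h2 : C.toFrac (pderiv 0 C.F) = 0 := by
    simpa [C.toFrac_X_ne_zero 0] using h1
  have h3 : ∀ i, pderiv i C.F = 0 := by
    intro i
    by_contra hi
    refine C.toFrac_ne_zero_of_isHomogeneous C.homogeneous.pderiv hi (by norm_num) ?_
    fin_cases i
    · exact h2
    · exact h.1
    · exact h.2
  have h4 := C.homogeneous.sum_X_mul_pderiv
  simp only [h3, mul_zero, Finset.sum_const_zero] at h4
  exact C.F_ne_zero (by simpa using h4.symm)

theorem exists_generator_ratDiff : ∃ ω : C.RatDiff, C.res ω ≠ 0 ∧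
    ∀ α : C.RatDiff, ∃ c : C.FunField, α = c • ω := by
  have hX := C.toFrac_X_ne_zero 0
  obtain ⟨h1, h2⟩ := C.resDer_X_div 0 (C.incl_coordFun 1) (C.incl_coordFun 2)
  rw [zero_add] at h1 h2
  have hrel := C.coordFun_relation
  rw [Fin.sum_univ_three, C.coordFun_zero, Derivation.map_one_eq_zero, smul_zero, zero_add] at hrel
  have hg : ∀ i, C.incl (aeval C.coordFun (pderiv i C.F)) =
      C.toFrac (pderiv i C.F) / C.toFrac (X 0) ^ 3 :=
    fun i => C.incl_aeval_coordFun C.homogeneous.pderiv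
  have hne : ∀ i, C.toFrac (pderiv i C.F) ≠ 0 → aeval C.coordFun (pderiv i C.F) ≠ 0 := by
    intro i hi h
    have := hg i
    rw [h, map_zero] at this
    exact (div_ne_zero hi (pow_ne_zero _ hX)) this.symm
  have gen : ∀ ω : C.RatDiff, (∀ i, KaehlerDifferential.D ℂ C.FunField (C.coordFun i) ∈
      Submodule.span C.FunField {ω}) → ∀ α : C.RatDiff, ∃ c : C.FunField, α = c • ω := by
    intro ω hω α
    have : α ∈ Submodule.span C.FunField {ω} := by
      have h3 : (⊤ : Submodule C.FunField C.RatDiff) ≤ Submodule.span C.FunField {ω} := by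
        rw [← KaehlerDifferential.span_range_derivation, Submodule.span_le]
        rintro _ ⟨f, rfl⟩
        refine Submodule.span_le.2 ?_ (C.D_mem_span f)
        rintro _ ⟨i, rfl⟩
        exact hω i
      exact h3 trivial
    obtain ⟨c, hc⟩ := Submodule.mem_span_singleton.1 this
    exact ⟨c, hc.symm⟩
  rcases C.toFrac_pderiv_ne_zero with h0 | h0
  · refine ⟨KaehlerDifferential.D ℂ C.FunField (C.coordFun 2), ?_, gen _ fun i => ?_⟩
    · rw [res_D, h2]
      exact div_ne_zero (neg_ne_zero.2 h0) (pow_ne_zero _ hX)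
    · fin_cases i
      · simp [C.coordFun_zero]
      · refine Submodule.mem_span_singleton.2
          ⟨-(aeval C.coordFun (pderiv 2 C.F) / aeval C.coordFun (pderiv 1 C.F)), ?_⟩
        have := hne 1 h0
        apply smul_right_injective _ this
        simp only [smul_smul, mul_neg, mul_div_cancel₀ _ this]
        rw [neg_smul]
        exact (eq_neg_of_add_eq_zero_left hrel).symm
      · exact Submodule.mem_span_singleton_self _
  · refine ⟨KaehlerDifferential.D ℂ C.FunField (C.coordFun 1), ?_, gen _ fun i => ?_⟩
    · rw [res_D, h1]
      exact div_ne_zero h0 (pow_ne_zero _ hX)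
    · fin_cases i
      · simp [C.coordFun_zero]
      · exact Submodule.mem_span_singleton_self _
      · refine Submodule.mem_span_singleton.2
          ⟨-(aeval C.coordFun (pderiv 1 C.F) / aeval C.coordFun (pderiv 2 C.F)), ?_⟩
        have := hne 2 h0
        apply smul_right_injective _ this
        simp only [smul_smul, mul_neg, mul_div_cancel₀ _ this]
        rw [neg_smul]
        exact (eq_neg_of_add_eq_zero_right hrel).symm

theorem res_injective : Function.Injective C.res := by
  rw [injective_iff_map_eq_zero]
  intro α hα
  obtain ⟨ω, hω, h⟩ := C.exists_generator_ratDiff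
  obtain ⟨c, rfl⟩ := h α
  rw [map_smul, smul_eq_zero] at hα
  rw [hα.resolve_right hω, zero_smul]

/-- The isomorphism `ω_C^⊗2 ≅ 𝒪_C(2)` on rational sections. -/
def quadRes : C.RatQuadDiff →ₗ[C.FunField] FractionRing C.CoordRing :=
  TensorProduct.lift ((LinearMap.mul C.FunField (FractionRing C.CoordRing)).compl₁₂ C.res C.res)

theorem quadRes_tmul (α β : C.RatDiff) : C.quadRes (α ⊗ₜ β) = C.res α * C.res β := rfl

theorem quadRes_injective : Function.Injective C.quadRes := by
  rw [injective_iff_map_eq_zero]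
  intro z hz
  obtain ⟨ω, hω, h⟩ := C.exists_generator_ratDiff
  have key : ∀ z : C.RatQuadDiff, ∃ c : C.FunField, z = c • (ω ⊗ₜ ω) := by
    intro z
    induction z using TensorProduct.induction_on with
    | zero => exact ⟨0, by simp⟩
    | tmul α β =>
      obtain ⟨a, rfl⟩ := h α
      obtain ⟨b, rfl⟩ := h β
      exact ⟨a * b, by rw [TensorProduct.smul_tmul_smul]⟩
    | add x y hx hy =>
      obtain ⟨a, rfl⟩ := hx
      obtain ⟨b, rfl⟩ := hy
      exact ⟨a + b, by rw [add_smul]⟩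
  obtain ⟨c, rfl⟩ := key z
  rw [map_smul, quadRes_tmul, smul_eq_zero] at hz
  rw [hz.resolve_right (mul_ne_zero hω hω), zero_smul]

theorem map_stalkQuadDiff (p : C.Point) :
    (C.stalkQuadDiff p).map (C.quadRes.restrictScalars (C.localRing p)) = C.twist 2 p := by
  apply le_antisymm
  · rw [stalkQuadDiff, Submodule.map_span, Submodule.span_le]
    rintro _ ⟨_, ⟨α, hα, β, hβ, rfl⟩, rfl⟩
    refine C.mul_mem_twist (d := 1) (e := 1) ?_ ?_
    · rw [← map_stalkDiff]
      exact ⟨α, hα, rfl⟩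
    · rw [← map_stalkDiff]
      exact ⟨β, hβ, rfl⟩
  · rintro u ⟨n, G, H, hG, hH, h0, rfl⟩
    obtain ⟨a, ha⟩ := C.exists_rep_ne_zero p
    have h1 : C.toFrac G / C.toFrac (H * X a) ∈ C.twist 1 p :=
      ⟨n + 1, G, H * X a, hG, hH.mul (isHomogeneous_X _ _), by simp [h0, ha], rfl⟩
    have h2 : C.toFrac (X a) ∈ C.twist 1 p := C.toFrac_mem_twist (isHomogeneous_X _ _) p
    rw [← map_stalkDiff] at h1 h2
    obtain ⟨α, hα, h1⟩ := h1
    obtain ⟨β, hβ, h2⟩ := h2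
    refine ⟨α ⊗ₜ β, Submodule.subset_span ⟨α, hα, β, hβ, rfl⟩, ?_⟩
    have h3 := C.toFrac_X_ne_zero a
    have h4 := C.toFrac_ne_zero p.2 h0
    change C.res α = _ at h1
    change C.res β = _ at h2
    change C.res α * C.res β = _
    rw [h1, h2, map_mul]
    field_simp

theorem mem_smul_stalkDiff_iff (p : C.Point) (I : Ideal (C.localRing p)) (α : C.RatDiff) :
    α ∈ I • C.stalkDiff p ↔ C.res α ∈ I • C.twist 1 p := by
  rw [← map_stalkDiff, ← Submodule.map_smul'']
  exact ⟨fun h => ⟨α, h, rfl⟩, fun ⟨β, hβ, h⟩ => C.res_injective h ▸ hβ⟩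

theorem mem_smul_stalkQuadDiff_iff (p : C.Point) (I : Ideal (C.localRing p)) (α : C.RatQuadDiff) :
    α ∈ I • C.stalkQuadDiff p ↔ C.quadRes α ∈ I • C.twist 2 p := by
  rw [← map_stalkQuadDiff, ← Submodule.map_smul'']
  exact ⟨fun h => ⟨α, h, rfl⟩, fun ⟨β, hβ, h⟩ => C.quadRes_injective h ▸ hβ⟩

end SmoothPlaneQuartic
end

open scoped LinearAlgebra.Projectivization TensorProduct

noncomputable section

open MvPolynomial

theorem MvPolynomial.IsHomogeneous.eval_smul_vec {σ : Type*} [Fintype σ]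
    {φ : MvPolynomial σ ℂ} {n : ℕ} (h : φ.IsHomogeneous n) (c : ℂ) (v : σ → ℂ) :
    eval (c • v) φ = c ^ n * eval v φ := by
  have := h.aeval_mul_left c v
  simp only [aeval_eq_eval] at this
  exact this

theorem MvPolynomial.IsHomogeneous.homogeneousComponent_add_mul {σ : Type*}
    {H : MvPolynomial σ ℂ} {n : ℕ} (h : H.IsHomogeneous n) (d : ℕ) (P : MvPolynomial σ ℂ) :
    homogeneousComponent (n + d) (H * P) = H * homogeneousComponent d P := by
  conv_lhs => rw [← sum_homogeneousComponent P, Finset.mul_sum, map_sum]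
  have key : ∀ i, homogeneousComponent (n + d) (H * homogeneousComponent i P) =
      if i = d then H * homogeneousComponent d P else 0 := by
    intro i
    rw [homogeneousComponent_of_mem (h.mul (homogeneousComponent_isHomogeneous i P))]
    by_cases hi : i = d
    · simp [hi]
    · rw [if_neg hi, if_neg (by omega)]
  simp only [key, Finset.sum_ite_eq', Finset.mem_range]
  split_ifs with hd
  · rfl
  · rw [homogeneousComponent_eq_zero, mul_zero]
    omega

theorem MvPolynomial.IsHomogeneous.homogeneousComponent_mul_of_lt {σ : Type*}
    {H : MvPolynomial σ ℂ} {n k : ℕ} (h : H.IsHomogeneous n) (hk : k < n) (P : MvPolynomial σ ℂ) :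
    homogeneousComponent k (H * P) = 0 := by
  conv_lhs => rw [← sum_homogeneousComponent P, Finset.mul_sum, map_sum]
  refine Finset.sum_eq_zero fun i _ => ?_
  rw [homogeneousComponent_of_mem (h.mul (homogeneousComponent_isHomogeneous i P)),
    if_neg (by omega)]

theorem MvPolynomial.IsHomogeneous.dvd_homogeneousComponent {σ : Type*}
    {H P : MvPolynomial σ ℂ} {n : ℕ} (h : H.IsHomogeneous n) (hP : H ∣ P) (k : ℕ) :
    H ∣ homogeneousComponent k P := by
  obtain ⟨A, rfl⟩ := hP
  rcases lt_or_ge k n with hk | hk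
  · rw [h.homogeneousComponent_mul_of_lt hk]
    exact dvd_zero _
  · obtain ⟨d, rfl⟩ := Nat.exists_eq_add_of_le hk
    rw [h.homogeneousComponent_add_mul]
    exact dvd_mul_right _ _

/-- The quotient of homogeneous polynomials is homogeneous. -/
theorem MvPolynomial.IsHomogeneous.exists_eq_mul_of_dvd {σ : Type*}
    {H P : MvPolynomial σ ℂ} {n d : ℕ} (h : H.IsHomogeneous n) (hP : P.IsHomogeneous (n + d))
    (hd : H ∣ P) : ∃ A : MvPolynomial σ ℂ, A.IsHomogeneous d ∧ P = H * A := by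
  obtain ⟨A, rfl⟩ := hd
  refine ⟨homogeneousComponent d A, homogeneousComponent_isHomogeneous _ _, ?_⟩
  rw [← h.homogeneousComponent_add_mul, homogeneousComponent_of_mem hP, if_pos rfl]

theorem MvPolynomial.X_pow_dvd_of_mul_eq {i j : Fin 3} (hij : i ≠ j) {N : ℕ}
    {a b : MvPolynomial (Fin 3) ℂ} (h : X i ^ N * a = X j ^ N * b) : X j ^ N ∣ a := by
  refine (X_prime (i := j)).pow_dvd_of_dvd_mul_left N (fun hd => ?_) (Dvd.intro _ h.symm)
  have := (X_prime (R := ℂ) (i := j)).dvd_of_dvd_pow hd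
  rw [X_dvd_X] at this
  exact hij this.symm

theorem MvPolynomial.exists_eq_of_X_pow_mul {N : ℕ} {a b c : MvPolynomial (Fin 3) ℂ}
    (h : X 0 ^ N * a = X 1 ^ N * b + X 2 ^ N * c) :
    ∃ s t : MvPolynomial (Fin 3) ℂ, a = X 1 ^ N * s + X 2 ^ N * t := by
  let M : Set (Fin 3 →₀ ℕ) := {Finsupp.single 1 N, Finsupp.single 2 N}
  have hM : (fun s => monomial s (1 : ℂ)) '' M = {X 1 ^ N, X 2 ^ N} := by
    simp [M, Set.image_pair, X_pow_eq_monomial]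
  have h1 : X 0 ^ N * a ∈ Ideal.span ((fun s => monomial s (1 : ℂ)) '' M) := by
    rw [hM, Ideal.mem_span_pair]
    exact ⟨b, c, by rw [h]; ring⟩
  have h2 : a ∈ Ideal.span ((fun s => monomial s (1 : ℂ)) '' M) := by
    rw [mem_ideal_span_monomial_image] at h1 ⊢
    intro d hd
    have h3 : Finsupp.single 0 N + d ∈ (X 0 ^ N * a).support := by
      rw [mem_support_iff] at hd ⊢
      rwa [X_pow_eq_monomial, coeff_monomial_mul, one_mul]
    obtain ⟨s, hs, hsd⟩ := h1 _ h3
    refine ⟨s, hs, ?_⟩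
    rcases hs with rfl | rfl
    · rw [Finsupp.single_le_iff] at hsd ⊢
      simpa using hsd
    · rw [Finsupp.single_le_iff] at hsd ⊢
      simpa using hsd
  rw [hM, Ideal.mem_span_pair] at h2
  obtain ⟨s, t, h⟩ := h2
  exact ⟨s, t, by rw [← h]; ring⟩

/-- Exactness of the Koszul complex of `X₀ᴺ, X₁ᴺ, X₂ᴺ` in the second spot. -/
theorem MvPolynomial.koszul_exact {N : ℕ} {A₀₁ A₀₂ A₁₂ : MvPolynomial (Fin 3) ℂ}
    (h : X 0 ^ N * A₁₂ - X 1 ^ N * A₀₂ + X 2 ^ N * A₀₁ = 0) :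
    ∃ B₀ B₁ : MvPolynomial (Fin 3) ℂ, A₀₁ = X 0 ^ N * B₁ - X 1 ^ N * B₀ := by
  obtain ⟨s, t, rfl⟩ := exists_eq_of_X_pow_mul (N := N) (a := A₁₂) (b := A₀₂) (c := -A₀₁)
    (by linear_combination h)
  have h1 : X 1 ^ N * (X 0 ^ N * s - A₀₂) = X 2 ^ N * (-X 0 ^ N * t - A₀₁) := by
    linear_combination h
  obtain ⟨B, hB⟩ := X_pow_dvd_of_mul_eq (by decide) h1
  refine ⟨B, -t, ?_⟩
  have h2 : (X 2 : MvPolynomial (Fin 3) ℂ) ^ N ≠ 0 := pow_ne_zero _ (X_ne_zero _)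
  apply mul_left_cancel₀ h2
  rw [hB] at h1
  linear_combination h1

namespace SmoothPlaneQuartic

variable (C : SmoothPlaneQuartic)

/-- The point of the curve with the given homogeneous coordinates. -/
def mkPoint (v : Fin 3 → ℂ) (hv : v ≠ 0) (h : eval v C.F = 0) : C.Point :=
  ⟨Projectivization.mk ℂ v hv, by
    obtain ⟨a, ha⟩ := Projectivization.exists_smul_eq_mk_rep ℂ v hv
    rw [← ha, Units.smul_def, C.homogeneous.eval_smul_vec, h, mul_zero]⟩

theorem exists_mkPoint_rep (v : Fin 3 → ℂ) (hv : v ≠ 0) (h : eval v C.F = 0) :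
    ∃ a : ℂ, a ≠ 0 ∧ (C.mkPoint v hv h).1.rep = a • v := by
  obtain ⟨a, ha⟩ := Projectivization.exists_smul_eq_mk_rep ℂ v hv
  exact ⟨a, a.ne_zero, ha.symm⟩

/-- A polynomial vanishes at all zeros of `F` only if it is a multiple of `F`. -/
theorem F_dvd_of_forall_eval {G : MvPolynomial (Fin 3) ℂ}
    (h : ∀ v, eval v C.F = 0 → eval v G = 0) : C.F ∣ G := by
  have : (Ideal.span {C.F}).IsPrime :=
    (Ideal.span_singleton_prime C.irreducible.ne_zero).2 C.irreducible.prime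
  rw [← Ideal.mem_span_singleton, ← IsPrime.vanishingIdeal_zeroLocus (K := ℂ) (Ideal.span {C.F}),
    mem_vanishingIdeal_iff]
  intro v hv
  rw [zeroLocus_span] at hv
  have := hv C.F rfl
  rw [aeval_eq_eval] at this ⊢
  exact h v this

theorem F_dvd_of_forall_point {G : MvPolynomial (Fin 3) ℂ} {n : ℕ} (hG : G.IsHomogeneous n)
    (hn : n ≠ 0) (h : ∀ p : C.Point, eval p.1.rep G = 0) : C.F ∣ G := by
  refine C.F_dvd_of_forall_eval fun v hv => ?_
  by_cases h0 : v = 0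
  · have := hG.eval_smul_vec 0 v
    rw [zero_pow hn, zero_mul, zero_smul] at this
    rw [h0, this]
  · obtain ⟨a, ha, hr⟩ := C.exists_mkPoint_rep v h0 hv
    have := h (C.mkPoint v h0 hv)
    rw [hr, hG.eval_smul_vec] at this
    exact (mul_eq_zero.1 this).resolve_left (pow_ne_zero _ ha)

instance : Nonempty C.Point := by
  by_contra h
  rw [not_nonempty_iff] at h
  have := C.F_dvd_of_forall_point (isHomogeneous_X ℂ 0) one_ne_zero fun p => (h.false p).elim
  exact C.toFrac_X_ne_zero 0 (C.toFrac_eq_zero_iff.2 this)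

/-- The ideal of denominators of an element of the fraction field. -/
def denominators (u : FractionRing C.CoordRing) : Ideal (MvPolynomial (Fin 3) ℂ) where
  carrier := {H | ∃ A, C.toFrac H * u = C.toFrac A}
  add_mem' := by
    rintro H H' ⟨A, hA⟩ ⟨A', hA'⟩
    exact ⟨A + A', by rw [map_add, add_mul, hA, hA', map_add]⟩
  zero_mem' := ⟨0, by simp⟩
  smul_mem' := by
    rintro B H ⟨A, hA⟩
    exact ⟨B * A, by rw [smul_eq_mul, map_mul, mul_assoc, hA, map_mul]⟩

theorem X_mem_radical_denominators {d : ℕ} {u : FractionRing C.CoordRing}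
    (hu : ∀ p, u ∈ C.twist d p) (i : Fin 3) : X i ∈ (C.denominators u).radical := by
  rw [← vanishingIdeal_zeroLocus_eq_radical (K := ℂ), mem_vanishingIdeal_iff]
  intro v hv
  by_cases h0 : v = 0
  · simp [h0]
  · exfalso
    simp only [mem_zeroLocus_iff, aeval_eq_eval] at hv
    have hF : eval v C.F = 0 := hv _ ⟨0, by simp [toFrac_F]⟩
    obtain ⟨a, ha, hr⟩ := C.exists_mkPoint_rep v h0 hF
    obtain ⟨n, G, H, hG, hH, hne, rfl⟩ := hu (C.mkPoint v h0 hF)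
    have h1 := C.toFrac_ne_zero (C.mkPoint v h0 hF).2 hne
    rw [hr, hH.eval_smul_vec] at hne
    refine hne ?_
    have : eval v H = 0 := hv _ ⟨G, by field_simp⟩
    rw [this, mul_zero]

theorem exists_toFrac_eq {d : ℕ} {u : FractionRing C.CoordRing}
    (hu : ∀ p, u ∈ C.twist d p) : ∃ G, u = C.toFrac G := by
  have h1 : ∀ i : Fin 3, ∃ N, ∃ A, C.toFrac (X i ^ N) * u = C.toFrac A :=
    fun i => C.X_mem_radical_denominators hu i
  choose n hn using h1
  let N := n 0 + n 1 + n 2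
  have h2 : ∀ i : Fin 3, ∃ A, C.toFrac (X i ^ N) * u = C.toFrac A := by
    intro i
    obtain ⟨A, hA⟩ := hn i
    have hi : n i ≤ N := by
      simp only [N]
      fin_cases i <;> simp <;> omega
    refine ⟨X i ^ (N - n i) * A, ?_⟩
    rw [map_mul, ← hA, ← mul_assoc, ← map_mul, ← pow_add, Nat.sub_add_cancel hi]
  choose G hG using h2
  have h3 : ∀ i j, ∃ A, X i ^ N * G j - X j ^ N * G i = C.F * A := by
    intro i j
    change C.F ∣ _
    rw [← toFrac_eq_zero_iff, map_sub, map_mul, map_mul, ← hG, ← hG]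
    ring
  obtain ⟨A₀₁, h01⟩ := h3 0 1
  obtain ⟨A₀₂, h02⟩ := h3 0 2
  obtain ⟨A₁₂, h12⟩ := h3 1 2
  obtain ⟨B₀, B₁, hB⟩ := koszul_exact (N := N) (A₀₁ := A₀₁) (A₀₂ := A₀₂) (A₁₂ := A₁₂) (by
    apply mul_left_cancel₀ C.F_ne_zero
    linear_combination X 1 ^ N * h02 - X 0 ^ N * h12 - X 2 ^ N * h01)
  have h4 : X 1 ^ N * (G 0 - C.F * B₀) = X 0 ^ N * (G 1 - C.F * B₁) := by
    rw [hB] at h01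
    linear_combination -h01
  obtain ⟨H, hH⟩ := X_pow_dvd_of_mul_eq (by decide) h4
  refine ⟨H, ?_⟩
  have h5 := congrArg C.toFrac hH
  rw [map_sub, map_mul, toFrac_F, zero_mul, sub_zero, ← hG 0, map_mul] at h5
  refine mul_left_cancel₀ ?_ h5
  rw [map_pow]
  exact pow_ne_zero _ (C.toFrac_X_ne_zero 0)

/-- Sections of `𝒪_C(d)` are forms of degree `d`. -/
theorem exists_form_of_mem_twist {d : ℕ} {u : FractionRing C.CoordRing}
    (hu : ∀ p, u ∈ C.twist d p) :
    ∃ G : MvPolynomial (Fin 3) ℂ, G.IsHomogeneous d ∧ u = C.toFrac G := by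
  obtain ⟨P, hP⟩ := C.exists_toFrac_eq hu
  obtain ⟨p⟩ : Nonempty C.Point := inferInstance
  obtain ⟨n, G, H, hG, hH, h0, h⟩ := hu p
  have hH0 := C.toFrac_ne_zero p.2 h0
  have h1 : C.F ∣ H * P - G := by
    rw [← toFrac_eq_zero_iff, map_sub, map_mul, ← hP, h]
    field_simp
    ring
  refine ⟨homogeneousComponent d P, homogeneousComponent_isHomogeneous _ _, ?_⟩
  have h2 := C.homogeneous.dvd_homogeneousComponent h1 (n + d)
  rw [map_sub, hH.homogeneousComponent_add_mul, homogeneousComponent_of_mem hG, if_pos rfl,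
    ← toFrac_eq_zero_iff, map_sub, map_mul, sub_eq_zero] at h2
  rw [h, ← h2]
  field_simp

end SmoothPlaneQuartic
end

open scoped LinearAlgebra.Projectivization TensorProduct

noncomputable section

open MvPolynomial

namespace SmoothPlaneQuartic

variable (C : SmoothPlaneQuartic)

open Classical in
/-- The forms of degree `d` that vanish on the effective divisor `t`. -/
def forms (d : ℕ) (t : Multiset C.Point) : Submodule ℂ (MvPolynomial (Fin 3) ℂ) where
  carrier := {G | G.IsHomogeneous d ∧
    ∀ p, C.toFrac G ∈ C.maxIdeal p ^ t.count p • C.twist d p}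
  add_mem' := fun ha hb => ⟨ha.1.add hb.1, fun p => by
    rw [map_add]
    exact Submodule.add_mem _ (ha.2 p) (hb.2 p)⟩
  zero_mem' := ⟨isHomogeneous_zero _ _ _, fun p => by simp⟩
  smul_mem' := fun c G hG => ⟨(homogeneousSubmodule (Fin 3) ℂ d).smul_mem c hG.1, fun p => by
    rw [map_smul]
    exact ((C.maxIdeal p ^ t.count p • C.twist d p).restrictScalars ℂ).smul_mem c (hG.2 p)⟩

open Classical in
theorem mem_forms {d : ℕ} {t : Multiset C.Point} {G : MvPolynomial (Fin 3) ℂ} :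
    G ∈ C.forms d t ↔ G.IsHomogeneous d ∧
      ∀ p, C.toFrac G ∈ C.maxIdeal p ^ t.count p • C.twist d p := Iff.rfl

open Classical in
theorem mem_canonicalSections {t : Multiset C.Point} {α : C.RatDiff} :
    α ∈ C.canonicalSections t ↔
      ∀ p, C.res α ∈ C.maxIdeal p ^ t.count p • C.twist 1 p := by
  simp only [canonicalSections, globalSections, Submodule.mem_iInf, Submodule.restrictScalars_mem,
    mem_smul_stalkDiff_iff]

open Classical in
theorem mem_bicanonicalSections {t : Multiset C.Point} {α : C.RatQuadDiff} :
    α ∈ C.bicanonicalSections t ↔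
      ∀ p, C.quadRes α ∈ C.maxIdeal p ^ t.count p • C.twist 2 p := by
  simp only [bicanonicalSections, globalSections, Submodule.mem_iInf, Submodule.restrictScalars_mem,
    mem_smul_stalkQuadDiff_iff]

theorem mem_bicanonicalSections_zero {α : C.RatQuadDiff} :
    α ∈ C.bicanonicalSections 0 ↔ ∀ p, C.quadRes α ∈ C.twist 2 p := by
  rw [mem_bicanonicalSections]
  simp

theorem canonicalSections_eq_bot_iff {t : Multiset C.Point} :
    C.canonicalSections t = ⊥ ↔ ∀ G ∈ C.forms 1 t, G = 0 := by
  rw [Submodule.eq_bot_iff]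
  constructor
  · rintro h G ⟨hG, hGt⟩
    obtain ⟨p⟩ : Nonempty C.Point := inferInstance
    have h1 := C.toFrac_mem_twist hG p
    rw [← map_stalkDiff] at h1
    obtain ⟨α, -, hα⟩ := h1
    change C.res α = _ at hα
    have h2 := h α (C.mem_canonicalSections.2 fun p => by rw [hα]; exact hGt p)
    rw [h2, map_zero] at hα
    by_contra h0
    exact C.toFrac_ne_zero_of_isHomogeneous hG h0 (by norm_num) hα.symm
  · intro h α hα
    rw [mem_canonicalSections] at hα
    obtain ⟨G, hG, hu⟩ := C.exists_form_of_mem_twist fun p => Submodule.smul_le_right (hα p)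
    have h1 := h G ⟨hG, fun p => hu ▸ hα p⟩
    rw [h1, map_zero] at hu
    exact C.res_injective (by rw [hu, map_zero])

/-- The map from forms of degree two to the fraction field. -/
def toFracTwo : homogeneousSubmodule (Fin 3) ℂ 2 →ₗ[ℂ] FractionRing C.CoordRing :=
  C.toFrac.toLinearMap ∘ₗ Submodule.subtype _

theorem toFracTwo_injective : Function.Injective C.toFracTwo := by
  rw [injective_iff_map_eq_zero]
  rintro ⟨G, hG⟩ h
  by_contra h0
  exact C.toFrac_ne_zero_of_isHomogeneous hG (fun h => h0 (Subtype.ext h)) (by norm_num) h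

/-- Bicanonical sections as elements of the fraction field. -/
def bicanToFrac : C.bicanonicalSections 0 →ₗ[ℂ] FractionRing C.CoordRing :=
  C.quadRes.restrictScalars ℂ ∘ₗ Submodule.subtype _

theorem bicanToFrac_injective : Function.Injective C.bicanToFrac :=
  C.quadRes_injective.comp Subtype.val_injective

theorem range_bicanToFrac : LinearMap.range C.bicanToFrac = LinearMap.range C.toFracTwo := by
  apply le_antisymm
  · rintro _ ⟨⟨α, hα⟩, rfl⟩
    rw [mem_bicanonicalSections_zero] at hα
    obtain ⟨G, hG, hu⟩ := C.exists_form_of_mem_twist hα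
    exact ⟨⟨G, hG⟩, hu.symm⟩
  · rintro _ ⟨⟨G, hG⟩, rfl⟩
    have h1 : ∀ p, C.toFrac G ∈ C.twist 2 p := C.toFrac_mem_twist hG
    obtain ⟨p⟩ : Nonempty C.Point := inferInstance
    have h2 := h1 p
    rw [← map_stalkQuadDiff] at h2
    obtain ⟨α, -, hα⟩ := h2
    change C.quadRes α = _ at hα
    exact ⟨⟨α, C.mem_bicanonicalSections_zero.2 fun p => hα ▸ h1 p⟩, hα⟩

/-- Bicanonical sections are conics. -/
def bicanEquiv : C.bicanonicalSections 0 ≃ₗ[ℂ] homogeneousSubmodule (Fin 3) ℂ 2 :=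
  (LinearEquiv.ofInjective C.bicanToFrac C.bicanToFrac_injective).trans
    ((LinearEquiv.ofEq _ _ C.range_bicanToFrac).trans
      (LinearEquiv.ofInjective C.toFracTwo C.toFracTwo_injective).symm)

theorem toFrac_bicanEquiv (s : C.bicanonicalSections 0) :
    C.toFrac (C.bicanEquiv s : MvPolynomial (Fin 3) ℂ) = C.quadRes s := by
  have h : (LinearEquiv.ofInjective C.toFracTwo C.toFracTwo_injective) (C.bicanEquiv s) =
      (LinearEquiv.ofEq _ _ C.range_bicanToFrac)
        (LinearEquiv.ofInjective C.bicanToFrac C.bicanToFrac_injective s) := by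
    simp [bicanEquiv]
  exact congrArg Subtype.val h

theorem bicanEquiv_mem_forms {t : Multiset C.Point} (s : C.bicanonicalSections 0) :
    (C.bicanEquiv s : MvPolynomial (Fin 3) ℂ) ∈ C.forms 2 t ↔
      (s : C.RatQuadDiff) ∈ C.bicanonicalSections t := by
  rw [mem_forms, mem_bicanonicalSections, toFrac_bicanEquiv]
  exact and_iff_right (C.bicanEquiv s).2

theorem mem_spanDual {t : Multiset C.Point} {φ : C.BicanDual} :
    φ ∈ C.spanDual t ↔ ∀ s : C.bicanonicalSections 0,
      (C.bicanEquiv s : MvPolynomial (Fin 3) ℂ) ∈ C.forms 2 t → φ s = 0 := by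
  simp only [spanDual, Submodule.mem_dualAnnihilator, Submodule.mem_comap, bicanEquiv_mem_forms]
  rfl

theorem mem_U {t : C.Sym3} : t ∈ C.U ↔ ∀ G ∈ C.forms 1 t, G = 0 :=
  C.canonicalSections_eq_bot_iff

end SmoothPlaneQuartic
end

open scoped LinearAlgebra.Projectivization TensorProduct

noncomputable section

open MvPolynomial

/-- A system of linear coordinates on `ℂ³`, given by the dual basis of vectors. -/
abbrev LinCoord : Type := Module.Basis (Fin 3) ℂ (Fin 3 → ℂ)

namespace LinCoord

variable (b : LinCoord)

/-- The coordinates as linear forms. -/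
def lin (j : Fin 3) : MvPolynomial (Fin 3) ℂ :=
  ∑ i, MvPolynomial.C (b.coord j (Pi.single i 1)) * X i

theorem isHomogeneous_lin (j : Fin 3) : (lin b j).IsHomogeneous 1 :=
  IsHomogeneous.sum _ _ _ fun i _ => by
    simpa using (isHomogeneous_C (Fin 3) (b.coord j (Pi.single i 1))).mul (isHomogeneous_X ℂ i)

theorem eval_lin (j : Fin 3) (v : Fin 3 → ℂ) : eval v (lin b j) = b.repr v j := by
  have h : v = ∑ i, v i • Pi.single (M := fun _ : Fin 3 => ℂ) i 1 := pi_eq_sum_univ' v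
  conv_rhs => rw [h]
  simp [lin, mul_comm]

theorem sum_C_mul_lin (i : Fin 3) :
    ∑ k, MvPolynomial.C (b k i) * lin b k = (X i : MvPolynomial (Fin 3) ℂ) := by
  apply MvPolynomial.funext
  intro v
  have := congrFun (b.sum_repr v) i
  simp only [map_sum, map_mul, eval_C, eval_lin, eval_X]
  rw [← this, Finset.sum_apply]
  simp [mul_comm]

variable {A : Type*} [CommRing A] [Algebra ℂ A]

/-- Substitution of values for the three coordinates. -/
def sub (u : Fin 3 → A) : MvPolynomial (Fin 3) ℂ →ₐ[ℂ] A := aeval fun i => ∑ k, b k i • u k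

theorem sub_X (u : Fin 3 → A) (i : Fin 3) : sub b u (X i) = ∑ k, b k i • u k := by
  simp [sub]

theorem sub_lin (u : Fin 3 → A) (j : Fin 3) : sub b u (lin b j) = u j := by
  simp only [lin, map_sum, map_mul, sub_X, MvPolynomial.algHom_C]
  have h1 : ∀ k, ∑ i, b.coord j (Pi.single i 1) * b k i = if k = j then 1 else 0 := by
    intro k
    have h2 := congrArg (b.coord j) (pi_eq_sum_univ' (b k))
    rw [map_sum] at h2
    simp only [map_smul, smul_eq_mul] at h2
    rw [Finset.sum_congr rfl fun i _ => mul_comm _ _, ← h2]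
    simp [Finsupp.single_apply]
  simp only [Finset.mul_sum, ← Algebra.smul_def, smul_smul]
  rw [Finset.sum_comm]
  simp only [← Finset.sum_smul, h1]
  simp

theorem sub_comp_lin (f : MvPolynomial (Fin 3) ℂ →ₐ[ℂ] A) : sub b (fun k => f (lin b k)) = f := by
  ext i
  rw [sub_X, ← sum_C_mul_lin b i, map_sum]
  simp [Algebra.smul_def]

theorem map_sub {A' : Type*} [CommRing A'] [Algebra ℂ A'] (f : A →ₐ[ℂ] A') (u : Fin 3 → A)
    (G : MvPolynomial (Fin 3) ℂ) : f (sub b u G) = sub b (fun k => f (u k)) G := by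
  rw [← AlgHom.comp_apply]
  congr 1
  ext i
  simp [sub_X]

theorem sub_mul_left (c : A) (u : Fin 3 → A) {G : MvPolynomial (Fin 3) ℂ} {n : ℕ}
    (hG : G.IsHomogeneous n) : sub b (fun k => c * u k) G = c ^ n * sub b u G := by
  rw [sub, sub, ← hG.aeval_mul_left]
  simp [Finset.mul_sum]

theorem sub_apply_eq_eval (u : Fin 3 → ℂ) (G : MvPolynomial (Fin 3) ℂ) :
    sub b u G = eval (∑ k, u k • b k) G := by
  rw [sub, aeval_eq_eval]
  congr 2
  ext i
  simp [mul_comm]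

theorem sub_repr (v : Fin 3 → ℂ) (G : MvPolynomial (Fin 3) ℂ) :
    sub b (fun k => b.repr v k) G = eval v G := by
  rw [sub_apply_eq_eval, b.sum_repr]

/-- The derivative in the direction of the last basis vector. -/
def dirDeriv (G : MvPolynomial (Fin 3) ℂ) : MvPolynomial (Fin 3) ℂ :=
  ∑ i, b 2 i • pderiv i G

theorem isHomogeneous_dirDeriv {G : MvPolynomial (Fin 3) ℂ} {n : ℕ} (hG : G.IsHomogeneous n) :
    (dirDeriv b G).IsHomogeneous (n - 1) :=
  (homogeneousSubmodule (Fin 3) ℂ (n - 1)).sum_mem fun _ _ =>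
    (homogeneousSubmodule (Fin 3) ℂ (n - 1)).smul_mem _ hG.pderiv

theorem eval_sub_C_X (x z : A) (G : MvPolynomial (Fin 3) ℂ) :
    (sub b ![1, Polynomial.C x, Polynomial.X] G).eval z = sub b ![1, x, z] G := by
  have := map_sub b ((Polynomial.aeval z : Polynomial A →ₐ[A] A).restrictScalars ℂ)
    ![1, Polynomial.C x, Polynomial.X] G
  rw [show (![1, x, z] : Fin 3 → A) = fun k =>
    ((Polynomial.aeval z : Polynomial A →ₐ[A] A).restrictScalars ℂ)
      ((![1, Polynomial.C x, Polynomial.X] : Fin 3 → Polynomial A) k) by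
    ext k; fin_cases k <;> simp, ← this]
  simp [Polynomial.coe_aeval_eq_eval]

theorem derivative_sub (x : A) (G : MvPolynomial (Fin 3) ℂ) (z : A) :
    (Polynomial.derivative (sub b ![1, Polynomial.C x, Polynomial.X] G)).eval z =
      sub b ![1, x, z] (dirDeriv b G) := by
  have h1 := (Polynomial.derivative'.restrictScalars ℂ :
    Derivation ℂ (Polynomial A) (Polynomial A)).map_mvPolynomial_aeval
    (fun i => ∑ k, b k i • (![1, Polynomial.C x, Polynomial.X] : Fin 3 → Polynomial A) k) G
  have h2 : ∀ i, Polynomial.derivative (∑ k, b k i •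
      (![1, Polynomial.C x, Polynomial.X] : Fin 3 → Polynomial A) k) =
      algebraMap ℂ (Polynomial A) (b 2 i) := by
    intro i
    simp [Fin.sum_univ_three, Algebra.algebraMap_eq_smul_one]
  change Polynomial.derivative (sub b ![1, Polynomial.C x, Polynomial.X] G) =
    ∑ i, sub b ![1, Polynomial.C x, Polynomial.X] (pderiv i G) * Polynomial.derivative _ at h1
  rw [h1, Polynomial.eval_finsetSum, dirDeriv, map_sum]
  refine Finset.sum_congr rfl fun i _ => ?_
  rw [h2, Polynomial.eval_mul, eval_sub_C_X, map_smul, Algebra.smul_def, mul_comm]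
  congr 1
  rw [IsScalarTower.algebraMap_apply ℂ A (Polynomial A), Polynomial.algebraMap_eq,
    Polynomial.eval_C]

/-- First order expansion in the last coordinate. -/
theorem exists_sub_expansion (x y z : A) (G : MvPolynomial (Fin 3) ℂ) :
    ∃ k, sub b ![1, x, z] G = sub b ![1, x, y] G +
      (z - y) * (sub b ![1, x, y] (dirDeriv b G) + k * (z - y)) := by
  obtain ⟨k, hk⟩ := Polynomial.binomExpansion (sub b ![1, Polynomial.C x, Polynomial.X] G) y (z - y)
  rw [add_sub_cancel, eval_sub_C_X, eval_sub_C_X, derivative_sub] at hk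
  exact ⟨k, by rw [hk]; ring⟩

/-- Substitutions congruent modulo an ideal give congruent values. -/
theorem sub_sub_mem {I : Ideal A} {u v : Fin 3 → A} (h : ∀ k, u k - v k ∈ I)
    (G : MvPolynomial (Fin 3) ℂ) : sub b u G - sub b v G ∈ I := by
  rw [← Ideal.Quotient.eq, ← Ideal.Quotient.mkₐ_eq_mk ℂ, map_sub, map_sub]
  congr 2
  ext k
  exact Ideal.Quotient.eq.2 (h k)

end LinCoord

namespace SmoothPlaneQuartic

variable (C : SmoothPlaneQuartic) (b : LinCoord)

theorem notMem_maxIdeal_of_eval {p : C.Point} {f : C.localRing p}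
    {G H : MvPolynomial (Fin 3) ℂ} (hH0 : eval p.1.rep H ≠ 0) (hG0 : eval p.1.rep G ≠ 0)
    (hf : C.incl f = C.toFrac G / C.toFrac H) : f ∉ C.maxIdeal p := by
  rintro ⟨m, G', H', hG', hH', h0, h1, hf'⟩
  rw [hf, div_eq_div_iff (C.toFrac_ne_zero p.2 hH0) (C.toFrac_ne_zero p.2 h0), ← map_mul,
    ← map_mul, ← sub_eq_zero, ← _root_.map_sub, toFrac_eq_zero_iff] at hf'
  obtain ⟨A, hA⟩ := hf'
  have := congrArg (eval p.1.rep) hA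
  simp only [_root_.map_sub, map_mul, h1, p.2, zero_mul, sub_zero] at this
  exact mul_ne_zero hG0 h0 this

theorem isUnit_of_notMem_maxIdeal {p : C.Point} {f : C.localRing p} (hf : f ∉ C.maxIdeal p) :
    IsUnit f := by
  obtain ⟨n, G, H, hG, hH, h0, hfe⟩ := f.2
  have hG0 : eval p.1.rep G ≠ 0 := fun h => hf ⟨n, G, H, hG, hH, h0, h, hfe⟩
  obtain ⟨g, hg⟩ := C.exists_localRing (p := p) hH hG hG0
  refine IsUnit.of_mul_eq_one g (Subtype.ext (C.incl_injective ?_))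
  have h1 := C.toFrac_ne_zero p.2 h0
  have h2 := C.toFrac_ne_zero p.2 hG0
  change C.incl ((f : C.FunField) * (g : C.FunField)) = C.incl 1
  rw [map_mul, hfe, hg, map_one]
  field_simp

theorem one_notMem_maxIdeal (p : C.Point) : (1 : C.localRing p) ∉ C.maxIdeal p :=
  C.notMem_maxIdeal_of_eval (G := 1) (H := 1) (by simp) (by simp) (by simp)

/-- The affine coordinates of a point. -/
def affCoord (p : C.Point) (k : Fin 3) : ℂ := b.repr p.1.rep k / b.repr p.1.rep 0

theorem eval_rep_eq {p : C.Point} (hp : b.repr p.1.rep 0 ≠ 0) {G : MvPolynomial (Fin 3) ℂ} {n : ℕ}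
    (hG : G.IsHomogeneous n) : eval p.1.rep G =
      b.repr p.1.rep 0 ^ n * LinCoord.sub b ![1, C.affCoord b p 1, C.affCoord b p 2] G := by
  rw [← LinCoord.sub_mul_left b _ _ hG, ← LinCoord.sub_repr b]
  congr 2
  ext k
  fin_cases k <;> simp [affCoord] <;> field_simp

section Local

variable {p : C.Point} {x y : C.localRing p}

theorem exists_affFun (hp : b.repr p.1.rep 0 ≠ 0) (k : Fin 3) : ∃ f : C.localRing p,
    C.incl f = C.toFrac (LinCoord.lin b k) / C.toFrac (LinCoord.lin b 0) :=
  C.exists_localRing (LinCoord.isHomogeneous_lin b k) (LinCoord.isHomogeneous_lin b 0)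
    (by rwa [LinCoord.eval_lin])

theorem toFrac_lin_ne_zero (hp : b.repr p.1.rep 0 ≠ 0) : C.toFrac (LinCoord.lin b 0) ≠ 0 :=
  C.toFrac_ne_zero p.2 (by rwa [LinCoord.eval_lin])

theorem incl_sub (hp : b.repr p.1.rep 0 ≠ 0)
    (hx : C.incl x = C.toFrac (LinCoord.lin b 1) / C.toFrac (LinCoord.lin b 0))
    (hy : C.incl y = C.toFrac (LinCoord.lin b 2) / C.toFrac (LinCoord.lin b 0))
    {G : MvPolynomial (Fin 3) ℂ} {n : ℕ} (hG : G.IsHomogeneous n) :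
    C.incl (LinCoord.sub b ![1, x, y] G : C.localRing p) =
      C.toFrac G / C.toFrac (LinCoord.lin b 0) ^ n := by
  have h0 := C.toFrac_lin_ne_zero b hp
  have h1 := LinCoord.map_sub b (C.incl.comp (C.localRing p).val) ![1, x, y] G
  have h2 : (fun k => (C.incl.comp (C.localRing p).val) ((![1, x, y] : Fin 3 → C.localRing p) k)) =
      fun k => (C.toFrac (LinCoord.lin b 0))⁻¹ * C.toFrac (LinCoord.lin b k) := by
    ext k
    fin_cases k
    · simp [h0]
    · simpa [div_eq_inv_mul] using hx
    · simpa [div_eq_inv_mul] using hy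
  rw [h2, LinCoord.sub_mul_left b _ _ hG, LinCoord.sub_comp_lin, inv_pow, ← div_eq_inv_mul] at h1
  exact h1

theorem toFrac_mem_smul_twist_iff (hp : b.repr p.1.rep 0 ≠ 0)
    (hx : C.incl x = C.toFrac (LinCoord.lin b 1) / C.toFrac (LinCoord.lin b 0))
    (hy : C.incl y = C.toFrac (LinCoord.lin b 2) / C.toFrac (LinCoord.lin b 0))
    {G : MvPolynomial (Fin 3) ℂ} {d : ℕ} (hG : G.IsHomogeneous d) (I : Ideal (C.localRing p)) :
    C.toFrac G ∈ I • C.twist d p ↔ LinCoord.sub b ![1, x, y] G ∈ I := by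
  have h0 : C.toFrac (LinCoord.lin b 0) ^ d ≠ 0 := pow_ne_zero _ (C.toFrac_lin_ne_zero b hp)
  have hl : (LinCoord.lin b 0 ^ d).IsHomogeneous d := by
    simpa using (LinCoord.isHomogeneous_lin b 0).pow d
  have htw : C.twist d p = Submodule.span (C.localRing p) {C.toFrac (LinCoord.lin b 0) ^ d} := by
    apply le_antisymm
    · intro u hu
      obtain ⟨f, rfl⟩ := C.exists_smul_eq_of_mem_twist (n := 0) (A := LinCoord.lin b 0 ^ d) (B := 1)
        (hl.of_eq (by simp)) (isHomogeneous_one _ _) (by simp [LinCoord.eval_lin, hp]) (by simp) hu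
      rw [map_one, div_one, map_pow]
      exact Submodule.smul_mem _ _ (Submodule.mem_span_singleton_self _)
    · rw [Submodule.span_singleton_le_iff_mem, ← map_pow]
      exact C.toFrac_mem_twist hl p
  rw [htw, Submodule.mem_smul_span_singleton]
  have key : ∀ f : C.localRing p, f • C.toFrac (LinCoord.lin b 0) ^ d = C.toFrac G ↔
      f = LinCoord.sub b ![1, x, y] G := by
    intro f
    rw [localRing_smul_def, ← eq_div_iff h0, ← C.incl_sub b hp hx hy hG]
    exact ⟨fun h => Subtype.ext (C.incl_injective h), fun h => by rw [h]⟩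
  simp only [key, exists_eq_right]

theorem sub_C_mem_maxIdeal (hp : b.repr p.1.rep 0 ≠ 0) {k : Fin 3} {f : C.localRing p}
    (hf : C.incl f = C.toFrac (LinCoord.lin b k) / C.toFrac (LinCoord.lin b 0)) :
    f - algebraMap ℂ _ (C.affCoord b p k) ∈ C.maxIdeal p := by
  have h0 := C.toFrac_lin_ne_zero b hp
  refine ⟨1, LinCoord.lin b k - C.affCoord b p k • LinCoord.lin b 0, LinCoord.lin b 0,
    (LinCoord.isHomogeneous_lin b k).sub ((homogeneousSubmodule (Fin 3) ℂ 1).smul_mem _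
      (LinCoord.isHomogeneous_lin b 0)), LinCoord.isHomogeneous_lin b 0, ?_, ?_, ?_⟩
  · rwa [LinCoord.eval_lin]
  · simp only [_root_.map_sub, smul_eval, LinCoord.eval_lin, affCoord]
    field_simp
    ring
  · change C.incl ((f : C.FunField) - algebraMap ℂ _ (C.affCoord b p k)) = _
    rw [_root_.map_sub, hf, AlgHom.commutes, _root_.map_sub, map_smul, Algebra.smul_def]
    field_simp

theorem exists_isUnit_sub (hp : b.repr p.1.rep 0 ≠ 0)
    (hx : C.incl x = C.toFrac (LinCoord.lin b 1) / C.toFrac (LinCoord.lin b 0))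
    (hy : C.incl y = C.toFrac (LinCoord.lin b 2) / C.toFrac (LinCoord.lin b 0))
    (hram : eval p.1.rep (LinCoord.dirDeriv b C.F) ≠ 0) {z : C.localRing p}
    (hz : y - z ∈ C.maxIdeal p) :
    ∃ u, IsUnit u ∧ LinCoord.sub b ![1, x, z] C.F = (y - z) * u := by
  obtain ⟨k, hk⟩ := LinCoord.exists_sub_expansion b x y z C.F
  have hF : LinCoord.sub b ![1, x, y] C.F = 0 := by
    have := C.incl_sub b hp hx hy C.homogeneous
    rw [toFrac_F, zero_div] at this
    exact Subtype.ext (C.incl_injective (this.trans (map_zero _).symm))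
  refine ⟨-(LinCoord.sub b ![1, x, y] (LinCoord.dirDeriv b C.F) + k * (z - y)), ?_, ?_⟩
  · rw [IsUnit.neg_iff]
    refine C.isUnit_of_notMem_maxIdeal fun h => ?_
    refine C.notMem_maxIdeal_of_eval (G := LinCoord.dirDeriv b C.F) (H := LinCoord.lin b 0 ^ 3)
      (by simp [LinCoord.eval_lin, hp]) hram ?_ ((Submodule.add_mem_iff_left _
        (Ideal.mul_mem_left _ k ?_)).1 h)
    · rw [C.incl_sub b hp hx hy (LinCoord.isHomogeneous_dirDeriv b C.homogeneous), map_pow]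
    · rw [← neg_sub]
      exact Submodule.neg_mem _ hz
  · rw [hk, hF]
    ring

theorem maxIdeal_eq_span (hp : b.repr p.1.rep 0 ≠ 0)
    (hx : C.incl x = C.toFrac (LinCoord.lin b 1) / C.toFrac (LinCoord.lin b 0))
    (hy : C.incl y = C.toFrac (LinCoord.lin b 2) / C.toFrac (LinCoord.lin b 0))
    (hram : eval p.1.rep (LinCoord.dirDeriv b C.F) ≠ 0) :
    C.maxIdeal p = Ideal.span {x - algebraMap ℂ _ (C.affCoord b p 1)} := by
  have hxm := C.sub_C_mem_maxIdeal b hp hx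
  have hym := C.sub_C_mem_maxIdeal b hp hy
  have hyI : y - algebraMap ℂ _ (C.affCoord b p 2) ∈
      Ideal.span {x - algebraMap ℂ (C.localRing p) (C.affCoord b p 1)} := by
    obtain ⟨u, hu, h⟩ := C.exists_isUnit_sub b hp hx hy hram hym
    rw [← Ideal.mul_unit_mem_iff_mem _ hu, ← h]
    have h1 := LinCoord.sub_sub_mem b
      (I := Ideal.span {x - algebraMap ℂ (C.localRing p) (C.affCoord b p 1)})
      (u := ![1, x, algebraMap ℂ _ (C.affCoord b p 2)])
      (v := ![1, algebraMap ℂ _ (C.affCoord b p 1), algebraMap ℂ _ (C.affCoord b p 2)])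
      (fun k => by
        fin_cases k
        · simp
        · exact Ideal.mem_span_singleton_self _
        · simp) C.F
    have h2 := LinCoord.map_sub b (Algebra.ofId ℂ (C.localRing p))
      ![1, C.affCoord b p 1, C.affCoord b p 2] C.F
    have h3 : LinCoord.sub b ![1, C.affCoord b p 1, C.affCoord b p 2] C.F = 0 := by
      have := C.eval_rep_eq b hp C.homogeneous
      rw [p.2] at this
      exact (mul_eq_zero.1 this.symm).resolve_left (pow_ne_zero _ hp)
    have h4 : (![1, algebraMap ℂ _ (C.affCoord b p 1), algebraMap ℂ _ (C.affCoord b p 2)] :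
        Fin 3 → C.localRing p) = fun k => Algebra.ofId ℂ (C.localRing p)
          (![1, C.affCoord b p 1, C.affCoord b p 2] k) := by
      ext k
      fin_cases k <;> simp [Algebra.ofId_apply]
    rw [h4, ← h2, h3, map_zero, sub_zero] at h1
    exact h1
  apply le_antisymm
  · rintro f ⟨n, G, H, hG, hH, hH0, hG0, hf⟩
    have hu : IsUnit (LinCoord.sub b ![1, x, y] H) := by
      refine C.isUnit_of_notMem_maxIdeal (C.notMem_maxIdeal_of_eval (G := H)
        (H := LinCoord.lin b 0 ^ n) (by simp [LinCoord.eval_lin, hp]) hH0 ?_)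
      rw [C.incl_sub b hp hx hy hH, map_pow]
    rw [← Ideal.mul_unit_mem_iff_mem _ hu]
    have h1 : f * LinCoord.sub b ![1, x, y] H = LinCoord.sub b ![1, x, y] G := by
      refine Subtype.ext (C.incl_injective ?_)
      change C.incl ((f : C.FunField) * (LinCoord.sub b ![1, x, y] H : C.localRing p)) = _
      have h2 := C.toFrac_ne_zero p.2 hH0
      rw [map_mul, hf, C.incl_sub b hp hx hy hH, C.incl_sub b hp hx hy hG]
      field_simp
    rw [h1]
    have h2 := LinCoord.sub_sub_mem b
      (I := Ideal.span {x - algebraMap ℂ (C.localRing p) (C.affCoord b p 1)})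
      (u := ![1, x, y])
      (v := ![1, algebraMap ℂ _ (C.affCoord b p 1), algebraMap ℂ _ (C.affCoord b p 2)])
      (fun k => by
        fin_cases k
        · simp
        · exact Ideal.mem_span_singleton_self _
        · exact hyI) G
    have h3 := LinCoord.map_sub b (Algebra.ofId ℂ (C.localRing p))
      ![1, C.affCoord b p 1, C.affCoord b p 2] G
    have h4 : LinCoord.sub b ![1, C.affCoord b p 1, C.affCoord b p 2] G = 0 := by
      have := C.eval_rep_eq b hp hG
      rw [hG0] at this
      exact (mul_eq_zero.1 this.symm).resolve_left (pow_ne_zero _ hp)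
    have h5 : (![1, algebraMap ℂ _ (C.affCoord b p 1), algebraMap ℂ _ (C.affCoord b p 2)] :
        Fin 3 → C.localRing p) = fun k => Algebra.ofId ℂ (C.localRing p)
          (![1, C.affCoord b p 1, C.affCoord b p 2] k) := by
      ext k
      fin_cases k <;> simp [Algebra.ofId_apply]
    rw [h5, ← h3, h4, map_zero, sub_zero] at h2
    exact h2
  · rw [Ideal.span_singleton_le_iff_mem]
    exact hxm

end Local

end SmoothPlaneQuartic
end

open scoped LinearAlgebra.Projectivization TensorProduct

noncomputable section

open MvPolynomial

namespace SmoothPlaneQuartic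

variable (C : SmoothPlaneQuartic) (b : LinCoord)

theorem aeval_sub_eval_mem {p : C.Point} (x : C.localRing p) (a : ℂ) (g : Polynomial ℂ) :
    Polynomial.aeval x g - algebraMap ℂ _ (g.eval a) ∈
      Ideal.span {x - algebraMap ℂ (C.localRing p) a} := by
  have h := Polynomial.sub_dvd_eval_sub x (algebraMap ℂ (C.localRing p) a)
    (g.map (algebraMap ℂ (C.localRing p)))
  rw [Ideal.mem_span_singleton]
  rwa [Polynomial.eval_map_algebraMap, Polynomial.eval_map_algebraMap,
    Polynomial.aeval_algebraMap_apply, Polynomial.coe_aeval_eq_eval] at h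

/-- The order of vanishing in terms of a polynomial parametrization of a jet of the curve. -/
theorem toFrac_mem_pow_iff {p : C.Point} (hp : b.repr p.1.rep 0 ≠ 0)
    (hram : eval p.1.rep (LinCoord.dirDeriv b C.F) ≠ 0) {η : Polynomial ℂ}
    (hη : η.eval (C.affCoord b p 1) = C.affCoord b p 2) {k : ℕ}
    (hk : (Polynomial.X - Polynomial.C (C.affCoord b p 1)) ^ k ∣
      LinCoord.sub b ![1, Polynomial.X, η] C.F)
    {G : MvPolynomial (Fin 3) ℂ} {d : ℕ} (hG : G.IsHomogeneous d) :
    C.toFrac G ∈ C.maxIdeal p ^ k • C.twist d p ↔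
      (Polynomial.X - Polynomial.C (C.affCoord b p 1)) ^ k ∣
        LinCoord.sub b ![1, Polynomial.X, η] G := by
  obtain ⟨x, hx⟩ := C.exists_affFun b hp 1
  obtain ⟨y, hy⟩ := C.exists_affFun b hp 2
  rw [C.toFrac_mem_smul_twist_iff b hp hx hy hG]
  have hm := C.maxIdeal_eq_span b hp hx hy hram
  have hxm := C.sub_C_mem_maxIdeal b hp hx
  have hym := C.sub_C_mem_maxIdeal b hp hy
  set a := C.affCoord b p 1 with ha
  have hsub : ∀ H, LinCoord.sub b ![1, x, Polynomial.aeval x η] H =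
      Polynomial.aeval x (LinCoord.sub b ![1, Polynomial.X, η] H) := by
    intro H
    rw [LinCoord.map_sub]
    congr 2
    ext k
    fin_cases k <;> simp
  have hval : ∀ g : Polynomial ℂ,
      Polynomial.aeval x g - algebraMap ℂ _ (g.eval a) ∈ C.maxIdeal p := by
    intro g
    rw [hm]
    exact C.aeval_sub_eval_mem x a g
  have hpow : ∀ g : Polynomial ℂ, (Polynomial.X - Polynomial.C a) ^ k ∣ g →
      Polynomial.aeval x g ∈ C.maxIdeal p ^ k := by
    rintro _ ⟨g, rfl⟩
    rw [map_mul, map_pow]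
    refine Ideal.mul_mem_right _ _ (Ideal.pow_mem_pow ?_ k)
    simpa using hxm
  have hyη : y - Polynomial.aeval x η ∈ C.maxIdeal p ^ k := by
    have h1 : y - Polynomial.aeval x η ∈ C.maxIdeal p := by
      have := Submodule.sub_mem _ hym (hval η)
      rw [hη] at this
      simpa using this
    obtain ⟨u, hu, h⟩ := C.exists_isUnit_sub b hp hx hy hram h1
    rw [← Ideal.mul_unit_mem_iff_mem _ hu, ← h, hsub]
    exact hpow _ hk
  have hcong : LinCoord.sub b ![1, x, y] G -
      Polynomial.aeval x (LinCoord.sub b ![1, Polynomial.X, η] G) ∈ C.maxIdeal p ^ k := by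
    rw [← hsub]
    refine LinCoord.sub_sub_mem b (fun j => ?_) G
    fin_cases j
    · simp
    · simp
    · exact hyη
  have hxa : x - algebraMap ℂ _ a ≠ 0 := by
    intro h
    have h1 : C.incl (x - algebraMap ℂ (C.localRing p) a : C.localRing p) = 0 := by
      rw [h]
      exact map_zero _
    change C.incl ((x : C.FunField) - algebraMap ℂ _ a) = 0 at h1
    have h0 := C.toFrac_lin_ne_zero b hp
    rw [_root_.map_sub, hx, AlgHom.commutes, sub_eq_zero, div_eq_iff h0, ← Algebra.smul_def,
      ← map_smul, ← sub_eq_zero, ← _root_.map_sub] at h1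
    refine C.toFrac_ne_zero_of_isHomogeneous (n := 1) ((LinCoord.isHomogeneous_lin b 1).sub
      ((homogeneousSubmodule (Fin 3) ℂ 1).smul_mem _ (LinCoord.isHomogeneous_lin b 0))) ?_
      (by norm_num) h1
    intro h2
    have := congrArg (eval (b 1)) h2
    simp [LinCoord.eval_lin] at this
  constructor
  · intro h
    have h1 := Submodule.sub_mem _ h hcong
    rw [sub_sub_cancel] at h1
    set g := LinCoord.sub b ![1, Polynomial.X, η] G
    by_cases hg : g = 0
    · simp [hg]
    · obtain ⟨q, hq, hnd⟩ := g.exists_eq_pow_rootMultiplicity_mul_and_not_dvd hg a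
      have hu : IsUnit (Polynomial.aeval x q) := by
        refine C.isUnit_of_notMem_maxIdeal fun h2 => ?_
        have h3 := Submodule.sub_mem _ h2 (hval q)
        rw [sub_sub_cancel] at h3
        have h4 : q.eval a ≠ 0 := fun h4 => hnd (Polynomial.dvd_iff_isRoot.2 h4)
        refine C.one_notMem_maxIdeal p ?_
        have h5 := Ideal.mul_mem_left _ (algebraMap ℂ (C.localRing p) (q.eval a)⁻¹) h3
        rwa [← map_mul, inv_mul_cancel₀ h4, map_one] at h5
      rw [hq, map_mul, Ideal.mul_unit_mem_iff_mem _ hu, hm, Ideal.span_singleton_pow,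
        Ideal.mem_span_singleton, map_pow] at h1
      by_cases hle : k ≤ g.rootMultiplicity a
      · exact (pow_dvd_pow _ hle).trans (Dvd.intro _ hq.symm)
      · exfalso
        obtain ⟨c, hc⟩ := h1
        have h6 : Polynomial.aeval x (Polynomial.X - Polynomial.C a) =
            x - algebraMap ℂ (C.localRing p) a := by simp
        obtain ⟨j, hj⟩ := Nat.exists_eq_add_of_lt (not_le.1 hle)
        rw [h6, hj, add_assoc, pow_add, mul_assoc] at hc
        have h7 := (mul_right_eq_self₀.1 hc.symm).resolve_right (pow_ne_zero _ hxa)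
        refine C.one_notMem_maxIdeal p ?_
        rw [← h7, pow_succ, mul_assoc, mul_comm]
        exact Ideal.mul_mem_right _ _ (Ideal.mul_mem_right _ _ hxm)
  · intro h
    have h1 := Submodule.add_mem _ hcong (hpow _ h)
    rwa [sub_add_cancel] at h1

/-- The monic polynomial whose roots are the abscissas of the points of a divisor. -/
def charPoly (t : Multiset C.Point) : Polynomial ℂ :=
  (t.map fun p => Polynomial.X - Polynomial.C (C.affCoord b p 1)).prod

theorem monic_charPoly (t : Multiset C.Point) : (C.charPoly b t).Monic :=
  Polynomial.monic_multiset_prod_of_monic _ _ fun _ _ => Polynomial.monic_X_sub_C _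

/-- Linear coordinates adapted to a divisor: no point of it lies at infinity, the projection from
the last basis vector to the line is unramified at its points and separates them. -/
structure IsAdapted (t : Multiset C.Point) : Prop where
  finite : ∀ p ∈ t, b.repr p.1.rep 0 ≠ 0
  unramified : ∀ p ∈ t, eval p.1.rep (LinCoord.dirDeriv b C.F) ≠ 0
  separated : ∀ p ∈ t, ∀ p' ∈ t, C.affCoord b p 1 = C.affCoord b p' 1 → p = p'

theorem mem_forms_iff_dvd {t : Multiset C.Point} (hb : C.IsAdapted b t) {η : Polynomial ℂ}
    (hη : ∀ p ∈ t, η.eval (C.affCoord b p 1) = C.affCoord b p 2)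
    (hχ : C.charPoly b t ∣ LinCoord.sub b ![1, Polynomial.X, η] C.F)
    {G : MvPolynomial (Fin 3) ℂ} {d : ℕ} (hG : G.IsHomogeneous d) :
    G ∈ C.forms d t ↔ C.charPoly b t ∣ LinCoord.sub b ![1, Polynomial.X, η] G := by
  classical
  have hprod : C.charPoly b t = ∏ p ∈ t.toFinset,
      (Polynomial.X - Polynomial.C (C.affCoord b p 1)) ^ t.count p :=
    Finset.prod_multiset_map_count _ _
  have hdvd : ∀ p ∈ t, (Polynomial.X - Polynomial.C (C.affCoord b p 1)) ^ t.count p ∣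
      C.charPoly b t := by
    intro p hp
    rw [hprod]
    exact Finset.dvd_prod_of_mem (fun p => (Polynomial.X - Polynomial.C (C.affCoord b p 1)) ^
      t.count p) (Multiset.mem_toFinset.2 hp)
  have key : ∀ p ∈ t, C.toFrac G ∈ C.maxIdeal p ^ t.count p • C.twist d p ↔
      (Polynomial.X - Polynomial.C (C.affCoord b p 1)) ^ t.count p ∣
        LinCoord.sub b ![1, Polynomial.X, η] G := fun p hp =>
    C.toFrac_mem_pow_iff b (hb.finite p hp) (hb.unramified p hp) (hη p hp)
      ((hdvd p hp).trans hχ) hG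
  constructor
  · rintro ⟨-, h⟩
    rw [hprod]
    refine Finset.prod_dvd_of_coprime (fun p hp p' hp' hne => ?_) fun p hp => ?_
    · refine IsCoprime.pow (Polynomial.isCoprime_X_sub_C_of_isUnit_sub ?_)
      refine (sub_ne_zero.2 fun h => hne ?_).isUnit
      exact hb.separated p (by simpa using hp) p' (by simpa using hp') h
    · refine (key p (by simpa using hp)).1 ?_
      convert h p
  · intro h
    refine ⟨hG, fun p => ?_⟩
    by_cases hp : p ∈ t
    · convert (key p hp).2 ((hdvd p hp).trans h)
    · rw [Multiset.count_eq_zero_of_notMem hp, pow_zero, Ideal.one_eq_top, Submodule.top_smul]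
      exact C.toFrac_mem_twist hG p

end SmoothPlaneQuartic
end

open scoped LinearAlgebra.Projectivization TensorProduct

noncomputable section

open MvPolynomial

namespace SmoothPlaneQuartic

variable (C : SmoothPlaneQuartic)

theorem IsMultiHomogeneous.mul {A B : MvPolynomial (Fin 3 × Fin 3) ℂ} {d e : Fin 3 → ℕ}
    (hA : IsMultiHomogeneous A d) (hB : IsMultiHomogeneous B e) :
    IsMultiHomogeneous (A * B) (d + e) := fun i => (hA i).mul (hB i)

theorem IsMultiHomogeneous.add {A B : MvPolynomial (Fin 3 × Fin 3) ℂ} {d : Fin 3 → ℕ}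
    (hA : IsMultiHomogeneous A d) (hB : IsMultiHomogeneous B d) :
    IsMultiHomogeneous (A + B) d := fun i => (hA i).add (hB i)

theorem isMultiHomogeneous_C (c : ℂ) : IsMultiHomogeneous (MvPolynomial.C c) 0 :=
  fun _ => isWeightedHomogeneous_C _ _

/-- The filter of Zariski neighbourhoods of a point of `C³`. -/
def nhd (P₀ : Fin 3 → C.Point) : Filter (Fin 3 → C.Point) where
  sets := {s | ∃ D d, IsMultiHomogeneous D d ∧ C.evalTriple P₀ D ≠ 0 ∧
    ∀ P, C.evalTriple P D ≠ 0 → P ∈ s}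
  univ_sets := ⟨1, 0, isMultiHomogeneous_C 1, by simp [evalTriple], fun _ _ => trivial⟩
  sets_of_superset := fun ⟨D, d, h1, h2, h3⟩ h => ⟨D, d, h1, h2, fun P hP => h (h3 P hP)⟩
  inter_sets := fun ⟨D, d, h1, h2, h3⟩ ⟨D', d', h1', h2', h3'⟩ =>
    ⟨D * D', d + d', h1.mul h1', by
      rw [evalTriple, map_mul]
      exact mul_ne_zero h2 h2', fun P hP => by
      rw [evalTriple, map_mul] at hP
      exact ⟨h3 P (left_ne_zero_of_mul hP), h3' P (right_ne_zero_of_mul hP)⟩⟩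

variable {C} {P₀ : Fin 3 → C.Point}

theorem eventually_nhd_self {q : (Fin 3 → C.Point) → Prop} (h : ∀ᶠ P in C.nhd P₀, q P) : q P₀ := by
  obtain ⟨D, d, -, h2, h3⟩ := h
  exact h3 P₀ h2

theorem eventually_evalTriple_ne_zero {D : MvPolynomial (Fin 3 × Fin 3) ℂ} {d : Fin 3 → ℕ}
    (hD : IsMultiHomogeneous D d) (h0 : C.evalTriple P₀ D ≠ 0) :
    ∀ᶠ P in C.nhd P₀, C.evalTriple P D ≠ 0 := ⟨D, d, hD, h0, fun _ h => h⟩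

variable (C) in
/-- Functions on `C³` that are regular at a point. -/
def regAt (P₀ : Fin 3 → C.Point) : Subalgebra ℂ ((Fin 3 → C.Point) → ℂ) where
  carrier := {f | ∃ d A B, IsMultiHomogeneous A d ∧ IsMultiHomogeneous B d ∧
    C.evalTriple P₀ B ≠ 0 ∧ ∀ᶠ P in C.nhd P₀, f P = C.evalTriple P A / C.evalTriple P B}
  mul_mem' := by
    rintro f g ⟨d, A, B, hA, hB, h0, hf⟩ ⟨d', A', B', hA', hB', h0', hg⟩
    refine ⟨d + d', A * A', B * B', hA.mul hA', hB.mul hB', ?_, ?_⟩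
    · rw [evalTriple, map_mul]
      exact mul_ne_zero h0 h0'
    · filter_upwards [hf, hg] with P h1 h2
      simp only [Pi.mul_apply, h1, h2, evalTriple, map_mul]
      rw [div_mul_div_comm]
  add_mem' := by
    rintro f g ⟨d, A, B, hA, hB, h0, hf⟩ ⟨d', A', B', hA', hB', h0', hg⟩
    refine ⟨d + d', A * B' + B * A', B * B', (hA.mul hB').add (hB.mul hA'), hB.mul hB', ?_, ?_⟩
    · rw [evalTriple, map_mul]
      exact mul_ne_zero h0 h0'
    · filter_upwards [hf, hg, eventually_evalTriple_ne_zero hB h0,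
        eventually_evalTriple_ne_zero hB' h0'] with P h1 h2 h3 h4
      simp only [Pi.add_apply, h1, h2]
      rw [div_add_div _ _ h3 h4]
      simp [evalTriple]
  algebraMap_mem' := fun c => ⟨0, MvPolynomial.C c, 1, isMultiHomogeneous_C c,
    isMultiHomogeneous_C 1, by simp [evalTriple], Filter.Eventually.of_forall fun P => by
      simp [evalTriple]⟩

theorem regAt_congr {f g : (Fin 3 → C.Point) → ℂ} (hf : f ∈ C.regAt P₀)
    (h : ∀ᶠ P in C.nhd P₀, g P = f P) : g ∈ C.regAt P₀ := by
  obtain ⟨d, A, B, hA, hB, h0, hf⟩ := hf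
  refine ⟨d, A, B, hA, hB, h0, ?_⟩
  filter_upwards [hf, h] with P h1 h2
  rw [h2, h1]

theorem eventually_ne_zero_of_regAt {f : (Fin 3 → C.Point) → ℂ} (hf : f ∈ C.regAt P₀)
    (h0 : f P₀ ≠ 0) : ∀ᶠ P in C.nhd P₀, f P ≠ 0 := by
  obtain ⟨d, A, B, hA, hB, hB0, hf⟩ := hf
  have h1 := eventually_nhd_self hf
  rw [h1] at h0
  have hA0 : C.evalTriple P₀ A ≠ 0 := fun h => h0 (by rw [h, zero_div])
  filter_upwards [hf, eventually_evalTriple_ne_zero hA hA0,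
    eventually_evalTriple_ne_zero hB hB0] with P h2 h3 h4
  rw [h2]
  exact div_ne_zero h3 h4

theorem inv_mem_regAt {f : (Fin 3 → C.Point) → ℂ} (hf : f ∈ C.regAt P₀)
    (h0 : f P₀ ≠ 0) : f⁻¹ ∈ C.regAt P₀ := by
  obtain ⟨d, A, B, hA, hB, hB0, hf⟩ := hf
  have h1 := eventually_nhd_self hf
  rw [h1] at h0
  have hA0 : C.evalTriple P₀ A ≠ 0 := fun h => h0 (by rw [h, zero_div])
  refine ⟨d, B, A, hB, hA, hA0, ?_⟩
  filter_upwards [hf] with P h2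
  rw [Pi.inv_apply, h2, inv_div]

theorem div_mem_regAt {f g : (Fin 3 → C.Point) → ℂ} (hf : f ∈ C.regAt P₀) (hg : g ∈ C.regAt P₀)
    (h0 : g P₀ ≠ 0) : (fun P => f P / g P) ∈ C.regAt P₀ := by
  have := (C.regAt P₀).mul_mem hf (inv_mem_regAt hg h0)
  convert this using 1
  ext P
  exact div_eq_mul_inv _ _

/-- Polynomial expressions in regular functions are regular. -/
theorem aeval_mem_regAt {σ : Type*} {g : σ → (Fin 3 → C.Point) → ℂ} (hg : ∀ j, g j ∈ C.regAt P₀)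
    (q : MvPolynomial σ ℂ) : (fun P => aeval (fun j => g j P) q) ∈ C.regAt P₀ := by
  have h1 : aeval g q ∈ C.regAt P₀ := by
    have := ((aeval (fun j => (⟨g j, hg j⟩ : C.regAt P₀)) q)).2
    rw [← Subalgebra.coe_val, ← AlgHom.comp_apply, comp_aeval] at this
    exact this
  convert h1 using 1
  ext P
  have := comp_aeval_apply (f := g) (Pi.evalAlgHom ℂ (fun _ : Fin 3 → C.Point => ℂ) P) q
  exact this.symm

theorem isMultiHomogeneous_rename {G : MvPolynomial (Fin 3) ℂ} {n : ℕ} (hG : G.IsHomogeneous n)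
    (i : Fin 3) : IsMultiHomogeneous (rename (fun j => (i, j)) G) (Pi.single i n) := by
  intro k d hd
  obtain ⟨u, rfl, hu⟩ := coeff_rename_ne_zero _ _ _ hd
  have h1 := hG hu
  rw [Finsupp.weight_apply] at h1 ⊢
  rw [Finsupp.sum_mapDomain_index (by simp) fun _ _ _ => add_smul _ _ _]
  by_cases hik : i = k
  · subst hik
    simpa using h1
  · simp [hik]

theorem evalTriple_rename (P : Fin 3 → C.Point) (i : Fin 3) (G : MvPolynomial (Fin 3) ℂ) :
    C.evalTriple P (rename (fun j => (i, j)) G) = eval (P i).1.rep G := by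
  rw [evalTriple, eval_rename]
  rfl

theorem affCoord_mem_regAt (b : LinCoord) {i : Fin 3} (h : b.repr (P₀ i).1.rep 0 ≠ 0)
    (k : Fin 3) : (fun P => C.affCoord b (P i) k) ∈ C.regAt P₀ := by
  refine ⟨Pi.single i 1, rename (fun j => (i, j)) (LinCoord.lin b k),
    rename (fun j => (i, j)) (LinCoord.lin b 0),
    isMultiHomogeneous_rename (LinCoord.isHomogeneous_lin b k) i,
    isMultiHomogeneous_rename (LinCoord.isHomogeneous_lin b 0) i, ?_,
    Filter.Eventually.of_forall fun P => ?_⟩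
  · rwa [evalTriple_rename, LinCoord.eval_lin]
  · rw [evalTriple_rename, evalTriple_rename, LinCoord.eval_lin, LinCoord.eval_lin]
    rfl

theorem eventually_eval_ne_zero {G : MvPolynomial (Fin 3) ℂ} {n : ℕ} (hG : G.IsHomogeneous n)
    {i : Fin 3} (h : eval (P₀ i).1.rep G ≠ 0) :
    ∀ᶠ P in C.nhd P₀, eval (P i).1.rep G ≠ 0 := by
  have := eventually_evalTriple_ne_zero (P₀ := P₀) (isMultiHomogeneous_rename hG i)
    (by rwa [evalTriple_rename])
  simpa only [evalTriple_rename] using this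

theorem isOpenSym3_of_eventually {W : Set C.Sym3}
    (h : ∀ P, C.sumOf P ∈ W → ∀ᶠ P' in C.nhd P, C.sumOf P' ∈ W) : C.IsOpenSym3 W := by
  refine ⟨{A | (∃ d, IsMultiHomogeneous A d) ∧ ∀ P, C.evalTriple P A ≠ 0 → C.sumOf P ∈ W},
    fun A hA => hA.1, fun P => ⟨fun hP => ?_, fun ⟨A, hA, hPA⟩ => hA.2 P hPA⟩⟩
  obtain ⟨D, d, h1, h2, h3⟩ := h P hP
  exact ⟨D, ⟨⟨d, h1⟩, h3⟩, h2⟩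

theorem isRegularOn_of_regAt {W : Set C.Sym3} {f : C.Sym3 → ℂ}
    (h : ∀ P, C.sumOf P ∈ W → (fun P' => f (C.sumOf P')) ∈ C.regAt P) : C.IsRegularOn W f := by
  intro P hP
  obtain ⟨d, A, B, hA, hB, h0, D, e, hD, hD0, hf⟩ := h P hP
  refine ⟨d + e, A * D, B * D, hA.mul hD, hB.mul hD, ?_, fun P' _ hP' => ?_⟩
  · rw [evalTriple, map_mul]
    exact mul_ne_zero h0 hD0
  · rw [evalTriple, map_mul] at hP'
    have h1 := hf P' (right_ne_zero_of_mul hP')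
    change f (C.sumOf P') = _ at h1
    rw [h1]
    simp only [evalTriple, map_mul]
    rw [mul_div_mul_right _ _ (right_ne_zero_of_mul hP')]

end SmoothPlaneQuartic
end

open scoped LinearAlgebra.Projectivization TensorProduct

noncomputable section

open MvPolynomial

/-- If two substitutions in a polynomial agree modulo `d`, the difference of the values is
divisible by `d`. -/
theorem MvPolynomial.dvd_aeval_sub_aeval {σ A : Type*} [CommRing A] [Algebra ℂ A]
    (p : MvPolynomial σ ℂ) {u v : σ → A} {d : A} (h : ∀ j, d ∣ u j - v j) :
    d ∣ aeval u p - aeval v p := by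
  rw [← Ideal.mem_span_singleton, ← Ideal.Quotient.eq, ← Ideal.Quotient.mkₐ_eq_mk ℂ,
    comp_aeval_apply, comp_aeval_apply]
  congr 2
  ext j
  exact Ideal.Quotient.eq.2 (Ideal.mem_span_singleton.2 (h j))

/-- The divided difference of a polynomial in two variables in the first one. -/
theorem MvPolynomial.exists_dividedDiff_left (p : MvPolynomial (Fin 2) ℂ) :
    ∃ q : MvPolynomial (Fin 3) ℂ, ∀ {A : Type} [CommRing A] [Algebra ℂ A] (t t' z : A),
      aeval ![t', z] p - aeval ![t, z] p = (t' - t) * aeval ![t, t', z] q := by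
  obtain ⟨q, hq⟩ := MvPolynomial.dvd_aeval_sub_aeval p
    (u := ![X 1, X 2]) (v := ![X 0, (X 2 : MvPolynomial (Fin 3) ℂ)]) (d := X 1 - X 0)
    (fun j => by fin_cases j <;> simp)
  refine ⟨q, fun t t' z => ?_⟩
  have := congrArg (aeval ![t, t', z]) hq
  rw [map_sub, map_mul, comp_aeval_apply, comp_aeval_apply] at this
  convert this using 2
  · congr 2
    ext j
    fin_cases j <;> simp
  · congr 2
    ext j
    fin_cases j <;> simp
  · simp

/-- The divided difference of a polynomial in two variables in the second one. -/
theorem MvPolynomial.exists_dividedDiff_right (p : MvPolynomial (Fin 2) ℂ) :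
    ∃ q : MvPolynomial (Fin 3) ℂ, ∀ {A : Type} [CommRing A] [Algebra ℂ A] (t z z' : A),
      aeval ![t, z'] p - aeval ![t, z] p = (z' - z) * aeval ![t, z, z'] q := by
  obtain ⟨q, hq⟩ := MvPolynomial.dvd_aeval_sub_aeval p
    (u := ![X 0, X 2]) (v := ![X 0, (X 1 : MvPolynomial (Fin 3) ℂ)]) (d := X 2 - X 1)
    (fun j => by fin_cases j <;> simp)
  refine ⟨q, fun t z z' => ?_⟩
  have := congrArg (aeval ![t, z, z']) hq
  rw [map_sub, map_mul, comp_aeval_apply, comp_aeval_apply] at this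
  convert this using 2
  · congr 2
    ext j
    fin_cases j <;> simp
  · congr 2
    ext j
    fin_cases j <;> simp
  · simp

/-- The equation of the slopes of the chords through a point `(x, y)`, given by the divided
differences of the equation `p` of a plane curve, and its divided difference. -/
theorem MvPolynomial.exists_dividedDiff_chord (DX DY : MvPolynomial (Fin 3) ℂ) :
    ∃ q : MvPolynomial (Fin 5) ℂ, ∀ {A : Type} [CommRing A] [Algebra ℂ A] (x y t t' a : A),
      (aeval ![x, t', y] DX + a * aeval ![t', y, y + a * (t' - x)] DY) -
      (aeval ![x, t, y] DX + a * aeval ![t, y, y + a * (t - x)] DY) =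
        (t' - t) * aeval ![x, y, t, t', a] q := by
  obtain ⟨q₁, h₁⟩ := MvPolynomial.dvd_aeval_sub_aeval DX
    (u := ![X 0, X 3, X 1]) (v := ![X 0, X 2, (X 1 : MvPolynomial (Fin 5) ℂ)]) (d := X 3 - X 2)
    (fun j => by fin_cases j <;> simp)
  obtain ⟨q₂, h₂⟩ := MvPolynomial.dvd_aeval_sub_aeval DY
    (u := ![X 3, X 1, X 1 + X 4 * (X 3 - X 0)])
    (v := ![X 2, X 1, (X 1 + X 4 * (X 2 - X 0) : MvPolynomial (Fin 5) ℂ)]) (d := X 3 - X 2)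
    (fun j => by
      fin_cases j
      · simp
      · simp
      · exact ⟨X 4, by simp; ring⟩)
  refine ⟨q₁ + X 4 * q₂, fun x y t t' a => ?_⟩
  have e₁ := congrArg (aeval ![x, y, t, t', a]) h₁
  have e₂ := congrArg (aeval ![x, y, t, t', a]) h₂
  rw [map_sub, map_mul, comp_aeval_apply, comp_aeval_apply] at e₁ e₂
  have f1 : (fun i => aeval ![x, y, t, t', a] (![X 0, X 3, (X 1 : MvPolynomial (Fin 5) ℂ)] i)) =
    ![x, t', y] := by ext j; fin_cases j <;> simp
  have f2 : (fun i => aeval ![x, y, t, t', a] (![X 0, X 2, (X 1 : MvPolynomial (Fin 5) ℂ)] i)) =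
    ![x, t, y] := by ext j; fin_cases j <;> simp
  have f3 : (fun i => aeval ![x, y, t, t', a] (![X 3, X 1, (X 1 + X 4 * (X 3 - X 0) :
    MvPolynomial (Fin 5) ℂ)] i)) = ![t', y, y + a * (t' - x)] := by ext j; fin_cases j <;> simp
  have f4 : (fun i => aeval ![x, y, t, t', a] (![X 2, X 1, (X 1 + X 4 * (X 2 - X 0) :
    MvPolynomial (Fin 5) ℂ)] i)) = ![t, y, y + a * (t - x)] := by ext j; fin_cases j <;> simp
  have f5 : aeval ![x, y, t, t', a] (X 3 - X 2 : MvPolynomial (Fin 5) ℂ) = t' - t := by simp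
  rw [f1, f2, f5] at e₁
  rw [f3, f4, f5] at e₂
  have f6 : aeval ![x, y, t, t', a] (X 4 : MvPolynomial (Fin 5) ℂ) = a := by simp
  rw [map_add, map_mul, f6]
  linear_combination e₁ + a * e₂

/-- Newton interpolation on a plane curve: the interpolating polynomial parametrizes the curve
modulo the product of the `T - xᵢ`. -/
theorem newton_interpolation {p : MvPolynomial (Fin 2) ℂ} {DX DY : MvPolynomial (Fin 3) ℂ}
    {DS : MvPolynomial (Fin 5) ℂ}
    (hDX : ∀ {A : Type} [CommRing A] [Algebra ℂ A] (t t' z : A),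
      aeval ![t', z] p - aeval ![t, z] p = (t' - t) * aeval ![t, t', z] DX)
    (hDY : ∀ {A : Type} [CommRing A] [Algebra ℂ A] (t z z' : A),
      aeval ![t, z'] p - aeval ![t, z] p = (z' - z) * aeval ![t, z, z'] DY)
    (hDS : ∀ {A : Type} [CommRing A] [Algebra ℂ A] (x y t t' a : A),
      (aeval ![x, t', y] DX + a * aeval ![t', y, y + a * (t' - x)] DY) -
      (aeval ![x, t, y] DX + a * aeval ![t, y, y + a * (t - x)] DY) =
        (t' - t) * aeval ![x, y, t, t', a] DS)
    {x₁ x₂ x₃ y₁ y₂ y₃ a a' c : ℂ} (h₁ : aeval ![x₁, y₁] p = 0)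
    (ha : y₂ = y₁ + a * (x₂ - x₁))
    (hs : aeval ![x₁, x₂, y₁] DX + a * aeval ![x₂, y₁, y₁ + a * (x₂ - x₁)] DY = 0)
    (ha' : y₃ = y₁ + a' * (x₃ - x₁))
    (hc : a' = a + c * (x₃ - x₂))
    (hs' : aeval ![x₁, y₁, x₂, x₃, a] DS + c * aeval ![x₃, y₁ + a * (x₃ - x₁), y₃] DY = 0)
    {η : Polynomial ℂ} (hη : η = Polynomial.C y₁ + (Polynomial.X - Polynomial.C x₁) *
      (Polynomial.C a + Polynomial.C c * (Polynomial.X - Polynomial.C x₂))) :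
    (η.eval x₁ = y₁ ∧ η.eval x₂ = y₂ ∧ η.eval x₃ = y₃) ∧
    (Polynomial.X - Polynomial.C x₁) * (Polynomial.X - Polynomial.C x₂) *
      (Polynomial.X - Polynomial.C x₃) ∣ aeval ![Polynomial.X, η] p := by
  have hev : η.eval x₁ = y₁ ∧ η.eval x₂ = y₂ ∧ η.eval x₃ = y₃ := by
    refine ⟨?_, ?_, ?_⟩
    · simp [hη]
    · simp [hη, ha]; ring
    · simp [hη, ha', hc]; ring
  refine ⟨hev, ?_⟩
  have hCa : ∀ {n : ℕ} (v : Fin n → ℂ) (q : MvPolynomial (Fin n) ℂ),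
      aeval (fun i => Polynomial.C (v i)) q = Polynomial.C (aeval v q) := by
    intro n v q
    exact (comp_aeval_apply (f := v) (Algebra.ofId ℂ (Polynomial ℂ)) q).symm
  have e0 : aeval ![Polynomial.C x₁, Polynomial.C y₁] p = 0 := by
    have := hCa ![x₁, y₁] p
    rw [h₁, map_zero] at this
    rw [← this]
    congr 2
    ext j : 1
    fin_cases j <;> rfl
  have e1 := hDX (Polynomial.C x₁) Polynomial.X (Polynomial.C y₁)
  have e2 := hDY Polynomial.X (Polynomial.C y₁)
    (Polynomial.C y₁ + Polynomial.C a * (Polynomial.X - Polynomial.C x₁))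
  have e3 := hDY Polynomial.X
    (Polynomial.C y₁ + Polynomial.C a * (Polynomial.X - Polynomial.C x₁)) η
  have e4 := hDS (Polynomial.C x₁) (Polynomial.C y₁) (Polynomial.C x₂) Polynomial.X
    (Polynomial.C a)
  have e5 : aeval ![Polynomial.C x₁, Polynomial.C x₂, Polynomial.C y₁] DX + Polynomial.C a *
      aeval ![Polynomial.C x₂, Polynomial.C y₁, Polynomial.C y₁ + Polynomial.C a *
        (Polynomial.C x₂ - Polynomial.C x₁)] DY = 0 := by
    have f1 := hCa ![x₁, x₂, y₁] DX
    have f2 := hCa ![x₂, y₁, y₁ + a * (x₂ - x₁)] DY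
    have g1 : (fun i => Polynomial.C (![x₁, x₂, y₁] i)) =
      ![Polynomial.C x₁, Polynomial.C x₂, Polynomial.C y₁] := by ext j : 1; fin_cases j <;> rfl
    have g2 : (fun i => Polynomial.C (![x₂, y₁, y₁ + a * (x₂ - x₁)] i)) =
      ![Polynomial.C x₂, Polynomial.C y₁, Polynomial.C y₁ + Polynomial.C a *
        (Polynomial.C x₂ - Polynomial.C x₁)] := by ext j : 1; fin_cases j <;> simp
    rw [g1] at f1
    rw [g2] at f2
    rw [f1, f2, ← Polynomial.C_mul, ← Polynomial.C_add, hs, Polynomial.C_0]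
  set Q := aeval ![Polynomial.C x₁, Polynomial.C y₁, Polynomial.C x₂, Polynomial.X,
      Polynomial.C a] DS + Polynomial.C c * aeval ![Polynomial.X, Polynomial.C y₁ +
        Polynomial.C a * (Polynomial.X - Polynomial.C x₁), η] DY with hQ
  have e6 : aeval ![Polynomial.X, η] p =
      (Polynomial.X - Polynomial.C x₁) * (Polynomial.X - Polynomial.C x₂) * Q := by
    rw [e5, sub_zero] at e4
    have e7 : η - (Polynomial.C y₁ + Polynomial.C a * (Polynomial.X - Polynomial.C x₁)) =
        Polynomial.C c * (Polynomial.X - Polynomial.C x₁) * (Polynomial.X - Polynomial.C x₂) := by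
      rw [hη]; ring
    rw [e7] at e3
    rw [hQ]
    linear_combination e3 + e2 + e1 + e0 + (Polynomial.X - Polynomial.C x₁) * e4
  have e8 : Q.eval x₃ = 0 := by
    have hE : ∀ {n : ℕ} (v : Fin n → Polynomial ℂ) (q : MvPolynomial (Fin n) ℂ),
        (aeval v q).eval x₃ = aeval (fun i => (v i).eval x₃) q := by
      intro n v q
      exact comp_aeval_apply (f := v) (Polynomial.aeval x₃ : Polynomial ℂ →ₐ[ℂ] ℂ) q
    rw [hQ, Polynomial.eval_add, Polynomial.eval_mul, hE, hE, Polynomial.eval_C]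
    rw [← hs']
    congr 3
    · ext j
      fin_cases j <;> simp
    · congr 1
      ext j
      fin_cases j <;> simp [hev.2.2]
  rw [e6]
  exact mul_dvd_mul_left _ (Polynomial.dvd_iff_isRoot.2 e8)

end

open scoped LinearAlgebra.Projectivization TensorProduct

noncomputable section

open MvPolynomial

/-- The relation between divided differences on three ordinates. -/
theorem MvPolynomial.dividedDiff_cocycle {p : MvPolynomial (Fin 2) ℂ} {DY : MvPolynomial (Fin 3) ℂ}
    (hDY : ∀ {A : Type} [CommRing A] [Algebra ℂ A] (t z z' : A),
      aeval ![t, z'] p - aeval ![t, z] p = (z' - z) * aeval ![t, z, z'] DY)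
    (t z s u w : ℂ) :
    u * aeval ![t, z, z + u * s] DY - w * aeval ![t, z, z + w * s] DY =
      (u - w) * aeval ![t, z + w * s, z + u * s] DY := by
  have key : (X 3 : MvPolynomial (Fin 5) ℂ) * aeval ![X 0, X 1, X 1 + X 3 * X 2] DY -
      X 4 * aeval ![X 0, X 1, X 1 + X 4 * X 2] DY =
      (X 3 - X 4) * aeval ![X 0, X 1 + X 4 * X 2, X 1 + X 3 * X 2] DY := by
    apply mul_left_cancel₀ (X_ne_zero (R := ℂ) (2 : Fin 5))
    have h1 := hDY (X 0 : MvPolynomial (Fin 5) ℂ) (X 1) (X 1 + X 3 * X 2)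
    have h2 := hDY (X 0 : MvPolynomial (Fin 5) ℂ) (X 1) (X 1 + X 4 * X 2)
    have h3 := hDY (X 0 : MvPolynomial (Fin 5) ℂ) (X 1 + X 4 * X 2) (X 1 + X 3 * X 2)
    linear_combination -h1 + h2 + h3
  have := congrArg (aeval ![t, z, s, u, w]) key
  simp only [map_sub, map_mul, comp_aeval_apply] at this
  have f1 : (fun i => aeval ![t, z, s, u, w] (![X 0, X 1, (X 1 + X 3 * X 2 :
    MvPolynomial (Fin 5) ℂ)] i)) = ![t, z, z + u * s] := by ext j; fin_cases j <;> simp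
  have f2 : (fun i => aeval ![t, z, s, u, w] (![X 0, X 1, (X 1 + X 4 * X 2 :
    MvPolynomial (Fin 5) ℂ)] i)) = ![t, z, z + w * s] := by ext j; fin_cases j <;> simp
  have f3 : (fun i => aeval ![t, z, s, u, w] (![X 0, X 1 + X 4 * X 2, (X 1 + X 3 * X 2 :
    MvPolynomial (Fin 5) ℂ)] i)) = ![t, z + w * s, z + u * s] := by ext j; fin_cases j <;> simp
  rw [f1, f2, f3] at this
  simpa using this

namespace SmoothPlaneQuartic

variable {C : SmoothPlaneQuartic} (b : LinCoord) {P₀ : Fin 3 → C.Point}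

theorem mem_sumOf {P : Fin 3 → C.Point} {p : C.Point} :
    p ∈ (C.sumOf P : Multiset C.Point) ↔ ∃ i, P i = p := by
  have : (C.sumOf P : Multiset C.Point) = Finset.univ.val.map P := rfl
  rw [this, Multiset.mem_map]
  simp

theorem charPoly_sumOf (P : Fin 3 → C.Point) : C.charPoly b (C.sumOf P) =
    (Polynomial.X - Polynomial.C (C.affCoord b (P 0) 1)) *
    (Polynomial.X - Polynomial.C (C.affCoord b (P 1) 1)) *
    (Polynomial.X - Polynomial.C (C.affCoord b (P 2) 1)) := by
  have : (C.sumOf P : Multiset C.Point) = Finset.univ.val.map P := rfl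
  rw [charPoly, this, Multiset.map_map]
  exact (Fin.prod_univ_three fun i => Polynomial.X - Polynomial.C (C.affCoord b (P i) 1))

theorem rep_eq_smul {p : C.Point} (hp : b.repr p.1.rep 0 ≠ 0) :
    p.1.rep = b.repr p.1.rep 0 • (b 0 + C.affCoord b p 1 • b 1 + C.affCoord b p 2 • b 2) := by
  conv_lhs => rw [← b.sum_repr p.1.rep, Fin.sum_univ_three]
  simp only [affCoord, smul_add, smul_smul]
  rw [mul_div_cancel₀ _ hp, mul_div_cancel₀ _ hp]

/-- A point is determined by its affine coordinates. -/
theorem eq_of_affCoord {p p' : C.Point} (hp : b.repr p.1.rep 0 ≠ 0) (hp' : b.repr p'.1.rep 0 ≠ 0)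
    (h1 : C.affCoord b p 1 = C.affCoord b p' 1) (h2 : C.affCoord b p 2 = C.affCoord b p' 2) :
    p = p' := by
  apply Subtype.ext
  rw [← p.1.mk_rep, ← p'.1.mk_rep, Projectivization.mk_eq_mk_iff']
  have e1 := rep_eq_smul b hp
  have e2 := rep_eq_smul b hp'
  generalize b.repr p.1.rep 0 = r at *
  generalize b.repr p'.1.rep 0 = r' at *
  refine ⟨r / r', ?_⟩
  rw [e1, e2, h1, h2, smul_smul, div_mul_cancel₀ _ hp']

/-- A regular function that solves two linear equations whose compatibility is known. -/
theorem exists_regAt_slope {x x' y y' N D : (Fin 3 → C.Point) → ℂ} (hx : x ∈ C.regAt P₀)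
    (hx' : x' ∈ C.regAt P₀) (hy : y ∈ C.regAt P₀) (hy' : y' ∈ C.regAt P₀) (hN : N ∈ C.regAt P₀)
    (hD : D ∈ C.regAt P₀)
    (h : ∀ᶠ P in C.nhd P₀, (x' P - x P) * N P + (y' P - y P) * D P = 0)
    (h0 : x P₀ ≠ x' P₀ ∨ D P₀ ≠ 0) :
    ∃ a ∈ C.regAt P₀, ∀ᶠ P in C.nhd P₀, y' P = y P + a P * (x' P - x P) ∧ N P + a P * D P = 0 := by
  rcases h0 with h0 | h0
  · have h1 : (x' - x) P₀ ≠ 0 := sub_ne_zero.2 (Ne.symm h0)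
    have h2 := (C.regAt P₀).sub_mem hx' hx
    refine ⟨_, div_mem_regAt ((C.regAt P₀).sub_mem hy' hy) h2 h1, ?_⟩
    filter_upwards [h, eventually_ne_zero_of_regAt h2 h1] with P e1 e2
    simp only [Pi.sub_apply] at e2 ⊢
    constructor
    · rw [div_mul_cancel₀ _ e2]
      ring
    · field_simp
      linear_combination e1
  · refine ⟨_, div_mem_regAt ((C.regAt P₀).neg_mem hN) hD h0, ?_⟩
    filter_upwards [h, eventually_ne_zero_of_regAt hD h0] with P e1 e2
    simp only [Pi.neg_apply]
    constructor
    · field_simp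
      linear_combination e1
    · field_simp
      ring

/-- The equation of the curve in affine coordinates. -/
def affEq (C : SmoothPlaneQuartic) (b : LinCoord) : MvPolynomial (Fin 2) ℂ :=
  LinCoord.sub b ![1, X 0, X 1] C.F

theorem aeval_affEq {A : Type*} [CommRing A] [Algebra ℂ A] (t z : A) :
    aeval ![t, z] (affEq C b) = LinCoord.sub b ![1, t, z] C.F := by
  rw [affEq, LinCoord.map_sub]
  congr 2
  ext k
  fin_cases k <;> simp

theorem aeval_affEq_affCoord {p : C.Point} (hp : b.repr p.1.rep 0 ≠ 0) :
    aeval ![C.affCoord b p 1, C.affCoord b p 2] (affEq C b) = 0 := by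
  have := C.eval_rep_eq b hp C.homogeneous
  rw [p.2] at this
  rw [aeval_affEq]
  exact (mul_eq_zero.1 this.symm).resolve_left (pow_ne_zero _ hp)

theorem aeval_dividedDiff_self {DY : MvPolynomial (Fin 3) ℂ}
    (hDY : ∀ {A : Type} [CommRing A] [Algebra ℂ A] (t z z' : A),
      aeval ![t, z'] (affEq C b) - aeval ![t, z] (affEq C b) = (z' - z) * aeval ![t, z, z'] DY)
    (t z : ℂ) : aeval ![t, z, z] DY = LinCoord.sub b ![1, t, z] (LinCoord.dirDeriv b C.F) := by
  have h1 := hDY (Polynomial.C t) (Polynomial.C z) (Polynomial.C z + Polynomial.X)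
  obtain ⟨k, hk⟩ := LinCoord.exists_sub_expansion b (Polynomial.C t) (Polynomial.C z)
    (Polynomial.C z + Polynomial.X) C.F
  rw [aeval_affEq, aeval_affEq, hk, add_sub_cancel_left, add_sub_cancel_left] at h1
  have h2 := mul_left_cancel₀ Polynomial.X_ne_zero h1
  have h3 := congrArg (Polynomial.aeval (0 : ℂ)) h2
  rw [map_add, LinCoord.map_sub, comp_aeval_apply] at h3
  simp only [map_mul, Polynomial.aeval_X, mul_zero, add_zero] at h3
  have f1 : (fun i => Polynomial.aeval (0 : ℂ) (![Polynomial.C t, Polynomial.C z,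
    Polynomial.C z + Polynomial.X] i)) = ![t, z, z] := by ext j; fin_cases j <;> simp
  have f2 : (fun i => Polynomial.aeval (0 : ℂ) (![1, Polynomial.C t, Polynomial.C z] i)) =
    ![1, t, z] := by ext j; fin_cases j <;> simp
  rw [f1, f2] at h3
  exact h3.symm

/-- Near a triple of points to which the coordinates are adapted, the coordinates stay adapted and
the divisors are parametrized by quadratic polynomials with regular coefficients. -/
theorem exists_regular_parametrization (hb : C.IsAdapted b (C.sumOf P₀)) :
    ∃ c : Fin 3 → (Fin 3 → C.Point) → ℂ, (∀ k, c k ∈ C.regAt P₀) ∧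
      ∀ᶠ P in C.nhd P₀, C.IsAdapted b (C.sumOf P) ∧
        (∀ i, (∑ k : Fin 3, Polynomial.C (c k P) * Polynomial.X ^ (k : ℕ)).eval
          (C.affCoord b (P i) 1) = C.affCoord b (P i) 2) ∧
        C.charPoly b (C.sumOf P) ∣ LinCoord.sub b ![1, Polynomial.X,
          ∑ k : Fin 3, Polynomial.C (c k P) * Polynomial.X ^ (k : ℕ)] C.F := by
  obtain ⟨DX, hDX⟩ := (affEq C b).exists_dividedDiff_left
  obtain ⟨DY, hDY⟩ := (affEq C b).exists_dividedDiff_right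
  obtain ⟨DS, hDS⟩ := exists_dividedDiff_chord DX DY
  have hfin : ∀ i, b.repr (P₀ i).1.rep 0 ≠ 0 := fun i => hb.finite _ (mem_sumOf.2 ⟨i, rfl⟩)
  have hram : ∀ i, eval (P₀ i).1.rep (LinCoord.dirDeriv b C.F) ≠ 0 :=
    fun i => hb.unramified _ (mem_sumOf.2 ⟨i, rfl⟩)
  have hreg : ∀ i k, (fun P => C.affCoord b (P i) k) ∈ C.regAt P₀ :=
    fun i k => affCoord_mem_regAt b (hfin i) k
  have hfin' : ∀ᶠ P in C.nhd P₀, ∀ i, b.repr (P i).1.rep 0 ≠ 0 := by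
    rw [Filter.eventually_all]
    intro i
    have := eventually_eval_ne_zero (P₀ := P₀) (i := i) (LinCoord.isHomogeneous_lin b 0)
      (by rw [LinCoord.eval_lin]; exact hfin i)
    simpa only [LinCoord.eval_lin] using this
  have hram' : ∀ᶠ P in C.nhd P₀, ∀ i, eval (P i).1.rep (LinCoord.dirDeriv b C.F) ≠ 0 := by
    rw [Filter.eventually_all]
    exact fun i => eventually_eval_ne_zero (LinCoord.isHomogeneous_dirDeriv b C.homogeneous)
      (hram i)
  have hdiag : ∀ i, aeval ![C.affCoord b (P₀ i) 1, C.affCoord b (P₀ i) 2,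
      C.affCoord b (P₀ i) 2] DY ≠ 0 := by
    intro i
    rw [aeval_dividedDiff_self b hDY]
    have := hram i
    rw [C.eval_rep_eq b (hfin i) (LinCoord.isHomogeneous_dirDeriv b C.homogeneous)] at this
    exact right_ne_zero_of_mul this
  have hcase : ∀ i j, C.affCoord b (P₀ i) 1 ≠ C.affCoord b (P₀ j) 1 ∨ P₀ i = P₀ j := by
    intro i j
    by_cases h : C.affCoord b (P₀ i) 1 = C.affCoord b (P₀ j) 1
    · exact Or.inr (hb.separated _ (mem_sumOf.2 ⟨i, rfl⟩) _ (mem_sumOf.2 ⟨j, rfl⟩) h)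
    · exact Or.inl h
  have hDYreg : ∀ {f g h : (Fin 3 → C.Point) → ℂ}, f ∈ C.regAt P₀ → g ∈ C.regAt P₀ →
      h ∈ C.regAt P₀ → ∀ D : MvPolynomial (Fin 3) ℂ,
      (fun P => aeval ![f P, g P, h P] D) ∈ C.regAt P₀ := by
    intro f g h hf hg hh D
    have := aeval_mem_regAt (g := ![f, g, h]) (P₀ := P₀)
      (fun j => by fin_cases j <;> assumption) D
    convert this using 4 with P
    ext j
    fin_cases j <;> rfl
  have hsep : ∀ᶠ P in C.nhd P₀, ∀ i j, C.affCoord b (P i) 1 = C.affCoord b (P j) 1 →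
      P i = P j := by
    rw [Filter.eventually_all]
    intro i
    rw [Filter.eventually_all]
    intro j
    rcases hcase i j with h | h
    · have h1 := (C.regAt P₀).sub_mem (hreg i 1) (hreg j 1)
      filter_upwards [eventually_ne_zero_of_regAt h1 (sub_ne_zero.2 h)] with P hP e
      exact absurd e (sub_ne_zero.1 hP)
    · have h1 := hDYreg (hreg j 1) (hreg i 2) (hreg j 2) DY
      have h2 := eventually_ne_zero_of_regAt h1 (by
        simp only [h]
        exact hdiag j)
      filter_upwards [h2, hfin'] with P hP hf e
      refine eq_of_affCoord b (hf i) (hf j) e ?_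
      have h3 := hDY (C.affCoord b (P j) 1) (C.affCoord b (P i) 2) (C.affCoord b (P j) 2)
      rw [aeval_affEq_affCoord b (hf j), ← e, aeval_affEq_affCoord b (hf i), sub_zero, e] at h3
      exact (sub_eq_zero.1 ((mul_eq_zero.1 h3.symm).resolve_right hP)).symm
  have hchord : ∀ j : Fin 3, ∃ a ∈ C.regAt P₀, ∀ᶠ P in C.nhd P₀,
      C.affCoord b (P j) 2 = C.affCoord b (P 0) 2 +
        a P * (C.affCoord b (P j) 1 - C.affCoord b (P 0) 1) ∧
      aeval ![C.affCoord b (P 0) 1, C.affCoord b (P j) 1, C.affCoord b (P 0) 2] DX + a P *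
        aeval ![C.affCoord b (P j) 1, C.affCoord b (P 0) 2, C.affCoord b (P j) 2] DY = 0 := by
    intro j
    refine exists_regAt_slope (hreg 0 1) (hreg j 1) (hreg 0 2) (hreg j 2)
      (hDYreg (hreg 0 1) (hreg j 1) (hreg 0 2) DX) (hDYreg (hreg j 1) (hreg 0 2) (hreg j 2) DY)
      ?_ ?_
    · filter_upwards [hfin'] with P hf
      have e1 := hDX (C.affCoord b (P 0) 1) (C.affCoord b (P j) 1) (C.affCoord b (P 0) 2)
      have e2 := hDY (C.affCoord b (P j) 1) (C.affCoord b (P 0) 2) (C.affCoord b (P j) 2)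
      rw [aeval_affEq_affCoord b (hf 0)] at e1
      rw [aeval_affEq_affCoord b (hf j)] at e2
      linear_combination -e1 - e2
    · rcases hcase 0 j with h | h
      · exact Or.inl h
      · right
        simp only [h]
        exact hdiag j
  obtain ⟨a, ha, hsa⟩ := hchord 1
  obtain ⟨a', ha', hsa'⟩ := hchord 2
  have hmid : (fun P => C.affCoord b (P 0) 2 + a P * (C.affCoord b (P 2) 1 -
      C.affCoord b (P 0) 1)) ∈ C.regAt P₀ :=
    (C.regAt P₀).add_mem (hreg 0 2) ((C.regAt P₀).mul_mem ha
      ((C.regAt P₀).sub_mem (hreg 2 1) (hreg 0 1)))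
  have hDSreg : (fun P => aeval ![C.affCoord b (P 0) 1, C.affCoord b (P 0) 2,
      C.affCoord b (P 1) 1, C.affCoord b (P 2) 1, a P] DS) ∈ C.regAt P₀ := by
    have := aeval_mem_regAt (g := ![fun P => C.affCoord b (P 0) 1, fun P => C.affCoord b (P 0) 2,
      fun P => C.affCoord b (P 1) 1, fun P => C.affCoord b (P 2) 1, a]) (P₀ := P₀)
      (fun j => by fin_cases j <;> first | exact hreg _ _ | exact ha) DS
    convert this using 4 with P
    ext j
    fin_cases j <;> rfl
  obtain ⟨c, hc, hsc⟩ := exists_regAt_slope (hreg 1 1) (hreg 2 1) ha ha' hDSreg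
    (hDYreg (hreg 2 1) hmid (hreg 2 2) DY) (by
      filter_upwards [hsa, hsa'] with P h1 h2
      have e1 := hDS (C.affCoord b (P 0) 1) (C.affCoord b (P 0) 2) (C.affCoord b (P 1) 1)
        (C.affCoord b (P 2) 1) (a P)
      have e2 := dividedDiff_cocycle hDY (C.affCoord b (P 2) 1) (C.affCoord b (P 0) 2)
        (C.affCoord b (P 2) 1 - C.affCoord b (P 0) 1) (a' P) (a P)
      rw [← h1.1] at e1
      rw [← h2.1] at e2
      linear_combination -e1 - e2 + h2.2 - h1.2) (by
      rcases hcase 1 2 with h | h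
      · exact Or.inl h
      · right
        have := (eventually_nhd_self hsa).1
        rw [h] at this
        simp only [← this]
        exact hdiag 2)
  refine ⟨![fun P => C.affCoord b (P 0) 2 - C.affCoord b (P 0) 1 * a P +
    c P * (C.affCoord b (P 0) 1 * C.affCoord b (P 1) 1),
    fun P => a P - c P * (C.affCoord b (P 0) 1 + C.affCoord b (P 1) 1), c], ?_, ?_⟩
  · intro k
    fin_cases k
    · exact (C.regAt P₀).add_mem ((C.regAt P₀).sub_mem (hreg 0 2)
        ((C.regAt P₀).mul_mem (hreg 0 1) ha)) ((C.regAt P₀).mul_mem hc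
          ((C.regAt P₀).mul_mem (hreg 0 1) (hreg 1 1)))
    · exact (C.regAt P₀).sub_mem ha ((C.regAt P₀).mul_mem hc
        ((C.regAt P₀).add_mem (hreg 0 1) (hreg 1 1)))
    · exact hc
  · filter_upwards [hsa, hsa', hsc, hfin', hram', hsep] with P h1 h2 h3 h4 h5 h6
    have hN := newton_interpolation hDX hDY hDS (aeval_affEq_affCoord b (h4 0)) h1.1
      (by rw [← h1.1]; exact h1.2) h2.1 h3.1 h3.2 rfl
    have heta : ∑ k : Fin 3, Polynomial.C ((![fun P => C.affCoord b (P 0) 2 -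
        C.affCoord b (P 0) 1 * a P + c P * (C.affCoord b (P 0) 1 * C.affCoord b (P 1) 1),
        fun P => a P - c P * (C.affCoord b (P 0) 1 + C.affCoord b (P 1) 1), c] :
        Fin 3 → (Fin 3 → C.Point) → ℂ) k P) * Polynomial.X ^ (k : ℕ) =
        Polynomial.C (C.affCoord b (P 0) 2) + (Polynomial.X - Polynomial.C (C.affCoord b (P 0) 1)) *
        (Polynomial.C (a P) + Polynomial.C (c P) *
          (Polynomial.X - Polynomial.C (C.affCoord b (P 1) 1))) := by
      simp [Fin.sum_univ_three]
      ring
    rw [heta]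
    refine ⟨⟨?_, ?_, ?_⟩, ?_, ?_⟩
    · intro p hp
      obtain ⟨i, rfl⟩ := mem_sumOf.1 hp
      exact h4 i
    · intro p hp
      obtain ⟨i, rfl⟩ := mem_sumOf.1 hp
      exact h5 i
    · intro p hp p' hp'
      obtain ⟨i, rfl⟩ := mem_sumOf.1 hp
      obtain ⟨j, rfl⟩ := mem_sumOf.1 hp'
      exact h6 i j
    · intro i
      fin_cases i
      · exact hN.1.1
      · exact hN.1.2.1
      · exact hN.1.2.2
    · rw [charPoly_sumOf, ← aeval_affEq]
      exact hN.2

end SmoothPlaneQuartic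
end

open scoped LinearAlgebra.Projectivization TensorProduct

noncomputable section

open MvPolynomial

/-- There are vectors outside finitely many proper subspaces and a hypersurface. -/
theorem exists_vector_avoiding {ι : Type*} [Finite ι] (W : ι → Submodule ℂ (Fin 3 → ℂ))
    (hW : ∀ i, W i ≠ ⊤) {G : MvPolynomial (Fin 3) ℂ} (hG : G ≠ 0) :
    ∃ e, eval e G ≠ 0 ∧ ∀ i, e ∉ W i := by
  have := Fintype.ofFinite ι
  choose f hf0 hf using fun i => Submodule.exists_le_ker_of_lt_top (W i) (lt_top_iff_ne_top.2 (hW i))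
  let g : ι → MvPolynomial (Fin 3) ℂ := fun i => ∑ j, MvPolynomial.C (f i (Pi.single j 1)) * X j
  have hg : ∀ i v, eval v (g i) = f i v := by
    intro i v
    conv_rhs => rw [pi_eq_sum_univ' v]
    simp [g, mul_comm]
  have hg0 : ∀ i, g i ≠ 0 := by
    intro i h
    apply hf0 i
    ext j
    have := hg i (Pi.single j 1)
    rw [h, map_zero] at this
    simpa using this.symm
  have h0 : G * ∏ i, g i ≠ 0 := mul_ne_zero hG (Finset.prod_ne_zero_iff.2 fun i _ => hg0 i)
  obtain ⟨e, he⟩ : ∃ e, eval e (G * ∏ i, g i) ≠ 0 := by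
    by_contra! h
    exact h0 (MvPolynomial.funext fun v => by rw [h v, map_zero])
  rw [map_mul, map_prod] at he
  refine ⟨e, left_ne_zero_of_mul he, fun i hi => ?_⟩
  have h1 := Finset.prod_ne_zero_iff.1 (right_ne_zero_of_mul he) i (Finset.mem_univ i)
  rw [hg] at h1
  exact h1 (hf i hi)

theorem span_pair_ne_top (u v : Fin 3 → ℂ) : Submodule.span ℂ {u, v} ≠ ⊤ := by
  intro h
  have h1 : Module.finrank ℂ (Submodule.span ℂ {u, v}) = 3 := by
    rw [h, finrank_top, Module.finrank_fin_fun]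
  have h2 := finrank_span_le_card (R := ℂ) ({u, v} : Set (Fin 3 → ℂ))
  have h3 : ({u, v} : Set (Fin 3 → ℂ)).toFinset.card ≤ 2 := by
    rw [Set.toFinset_insert, Set.toFinset_singleton]
    exact Finset.card_le_two
  omega

namespace SmoothPlaneQuartic

variable {C : SmoothPlaneQuartic}

theorem exists_isAdapted (P : Fin 3 → C.Point) :
    ∃ b : LinCoord, C.IsAdapted b (C.sumOf P) ∧ eval (b 2) C.F ≠ 0 := by
  let T : Fin 3 → Module.Dual ℂ (Fin 3 → ℂ) := fun i =>
    ∑ j, eval (P i).1.rep (pderiv j C.F) • LinearMap.proj j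
  have hT : ∀ i, LinearMap.ker (T i) ≠ ⊤ := by
    intro i h
    rw [LinearMap.ker_eq_top] at h
    obtain ⟨j, hj⟩ := C.smooth _ (P i).1.rep_nonzero (P i).2
    apply hj
    have := LinearMap.congr_fun h (Pi.single j 1)
    simpa [T, Pi.single_apply] using this
  obtain ⟨e, heF, he⟩ := exists_vector_avoiding
    (Sum.elim (fun i => LinearMap.ker (T i))
      (fun ij : Fin 3 × Fin 3 => Submodule.span ℂ {(P ij.1).1.rep, (P ij.2).1.rep}))
    (by
      rintro (i | ij)
      · exact hT i
      · exact span_pair_ne_top _ _) C.F_ne_zero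
  have heT : ∀ i, T i e ≠ 0 := fun i h => he (Sum.inl i) h
  have heS : ∀ i j, e ∉ Submodule.span ℂ {(P i).1.rep, (P j).1.rep} := fun i j => he (Sum.inr (i, j))
  obtain ⟨w, -, hw⟩ := exists_vector_avoiding (fun i => Submodule.span ℂ {e, (P i).1.rep})
    (fun i => span_pair_ne_top _ _) (one_ne_zero (α := MvPolynomial (Fin 3) ℂ))
  have he0 : e ≠ 0 := fun h => heS 0 0 (h ▸ Submodule.zero_mem _)
  have hw0 : w ≠ 0 := fun h => hw 0 (h ▸ Submodule.zero_mem _)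
  have hPi : ∀ i, (P i).1.rep ∉ Submodule.span ℂ {w, e} := by
    intro i h
    obtain ⟨α, β, h⟩ := Submodule.mem_span_pair.1 h
    by_cases hα : α = 0
    · rw [hα, zero_smul, zero_add] at h
      by_cases hβ : β = 0
      · rw [hβ, zero_smul] at h
        exact (P i).1.rep_nonzero h.symm
      · refine heS i i (Submodule.mem_span_pair.2 ⟨β⁻¹, 0, ?_⟩)
        rw [← h, smul_smul, inv_mul_cancel₀ hβ, one_smul, zero_smul, add_zero]
    · refine hw i (Submodule.mem_span_pair.2 ⟨-(α⁻¹ * β), α⁻¹, ?_⟩)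
      rw [← h, smul_add, smul_smul, smul_smul, inv_mul_cancel₀ hα, one_smul, neg_smul]
      abel
  have hli : LinearIndependent ℂ ![(P 0).1.rep, w, e] := by
    change LinearIndependent ℂ (Fin.cons (P 0).1.rep ![w, e] : Fin 3 → Fin 3 → ℂ)
    rw [linearIndependent_finCons]
    refine ⟨?_, ?_⟩
    · rw [LinearIndependent.pair_iff' hw0]
      intro a h
      refine hw 0 (Submodule.mem_span_pair.2 ⟨a⁻¹, 0, ?_⟩)
      have ha : a ≠ 0 := by
        rintro rfl
        exact he0 (by rw [← h, zero_smul])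
      rw [← h, smul_smul, inv_mul_cancel₀ ha, one_smul, zero_smul, add_zero]
    · simpa [Set.pair_comm e w] using hPi 0
  let b : LinCoord := basisOfLinearIndependentOfCardEqFinrank hli (by simp)
  have hb : ⇑b = ![(P 0).1.rep, w, e] := coe_basisOfLinearIndependentOfCardEqFinrank _ _
  have hb1 : b 1 = w := by rw [hb]; rfl
  have hb2 : b 2 = e := by rw [hb]; rfl
  have hfin : ∀ i, b.repr (P i).1.rep 0 ≠ 0 := by
    intro i h
    apply hPi i
    have h1 := b.sum_repr (P i).1.rep
    rw [Fin.sum_univ_three, h, zero_smul, zero_add, hb1, hb2] at h1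
    exact Submodule.mem_span_pair.2 ⟨_, _, h1⟩
  refine ⟨b, ⟨?_, ?_, ?_⟩, hb2 ▸ heF⟩
  · intro p hp
    obtain ⟨i, rfl⟩ := mem_sumOf.1 hp
    exact hfin i
  · intro p hp
    obtain ⟨i, rfl⟩ := mem_sumOf.1 hp
    have := heT i
    simp only [T, LinearMap.sum_apply, LinearMap.smul_apply, LinearMap.proj_apply,
      smul_eq_mul] at this
    simpa [LinCoord.dirDeriv, hb2, mul_comm] using this
  · intro p hp p' hp' h
    obtain ⟨i, rfl⟩ := mem_sumOf.1 hp
    obtain ⟨j, rfl⟩ := mem_sumOf.1 hp'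
    refine eq_of_affCoord b (hfin i) (hfin j) h ?_
    by_contra hne
    apply heS i j
    have e1 := rep_eq_smul b (hfin i)
    have e2 := rep_eq_smul b (hfin j)
    have hi := hfin i
    have hj := hfin j
    generalize b.repr (P i).1.rep 0 = r at *
    generalize b.repr (P j).1.rep 0 = r' at *
    have hd : C.affCoord b (P i) 2 - C.affCoord b (P j) 2 ≠ 0 := sub_ne_zero.2 hne
    refine Submodule.mem_span_pair.2
      ⟨(C.affCoord b (P i) 2 - C.affCoord b (P j) 2)⁻¹ * r⁻¹,
        -((C.affCoord b (P i) 2 - C.affCoord b (P j) 2)⁻¹ * r'⁻¹), ?_⟩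
    rw [e1, e2, h, hb2]
    ext k
    simp only [Pi.add_apply, Pi.smul_apply, smul_eq_mul]
    field_simp
    ring

theorem exists_sumOf_eq (t : C.Sym3) : ∃ P, C.sumOf P = t := by
  obtain ⟨⟨l⟩, hl⟩ := t
  have hl' : l.length = 3 := hl
  refine ⟨fun i => l.get (i.cast hl'.symm), Subtype.ext ?_⟩
  change Multiset.map _ (Finset.univ : Finset (Fin 3)).val = (l : Multiset C.Point)
  match l, hl' with
  | [x, y, z], _ => rfl

end SmoothPlaneQuartic
end

open scoped LinearAlgebra.Projectivization TensorProduct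

noncomputable section

open MvPolynomial

theorem MvPolynomial.finrank_homogeneousSubmodule_fin (n d : ℕ) :
    Module.finrank ℂ (homogeneousSubmodule (Fin n) ℂ d) = n.multichoose d := by
  classical
  have h : ((Finset.univ : Finset (Fin n)).finsuppAntidiag d : Set (Fin n →₀ ℕ)) =
      {e : Fin n →₀ ℕ | e.degree = d} := by
    ext e
    simp [Finset.mem_finsuppAntidiag, Finsupp.degree_eq_sum]
  rw [homogeneousSubmodule_eq_finsupp_supported, ← h,
    (AddMonoidAlgebra.supportedEquivFinsupp _).finrank_eq, Module.finrank_finsupp_self]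
  rw [← Nat.card_eq_fintype_card, Nat.card_coe_set_eq, Set.ncard_coe_finset,
    Finset.card_finsuppAntidiag_nat_eq_multichoose, Finset.card_univ, Fintype.card_fin]

instance MvPolynomial.finite_homogeneousSubmodule (n d : ℕ) :
    Module.Finite ℂ (homogeneousSubmodule (Fin n) ℂ d) :=
  Module.Finite.iff_fg.2 (homogeneousSubmodule_fg _ _ d)

theorem MvPolynomial.homogeneousSubmodule_mul_eq (n d e : ℕ) :
    homogeneousSubmodule (Fin n) ℂ d * homogeneousSubmodule (Fin n) ℂ e =
      homogeneousSubmodule (Fin n) ℂ (d + e) := by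
  rw [← homogeneousSubmodule_one_pow ℂ d, ← homogeneousSubmodule_one_pow ℂ e, ← pow_add,
    homogeneousSubmodule_one_pow]

namespace QuadraticForm

variable {B : Type*} [AddCommGroup B] [Module ℂ B] [FiniteDimensional ℂ B]
  {A A' : Type*} [CommRing A] [Algebra ℂ A] [CommRing A'] [Algebra ℂ A']

/-- A quadratic form on the dual of `B`, as an element of `Sym² B`, evaluated along a linear map
from `B` to an algebra. -/
def contract (f : B →ₗ[ℂ] A) : QuadraticForm ℂ (Module.Dual ℂ B) →ₗ[ℂ] A where
  toFun G := ∑ i, ∑ j, (2⁻¹ * QuadraticMap.polar G ((Module.finBasis ℂ B).coord i)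
    ((Module.finBasis ℂ B).coord j)) • (f (Module.finBasis ℂ B i) * f (Module.finBasis ℂ B j))
  map_add' G H := by
    simp only [FunLike.coe_add, QuadraticMap.polar_add, mul_add, add_smul,
      Finset.sum_add_distrib]
  map_smul' c G := by
    simp only [FunLike.coe_smul, QuadraticMap.polar_smul, Finset.smul_sum, smul_eq_mul,
      RingHom.id_apply, smul_smul]
    simp only [mul_left_comm]

theorem contract_apply (f : B →ₗ[ℂ] A) (G : QuadraticForm ℂ (Module.Dual ℂ B)) :
    contract f G = ∑ i, ∑ j, (2⁻¹ * QuadraticMap.polar G ((Module.finBasis ℂ B).coord i)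
      ((Module.finBasis ℂ B).coord j)) •
        (f (Module.finBasis ℂ B i) * f (Module.finBasis ℂ B j)) := rfl

theorem map_contract (h : A →ₐ[ℂ] A') (f : B →ₗ[ℂ] A) (G : QuadraticForm ℂ (Module.Dual ℂ B)) :
    h (contract f G) = contract (h.toLinearMap ∘ₗ f) G := by
  simp [contract_apply, map_sum]

theorem contract_dual (φ : Module.Dual ℂ B) (G : QuadraticForm ℂ (Module.Dual ℂ B)) :
    contract φ G = G φ := by
  have h : φ = ∑ i, φ (Module.finBasis ℂ B i) • (Module.finBasis ℂ B).coord i :=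
    ((Module.finBasis ℂ B).sum_dual_apply_smul_coord φ).symm
  have h2 : G φ = 2⁻¹ * G.polarBilin φ φ := by
    rw [QuadraticMap.polarBilin_apply_apply, QuadraticMap.polar_self]
    simp
  rw [h2]
  conv_rhs => rw [h]
  simp only [contract_apply, map_sum, map_smul, LinearMap.sum_apply, LinearMap.smul_apply,
    QuadraticMap.polarBilin_apply_apply, smul_eq_mul, Finset.mul_sum]
  rw [Finset.sum_comm]
  refine Finset.sum_congr rfl fun i _ => Finset.sum_congr rfl fun j _ => ?_
  ring

theorem contract_linMulLin (f : B →ₗ[ℂ] A) (s s' : B) :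
    contract f (QuadraticMap.linMulLin (Module.Dual.eval ℂ B s) (Module.Dual.eval ℂ B s')) =
      f s * f s' := by
  have hs : ∀ s, f s = ∑ i, (Module.finBasis ℂ B).coord i s • f (Module.finBasis ℂ B i) := by
    intro s
    conv_lhs => rw [← (Module.finBasis ℂ B).sum_repr s]
    simp only [map_sum, map_smul, Module.Basis.coord_apply]
  have hp : ∀ x y : Module.Dual ℂ B, QuadraticMap.polar (QuadraticMap.linMulLin
      (Module.Dual.eval ℂ B s) (Module.Dual.eval ℂ B s')) x y = x s * y s' + y s * x s' := by
    intro x y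
    simp [QuadraticMap.polar]
    ring
  have h1 : f s * f s' = ∑ i, ∑ j, ((Module.finBasis ℂ B).coord i s *
      (Module.finBasis ℂ B).coord j s') • (f (Module.finBasis ℂ B i) *
        f (Module.finBasis ℂ B j)) := by
    rw [hs s, hs s', Finset.sum_mul_sum]
    refine Finset.sum_congr rfl fun i _ => Finset.sum_congr rfl fun j _ => ?_
    rw [smul_mul_smul_comm]
  have h2 : f s * f s' = ∑ i, ∑ j, ((Module.finBasis ℂ B).coord j s *
      (Module.finBasis ℂ B).coord i s') • (f (Module.finBasis ℂ B i) *
        f (Module.finBasis ℂ B j)) := by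
    rw [h1, Finset.sum_comm]
    refine Finset.sum_congr rfl fun i _ => Finset.sum_congr rfl fun j _ => ?_
    rw [mul_comm (f _)]
  have h3 : f s * f s' = (2⁻¹ : ℂ) • (f s * f s' + f s * f s') := by
    rw [← two_smul ℂ, smul_smul]
    norm_num
  rw [h3]
  conv_rhs => rw [h1]
  conv_rhs =>
    enter [2, 2]
    rw [← h1, h2]
  rw [contract_apply, ← Finset.sum_add_distrib, Finset.smul_sum]
  refine Finset.sum_congr rfl fun i _ => ?_
  rw [← Finset.sum_add_distrib, Finset.smul_sum]
  refine Finset.sum_congr rfl fun j _ => ?_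
  rw [← add_smul, smul_smul, hp]

theorem contract_mem (f : B →ₗ[ℂ] A) (N N' : Submodule ℂ A) (hf : ∀ s, f s ∈ N)
    (hN : N * N ≤ N') (G : QuadraticForm ℂ (Module.Dual ℂ B)) : contract f G ∈ N' := by
  rw [contract_apply]
  exact Submodule.sum_mem _ fun i _ => Submodule.sum_mem _ fun j _ => N'.smul_mem _
    (hN (Submodule.mul_mem_mul (hf _) (hf _)))

theorem range_contract (f : B →ₗ[ℂ] A) :
    LinearMap.range (contract f) = LinearMap.range f * LinearMap.range f := by
  apply le_antisymm
  · rintro _ ⟨G, rfl⟩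
    exact contract_mem f _ _ (fun s => LinearMap.mem_range_self f s) le_rfl G
  · rw [Submodule.mul_le]
    rintro _ ⟨s, rfl⟩ _ ⟨s', rfl⟩
    exact ⟨_, contract_linMulLin f s s'⟩

variable (B) in
theorem finrank_quadraticForm_dual :
    Module.finrank ℂ (QuadraticForm ℂ (Module.Dual ℂ B)) =
      (Module.finrank ℂ B).multichoose 2 := by
  set n := Module.finrank ℂ B
  set f : B →ₗ[ℂ] MvPolynomial (Fin n) ℂ := (Module.finBasis ℂ B).constr ℂ X with hf
  have hr : LinearMap.range f = homogeneousSubmodule (Fin n) ℂ 1 := by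
    rw [hf, Module.Basis.constr_range, homogeneousSubmodule_one_eq_span_X]
  have hinj : Function.Injective (contract f) := by
    rw [injective_iff_map_eq_zero]
    intro G hG
    ext φ
    have h1 : (aeval (R := ℂ) fun i => φ (Module.finBasis ℂ B i)).toLinearMap ∘ₗ f = φ := by
      refine (Module.finBasis ℂ B).ext fun i => ?_
      simp [hf]
    rw [← contract_dual, ← h1, ← map_contract, hG]
    simp
  rw [(LinearEquiv.ofInjective _ hinj).finrank_eq, range_contract, hr,
    homogeneousSubmodule_mul_eq, finrank_homogeneousSubmodule_fin]

instance : Module.Finite ℂ (QuadraticForm ℂ (Module.Dual ℂ B)) := by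
  by_cases h : Module.finrank ℂ B = 0
  · have : Subsingleton B := Module.finrank_zero_iff.1 h
    have : Subsingleton (QuadraticForm ℂ (Module.Dual ℂ B)) := ⟨fun G H => by
      ext φ
      rw [Subsingleton.elim φ 0]
      simp⟩
    infer_instance
  · apply Module.finite_of_finrank_pos
    rw [finrank_quadraticForm_dual, Nat.multichoose_eq]
    exact Nat.choose_pos (by omega)

end QuadraticForm

namespace SmoothPlaneQuartic

variable (C : SmoothPlaneQuartic)

instance : Module.Finite ℂ (C.bicanonicalSections 0) :=
  Module.Finite.equiv C.bicanEquiv.symm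

theorem finrank_bicanonicalSections : Module.finrank ℂ (C.bicanonicalSections 0) = 6 := by
  rw [C.bicanEquiv.finrank_eq, finrank_homogeneousSubmodule_fin, Nat.multichoose_eq]
  rfl

theorem finrank_bicanDual : Module.finrank ℂ C.BicanDual = 6 := by
  rw [Subspace.dual_finrank_eq, finrank_bicanonicalSections]

/-- A bicanonical section as a form of degree two. -/
def conic : C.bicanonicalSections 0 →ₗ[ℂ] MvPolynomial (Fin 3) ℂ :=
  Submodule.subtype _ ∘ₗ C.bicanEquiv.toLinearMap

theorem conic_apply (s : C.bicanonicalSections 0) : C.conic s = C.bicanEquiv s := rfl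

theorem isHomogeneous_conic (s : C.bicanonicalSections 0) : (C.conic s).IsHomogeneous 2 :=
  (C.bicanEquiv s).2

theorem conic_injective : Function.Injective C.conic :=
  Subtype.val_injective.comp C.bicanEquiv.injective

theorem range_conic : LinearMap.range C.conic = homogeneousSubmodule (Fin 3) ℂ 2 := by
  rw [conic, LinearMap.range_comp]
  simp

theorem exists_conic_eq {G : MvPolynomial (Fin 3) ℂ} (hG : G.IsHomogeneous 2) :
    ∃ s, C.conic s = G := by
  have : G ∈ LinearMap.range C.conic := by rwa [range_conic]
  exact this

/-- Evaluation of conics at a vector. -/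
def evalDual (v : Fin 3 → ℂ) : C.BicanDual := (aeval v).toLinearMap ∘ₗ C.conic

theorem evalDual_apply (v : Fin 3 → ℂ) (s : C.bicanonicalSections 0) :
    C.evalDual v s = eval v (C.conic s) := by
  simp [evalDual, aeval_eq_eval]

theorem quadric_evalDual (v : Fin 3 → ℂ) (G : QuadraticForm ℂ C.BicanDual) :
    G (C.evalDual v) = eval v (QuadraticForm.contract C.conic G) := by
  rw [← QuadraticForm.contract_dual, evalDual, ← QuadraticForm.map_contract]
  simp [aeval_eq_eval]

theorem mem_quadricsThrough_iff {Z : Set C.P5} {G : QuadraticForm ℂ C.BicanDual} :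
    G ∈ C.quadricsThrough Z ↔ ∀ φ : C.BicanDual, ∀ h : φ ≠ 0,
      Projectivization.mk ℂ φ h ∈ Z → G φ = 0 := by
  constructor
  · intro hG φ h hφ
    have h1 := hG _ hφ
    obtain ⟨a, ha⟩ := Projectivization.exists_smul_eq_mk_rep ℂ φ h
    rw [← ha, Units.smul_def, QuadraticMap.map_smul] at h1
    simpa using h1
  · intro h φ hφ
    exact h _ φ.rep_nonzero (by rwa [Projectivization.mk_rep])

theorem mk_mem_linSpan {t : Multiset C.Point} {φ : C.BicanDual} {h : φ ≠ 0} :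
    Projectivization.mk ℂ φ h ∈ C.linSpan t ↔ φ ∈ C.spanDual t := by
  rw [linSpan, Set.mem_ofPred_eq, Projectivization.submodule_mk, Submodule.span_singleton_le_iff_mem]

theorem mem_quadricsThrough_linSpan {t : Multiset C.Point} {G : QuadraticForm ℂ C.BicanDual} :
    G ∈ C.quadricsThrough (C.linSpan t) ↔ ∀ φ ∈ C.spanDual t, G φ = 0 := by
  rw [mem_quadricsThrough_iff]
  constructor
  · intro h φ hφ
    by_cases h0 : φ = 0
    · simp [h0]
    · exact h φ h0 (C.mk_mem_linSpan.2 hφ)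
  · intro h φ h0 hφ
    exact h φ (C.mk_mem_linSpan.1 hφ)

theorem quadricsThrough_union (Z Z' : Set C.P5) :
    C.quadricsThrough (Z ∪ Z') = C.quadricsThrough Z ⊓ C.quadricsThrough Z' := by
  ext G
  constructor
  · intro h
    exact ⟨fun φ hφ => h φ (Or.inl hφ), fun φ hφ => h φ (Or.inr hφ)⟩
  · rintro ⟨h, h'⟩ φ (hφ | hφ)
    exacts [h φ hφ, h' φ hφ]

theorem subset_quadric_iff {Z : Set C.P5} {G : C.P6} :
    Z ⊆ C.quadric G ↔ (G.rep : QuadraticForm ℂ C.BicanDual) ∈ C.quadricsThrough Z := Iff.rfl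

end SmoothPlaneQuartic
end

open scoped LinearAlgebra.Projectivization TensorProduct

noncomputable section

open MvPolynomial

namespace SmoothPlaneQuartic

variable {C : SmoothPlaneQuartic}

/-! ### Quadrics through the bicanonical curve -/

theorem mem_forms_singleton {x : C.Point} {d : ℕ} {G : MvPolynomial (Fin 3) ℂ}
    (hG : G.IsHomogeneous d) : G ∈ C.forms d {x} ↔ eval x.1.rep G = 0 := by
  obtain ⟨b, hb, -⟩ := C.exists_isAdapted fun _ => x
  have hx : x ∈ (C.sumOf fun _ => x : Multiset C.Point) := mem_sumOf.2 ⟨0, rfl⟩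
  have hb' : C.IsAdapted b {x} := by
    refine ⟨fun p hp => ?_, fun p hp => ?_, fun p hp p' hp' _ => ?_⟩
    · rw [Multiset.mem_singleton.1 hp]
      exact hb.finite x hx
    · rw [Multiset.mem_singleton.1 hp]
      exact hb.unramified x hx
    · rw [Multiset.mem_singleton.1 hp, Multiset.mem_singleton.1 hp']
  have h0 := hb.finite x hx
  have key : ∀ {n : ℕ} {H : MvPolynomial (Fin 3) ℂ}, H.IsHomogeneous n →
      (C.charPoly b {x} ∣ LinCoord.sub b
        ![1, Polynomial.X, Polynomial.C (C.affCoord b x 2)] H ↔ eval x.1.rep H = 0) := by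
    intro n H hH
    have h1 : (LinCoord.sub b ![1, Polynomial.X, Polynomial.C (C.affCoord b x 2)] H).eval
        (C.affCoord b x 1) = LinCoord.sub b ![1, C.affCoord b x 1, C.affCoord b x 2] H := by
      rw [← Polynomial.coe_aeval_eq_eval, LinCoord.map_sub]
      congr 2
      ext k
      fin_cases k <;> simp
    rw [charPoly, Multiset.map_singleton, Multiset.prod_singleton, Polynomial.dvd_iff_isRoot,
      Polynomial.IsRoot, h1, C.eval_rep_eq b h0 hH]
    simp [h0]
  rw [C.mem_forms_iff_dvd b hb' (η := Polynomial.C (C.affCoord b x 2)) ?_ ?_ hG, key hG]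
  · intro p hp
    rw [Multiset.mem_singleton.1 hp]
    simp
  · rw [key C.homogeneous]
    exact x.2

theorem evalDual_mem_spanDual (x : C.Point) : C.evalDual x.1.rep ∈ C.spanDual {x} := by
  rw [mem_spanDual]
  intro s hs
  rw [evalDual_apply]
  exact (mem_forms_singleton (C.isHomogeneous_conic s)).1 hs

theorem exists_eq_smul_evalDual {x : C.Point} {φ : C.BicanDual} (hφ : φ ∈ C.spanDual {x}) :
    ∃ c : ℂ, φ = c • C.evalDual x.1.rep := by
  rw [mem_spanDual] at hφ
  have h : ⨅ _ : Unit, LinearMap.ker (C.evalDual x.1.rep) ≤ LinearMap.ker φ := by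
    intro s hs
    simp only [ciInf_const, LinearMap.mem_ker, evalDual_apply] at hs
    exact hφ s ((mem_forms_singleton (C.isHomogeneous_conic s)).2 hs)
  have h1 := mem_span_of_iInf_ker_le_ker h
  rw [Set.range_const, Submodule.mem_span_singleton] at h1
  obtain ⟨c, hc⟩ := h1
  exact ⟨c, hc.symm⟩

theorem mem_quadricsThrough_iUnion {ι : Type*} {Z : ι → Set C.P5}
    {G : QuadraticForm ℂ C.BicanDual} :
    G ∈ C.quadricsThrough (⋃ i, Z i) ↔ ∀ i, G ∈ C.quadricsThrough (Z i) := by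
  constructor
  · intro h i φ hφ
    exact h φ (Set.mem_iUnion.2 ⟨i, hφ⟩)
  · intro h φ hφ
    obtain ⟨i, hi⟩ := Set.mem_iUnion.1 hφ
    exact h i φ hi

theorem mem_quadricsThrough_curve {G : QuadraticForm ℂ C.BicanDual} :
    G ∈ C.quadricsThrough C.bicanonicalCurve ↔
      ∀ x : C.Point, eval x.1.rep (QuadraticForm.contract C.conic G) = 0 := by
  rw [bicanonicalCurve, mem_quadricsThrough_iUnion]
  refine forall_congr' fun x => ?_
  rw [mem_quadricsThrough_linSpan, ← quadric_evalDual]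
  constructor
  · intro h
    exact h _ (evalDual_mem_spanDual x)
  · intro h φ hφ
    obtain ⟨c, rfl⟩ := exists_eq_smul_evalDual hφ
    rw [QuadraticMap.map_smul, h, smul_zero]

variable (C) in
theorem range_contract_conic : LinearMap.range (QuadraticForm.contract C.conic) =
    homogeneousSubmodule (Fin 3) ℂ 4 := by
  rw [QuadraticForm.range_contract, range_conic, homogeneousSubmodule_mul_eq]

theorem isHomogeneous_contract_conic (G : QuadraticForm ℂ C.BicanDual) :
    (QuadraticForm.contract C.conic G).IsHomogeneous 4 := by
  have h : QuadraticForm.contract C.conic G ∈ LinearMap.range (QuadraticForm.contract C.conic) :=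
    ⟨G, rfl⟩
  rwa [range_contract_conic] at h

variable (C) in
theorem quadricsThrough_curve_eq : C.quadricsThrough C.bicanonicalCurve =
    (Submodule.span ℂ {C.F}).comap (QuadraticForm.contract C.conic) := by
  ext G
  rw [mem_quadricsThrough_curve, Submodule.mem_comap, Submodule.mem_span_singleton]
  constructor
  · intro h
    have hh := isHomogeneous_contract_conic G
    obtain ⟨A, hA, hA'⟩ := C.homogeneous.exists_eq_mul_of_dvd (d := 0) (by simpa using hh)
      (C.F_dvd_of_forall_point hh (by norm_num) h)
    rw [← totalDegree_zero_iff_isHomogeneous, totalDegree_eq_zero_iff_eq_C] at hA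
    refine ⟨coeff 0 A, ?_⟩
    rw [hA', smul_eq_C_mul, mul_comm]
    conv_rhs => rw [hA]
  · rintro ⟨c, hc⟩ x
    rw [← hc, smul_eval, x.2, mul_zero]

variable (C) in
theorem finrank_quadricSpace : Module.finrank ℂ C.QuadricSpace = 7 := by
  have h1 := LinearMap.finrank_range_add_finrank_ker (QuadraticForm.contract C.conic)
  rw [range_contract_conic, finrank_homogeneousSubmodule_fin,
    QuadraticForm.finrank_quadraticForm_dual, finrank_bicanonicalSections, Nat.multichoose_eq,
    Nat.multichoose_eq] at h1
  have h2 := LinearMap.finrank_range_add_finrank_ker (K := ℂ) (V := C.QuadricSpace)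
    ((QuadraticForm.contract C.conic).domRestrict (C.quadricsThrough C.bicanonicalCurve))
  rw [LinearMap.range_domRestrict, LinearMap.ker_domRestrict] at h2
  have h3 : (C.quadricsThrough C.bicanonicalCurve).map (QuadraticForm.contract C.conic) =
      Submodule.span ℂ {C.F} := by
    rw [quadricsThrough_curve_eq, Submodule.map_comap_eq, range_contract_conic]
    rw [inf_eq_right, Submodule.span_singleton_le_iff_mem]
    exact C.homogeneous
  have h4 : LinearMap.ker (QuadraticForm.contract C.conic) ≤
      C.quadricsThrough C.bicanonicalCurve := by
    rw [quadricsThrough_curve_eq]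
    exact LinearMap.ker_le_comap _
  rw [h3, finrank_span_singleton C.F_ne_zero,
    (Submodule.comapSubtypeEquivOfLe h4).finrank_eq] at h2
  have h5 : (3 + 4 - 1).choose 4 = 15 := rfl
  have h6 : (6 + 2 - 1).choose 2 = 21 := rfl
  change Module.finrank ℂ C.QuadricSpace = 7
  have h7 : Module.finrank ℂ (C.quadricsThrough C.bicanonicalCurve) =
    Module.finrank ℂ C.QuadricSpace := rfl
  omega

/-! ### Quadrics through the span of a divisor -/

/-- An algebra of dimension three that is the ring of functions on the divisor `t`, with a linear
form trivializing `𝒪(1)` on `t`. -/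
structure IsDivisorAlgebra (t : Multiset C.Point) {R : Type*} [CommRing R] [Algebra ℂ R]
    (l : MvPolynomial (Fin 3) ℂ) (h : MvPolynomial (Fin 3) ℂ →ₐ[ℂ] R) : Prop where
  isHomogeneous : l.IsHomogeneous 1
  map_eq_one : h l = 1
  map_F : h C.F = 0
  mem_forms_iff : ∀ {d : ℕ} {G : MvPolynomial (Fin 3) ℂ}, G.IsHomogeneous d →
    (G ∈ C.forms d t ↔ h G = 0)
  finrank_eq : Module.finrank ℂ R = 3

section

variable {t : Multiset C.Point} {R : Type*} [CommRing R] [Algebra ℂ R]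
  {l : MvPolynomial (Fin 3) ℂ} {h : MvPolynomial (Fin 3) ℂ →ₐ[ℂ] R}

namespace IsDivisorAlgebra

theorem exists_section (H : C.IsDivisorAlgebra t l h) (hU : ∀ G ∈ C.forms 1 t, G = 0) :
    ∃ σ : R →ₗ[ℂ] MvPolynomial (Fin 3) ℂ, (∀ r, (σ r).IsHomogeneous 1) ∧ (∀ r, h (σ r) = r) ∧
      ∀ G : MvPolynomial (Fin 3) ℂ, G.IsHomogeneous 1 → σ (h G) = G := by
  let f : homogeneousSubmodule (Fin 3) ℂ 1 →ₗ[ℂ] R := h.toLinearMap ∘ₗ Submodule.subtype _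
  have hf : Function.Injective f := by
    rw [injective_iff_map_eq_zero]
    rintro ⟨G, hG⟩ h0
    exact Subtype.ext (hU G ((H.mem_forms_iff hG).2 h0))
  have : Module.Finite ℂ R := Module.finite_of_finrank_pos (by rw [H.finrank_eq]; norm_num)
  have hd : Module.finrank ℂ (homogeneousSubmodule (Fin 3) ℂ 1) = Module.finrank ℂ R := by
    rw [finrank_homogeneousSubmodule_fin, H.finrank_eq]
    simp
  let e := LinearEquiv.ofInjectiveOfFinrankEq f hf hd
  have he : ∀ x, e x = h x := fun x => rfl
  refine ⟨Submodule.subtype _ ∘ₗ e.symm.toLinearMap, fun r => (e.symm r).2, fun r => ?_,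
    fun G hG => ?_⟩
  · change h (e.symm r) = r
    rw [← he, LinearEquiv.apply_symm_apply]
  · change ((e.symm (h G) : homogeneousSubmodule (Fin 3) ℂ 1) : MvPolynomial (Fin 3) ℂ) = G
    have : h G = e ⟨G, hG⟩ := rfl
    rw [this, LinearEquiv.symm_apply_apply]

/-- Restriction of conics to the divisor. -/
def restrict (_ : C.IsDivisorAlgebra t l h) : C.bicanonicalSections 0 →ₗ[ℂ] R :=
  h.toLinearMap ∘ₗ C.conic

theorem restrict_apply (H : C.IsDivisorAlgebra t l h) (s : C.bicanonicalSections 0) :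
    H.restrict s = h (C.conic s) := rfl

theorem restrict_surjective (H : C.IsDivisorAlgebra t l h) (hU : ∀ G ∈ C.forms 1 t, G = 0) :
    Function.Surjective H.restrict := by
  intro r
  obtain ⟨σ, hσ, hσ', -⟩ := H.exists_section hU
  obtain ⟨s, hs⟩ := C.exists_conic_eq (G := l * σ r) (H.isHomogeneous.mul (hσ r))
  exact ⟨s, by rw [restrict_apply, hs, map_mul, H.map_eq_one, one_mul, hσ']⟩

theorem spanDual_eq (H : C.IsDivisorAlgebra t l h) (hU : ∀ G ∈ C.forms 1 t, G = 0) :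
    C.spanDual t = LinearMap.range H.restrict.dualMap := by
  rw [LinearMap.range_dualMap_eq_dualAnnihilator_ker_of_surjective _ (H.restrict_surjective hU)]
  ext φ
  rw [mem_spanDual, Submodule.mem_dualAnnihilator]
  refine forall_congr' fun s => ?_
  rw [← conic_apply, H.mem_forms_iff (C.isHomogeneous_conic s), LinearMap.mem_ker, restrict_apply]

theorem finrank_spanDual (H : C.IsDivisorAlgebra t l h) (hU : ∀ G ∈ C.forms 1 t, G = 0) :
    Module.finrank ℂ (C.spanDual t) = 3 := by
  have : Module.Finite ℂ R := Module.finite_of_finrank_pos (by rw [H.finrank_eq]; norm_num)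
  rw [H.spanDual_eq hU, LinearMap.finrank_range_of_inj
    (LinearMap.dualMap_injective_of_surjective (H.restrict_surjective hU)),
    Subspace.dual_finrank_eq, H.finrank_eq]

theorem forall_mem_spanDual_iff (H : C.IsDivisorAlgebra t l h) (hU : ∀ G ∈ C.forms 1 t, G = 0)
    {σ : R →ₗ[ℂ] MvPolynomial (Fin 3) ℂ} (hσ : ∀ r, (σ r).IsHomogeneous 1)
    (hσ' : ∀ r, h (σ r) = r) (G : QuadraticForm ℂ C.BicanDual) :
    (∀ φ ∈ C.spanDual t, G φ = 0) ↔ QuadraticForm.contract (σ ∘ₗ H.restrict) G = 0 := by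
  rw [H.spanDual_eq hU]
  constructor
  · intro hG
    apply MvPolynomial.funext
    intro v
    have h1 := QuadraticForm.map_contract (aeval v) (σ ∘ₗ H.restrict) G
    rw [aeval_eq_eval, ← aeval_eq_eval] at h1
    rw [map_zero, ← coe_aeval_eq_eval]
    refine h1.trans ((QuadraticForm.contract_dual _ _).trans (hG _ ⟨(aeval v).toLinearMap ∘ₗ σ, ?_⟩))
    rfl
  · rintro hG _ ⟨ψ, rfl⟩
    let v : Fin 3 → ℂ := fun i => ψ (h (X i))
    have hv : (aeval v).toLinearMap ∘ₗ σ = ψ := by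
      have h2 : ∀ L ∈ homogeneousSubmodule (Fin 3) ℂ 1, aeval v L = ψ (h L) := by
        rw [homogeneousSubmodule_one_eq_span_X]
        intro L hL
        induction hL using Submodule.span_induction with
        | mem x hx =>
          obtain ⟨i, rfl⟩ := hx
          simp [v]
        | zero => simp
        | add x y _ _ hx hy => rw [map_add, map_add, map_add, hx, hy]
        | smul c x _ hx => rw [map_smul, map_smul, map_smul, hx]
      ext r
      change aeval v (σ r) = _
      rw [h2 _ (hσ r), hσ']
    rw [← QuadraticForm.contract_dual, LinearMap.dualMap_apply', ← hv, LinearMap.comp_assoc,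
      ← QuadraticForm.map_contract, hG, map_zero]

theorem finrank_forms_two (H : C.IsDivisorAlgebra t l h) (hU : ∀ G ∈ C.forms 1 t, G = 0) :
    Module.finrank ℂ (C.forms 2 t) = 3 := by
  have h1 := LinearMap.finrank_range_add_finrank_ker H.restrict
  rw [LinearMap.range_eq_top.2 (H.restrict_surjective hU), finrank_top, H.finrank_eq,
    finrank_bicanonicalSections] at h1
  have h2 : (LinearMap.ker H.restrict).map C.conic = C.forms 2 t := by
    ext G
    constructor
    · rintro ⟨s, hs, rfl⟩
      exact (H.mem_forms_iff (C.isHomogeneous_conic s)).2 hs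
    · intro hG
      obtain ⟨s, rfl⟩ := C.exists_conic_eq hG.1
      exact ⟨s, (H.mem_forms_iff (C.isHomogeneous_conic s)).1 hG, rfl⟩
  rw [← h2, ← (Submodule.equivMapOfInjective _ C.conic_injective _).finrank_eq]
  omega

theorem contract_mem_forms (H : C.IsDivisorAlgebra t l h)
    {σ : R →ₗ[ℂ] MvPolynomial (Fin 3) ℂ} (hσ : ∀ r, (σ r).IsHomogeneous 1)
    (hσ' : ∀ r, h (σ r) = r) {G : QuadraticForm ℂ C.BicanDual}
    (hG : G ∈ C.quadricsThrough C.bicanonicalCurve) :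
    QuadraticForm.contract (σ ∘ₗ H.restrict) G ∈ C.forms 2 t := by
  rw [H.mem_forms_iff (QuadraticForm.contract_mem (σ ∘ₗ H.restrict)
    (homogeneousSubmodule (Fin 3) ℂ 1)
    (homogeneousSubmodule (Fin 3) ℂ 2) (fun s => hσ _) (homogeneousSubmodule_mul 1 1) G)]
  have h1 : h.toLinearMap ∘ₗ (σ ∘ₗ H.restrict) = h.toLinearMap ∘ₗ C.conic := by
    ext s
    exact hσ' _
  rw [QuadraticForm.map_contract, h1, ← QuadraticForm.map_contract]
  rw [quadricsThrough_curve_eq, Submodule.mem_comap, Submodule.mem_span_singleton] at hG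
  obtain ⟨c, hc⟩ := hG
  rw [← hc, map_smul, H.map_F, smul_zero]

theorem exists_contract_eq (H : C.IsDivisorAlgebra t l h)
    {σ : R →ₗ[ℂ] MvPolynomial (Fin 3) ℂ}
    (hσ : ∀ G : MvPolynomial (Fin 3) ℂ, G.IsHomogeneous 1 → σ (h G) = G)
    {q : MvPolynomial (Fin 3) ℂ} (hq : q ∈ C.forms 2 t) :
    ∃ G ∈ C.quadricsThrough C.bicanonicalCurve,
      QuadraticForm.contract (σ ∘ₗ H.restrict) G = q := by
  set N := (C.quadricsThrough C.bicanonicalCurve).map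
    (QuadraticForm.contract (σ ∘ₗ H.restrict)) with hN
  let D : MvPolynomial (Fin 3) ℂ →ₗ[ℂ] MvPolynomial (Fin 3) ℂ :=
    LinearMap.id - LinearMap.mulLeft ℂ l ∘ₗ σ ∘ₗ h.toLinearMap
  have hD : ∀ q, D q = q - l * σ (h q) := fun q => rfl
  have key : homogeneousSubmodule (Fin 3) ℂ 1 * homogeneousSubmodule (Fin 3) ℂ 1 ≤ N.comap D := by
    rw [Submodule.mul_le]
    intro a ha b hb
    obtain ⟨sab, hab⟩ := C.exists_conic_eq (IsHomogeneous.mul ha hb)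
    obtain ⟨sll, hll⟩ := C.exists_conic_eq (H.isHomogeneous.mul H.isHomogeneous)
    obtain ⟨sla, hla⟩ := C.exists_conic_eq (H.isHomogeneous.mul ha)
    obtain ⟨slb, hlb⟩ := C.exists_conic_eq (H.isHomogeneous.mul hb)
    refine ⟨QuadraticMap.linMulLin (Module.Dual.eval ℂ _ sla) (Module.Dual.eval ℂ _ slb) -
      QuadraticMap.linMulLin (Module.Dual.eval ℂ _ sab) (Module.Dual.eval ℂ _ sll), ?_, ?_⟩
    · rw [quadricsThrough_curve_eq]
      change QuadraticForm.contract C.conic _ ∈ Submodule.span ℂ {C.F}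
      rw [map_sub, QuadraticForm.contract_linMulLin, QuadraticForm.contract_linMulLin, hab, hll,
        hla, hlb]
      rw [show l * a * (l * b) - a * b * (l * l) = 0 by ring]
      exact Submodule.zero_mem _
    · rw [map_sub, QuadraticForm.contract_linMulLin, QuadraticForm.contract_linMulLin, hD]
      simp only [LinearMap.comp_apply, restrict_apply, hab, hll, hla, hlb, map_mul, H.map_eq_one,
        one_mul]
      have h1 : σ 1 = l := by rw [← H.map_eq_one, hσ l H.isHomogeneous]
      rw [hσ a ha, hσ b hb, h1, mul_comm l]
  rw [homogeneousSubmodule_mul_eq] at key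
  have h1 : D q ∈ N := key hq.1
  rw [hD, (H.mem_forms_iff hq.1).1 hq, map_zero, mul_zero, sub_zero] at h1
  exact h1

theorem finrank_quadricsThrough (H : C.IsDivisorAlgebra t l h)
    (hU : ∀ G ∈ C.forms 1 t, G = 0) :
    Module.finrank ℂ (C.quadricsThrough (C.bicanonicalCurve ∪ C.linSpan t)) = 4 := by
  obtain ⟨σ, hσ1, hσ2, hσ3⟩ := H.exists_section hU
  let f := (QuadraticForm.contract (σ ∘ₗ H.restrict)).domRestrict
    (C.quadricsThrough C.bicanonicalCurve)
  have h1 := LinearMap.finrank_range_add_finrank_ker (K := ℂ) (V := C.QuadricSpace) f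
  have h2 : LinearMap.range f = C.forms 2 t := by
    ext q
    constructor
    · rintro ⟨G, rfl⟩
      exact H.contract_mem_forms hσ1 hσ2 G.2
    · intro hq
      obtain ⟨G, hG, hGq⟩ := H.exists_contract_eq hσ3 hq
      exact ⟨⟨G, hG⟩, hGq⟩
  have h3 : (LinearMap.ker f).map (Submodule.subtype _) =
      C.quadricsThrough (C.bicanonicalCurve ∪ C.linSpan t) := by
    rw [quadricsThrough_union]
    ext G
    rw [Submodule.mem_inf, mem_quadricsThrough_linSpan, H.forall_mem_spanDual_iff hU hσ1 hσ2]
    constructor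
    · rintro ⟨⟨G, hG⟩, hG', rfl⟩
      exact ⟨hG, hG'⟩
    · rintro ⟨hG, hG'⟩
      exact ⟨⟨G, hG⟩, hG', rfl⟩
  rw [h2, H.finrank_forms_two hU] at h1
  have h4 : Module.finrank ℂ (C.quadricsThrough C.bicanonicalCurve) = 7 := C.finrank_quadricSpace
  rw [← h3, ← (Submodule.equivMapOfInjective _ (Submodule.injective_subtype _) _).finrank_eq]
  exact Nat.add_left_cancel (n := 3) (h1.trans h4)

end IsDivisorAlgebra

end

theorem isDivisorAlgebra_adjoinRoot {b : LinCoord} {t : C.Sym3}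
    (hb : C.IsAdapted b t) {η : Polynomial ℂ}
    (hη : ∀ p ∈ (t : Multiset C.Point), η.eval (C.affCoord b p 1) = C.affCoord b p 2)
    (hχ : C.charPoly b t ∣ LinCoord.sub b ![1, Polynomial.X, η] C.F) :
    C.IsDivisorAlgebra t (LinCoord.lin b 0)
      ((Ideal.Quotient.mkₐ ℂ (Ideal.span {C.charPoly b (t : Multiset C.Point)})).comp
        (LinCoord.sub b ![1, Polynomial.X, η])) where
  isHomogeneous := LinCoord.isHomogeneous_lin b 0
  map_eq_one := by
    rw [AlgHom.comp_apply, LinCoord.sub_lin]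
    simp
  map_F := by
    rw [AlgHom.comp_apply, Ideal.Quotient.mkₐ_eq_mk, Ideal.Quotient.eq_zero_iff_mem,
      Ideal.mem_span_singleton]
    exact hχ
  mem_forms_iff := by
    intro d G hG
    rw [C.mem_forms_iff_dvd b hb hη hχ hG, AlgHom.comp_apply, Ideal.Quotient.mkₐ_eq_mk,
      Ideal.Quotient.eq_zero_iff_mem, Ideal.mem_span_singleton]
  finrank_eq := by
    have h := (AdjoinRoot.powerBasis' (C.monic_charPoly b (t : Multiset C.Point))).finrank
    rw [AdjoinRoot.powerBasis'_dim] at h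
    refine h.trans ?_
    rw [charPoly, Polynomial.natDegree_multiset_prod_of_monic]
    · simp
    · intro f hf
      obtain ⟨p, -, rfl⟩ := Multiset.mem_map.1 hf
      exact Polynomial.monic_X_sub_C _

end SmoothPlaneQuartic
end

open scoped LinearAlgebra.Projectivization TensorProduct

noncomputable section

open MvPolynomial

namespace SmoothPlaneQuartic

variable {C : SmoothPlaneQuartic}

/-! ### Regular frames of the conormal data of a divisor -/

/-- Evaluation of regular functions. -/
def evalReg (P₀ P : Fin 3 → C.Point) : C.regAt P₀ →ₐ[ℂ] ℂ :=
  (Pi.evalAlgHom ℂ (fun _ : Fin 3 → C.Point => ℂ) P).comp (C.regAt P₀).val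

theorem natDegree_charPoly (b : LinCoord) (t : C.Sym3) :
    (C.charPoly b (t : Multiset C.Point)).natDegree = 3 := by
  rw [charPoly, Polynomial.natDegree_multiset_prod_of_monic]
  · simp
  · intro f hf
    obtain ⟨p, -, rfl⟩ := Multiset.mem_map.1 hf
    exact Polynomial.monic_X_sub_C _

/-- Near every triple of points the forms that vanish on the divisor are cut out by three linear
functionals with regular coefficients. -/
theorem exists_regular_frame (P₀ : Fin 3 → C.Point) :
    ∃ γ : Fin 3 → (Fin 3 → C.Point) → MvPolynomial (Fin 3) ℂ →ₗ[ℂ] ℂ,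
      (∀ k G, (fun P => γ k P G) ∈ C.regAt P₀) ∧
      ∀ᶠ P in C.nhd P₀, ∀ {d : ℕ} {G : MvPolynomial (Fin 3) ℂ}, G.IsHomogeneous d →
        (G ∈ C.forms d (C.sumOf P) ↔ ∀ k, γ k P G = 0) := by
  obtain ⟨b, hb, -⟩ := C.exists_isAdapted P₀
  obtain ⟨c, hc, hev⟩ := exists_regular_parametrization b hb
  have hx : ∀ i, (fun P => C.affCoord b (P i) 1) ∈ C.regAt P₀ := fun i =>
    affCoord_mem_regAt b (hb.finite _ (mem_sumOf.2 ⟨i, rfl⟩)) 1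
  let η : (Fin 3 → C.Point) → Polynomial ℂ :=
    fun P => ∑ k : Fin 3, Polynomial.C (c k P) * Polynomial.X ^ (k : ℕ)
  let χ : (Fin 3 → C.Point) → Polynomial ℂ := fun P => C.charPoly b (C.sumOf P)
  refine ⟨fun k P => Polynomial.lcoeff ℂ k ∘ₗ Polynomial.modByMonicHom (χ P) ∘ₗ
    (LinCoord.sub b ![1, Polynomial.X, η P]).toLinearMap, fun k G => ?_, ?_⟩
  · let x : Fin 3 → C.regAt P₀ := fun i => ⟨_, hx i⟩
    let c' : Fin 3 → C.regAt P₀ := fun k => ⟨_, hc k⟩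
    let η' : Polynomial (C.regAt P₀) :=
      ∑ k : Fin 3, Polynomial.C (c' k) * Polynomial.X ^ (k : ℕ)
    let χ' : Polynomial (C.regAt P₀) := (Polynomial.X - Polynomial.C (x 0)) *
      (Polynomial.X - Polynomial.C (x 1)) * (Polynomial.X - Polynomial.C (x 2))
    have hmonic : χ'.Monic := ((Polynomial.monic_X_sub_C _).mul (Polynomial.monic_X_sub_C _)).mul
      (Polynomial.monic_X_sub_C _)
    let g : Polynomial (C.regAt P₀) := LinCoord.sub b ![1, Polynomial.X, η'] G
    have key : ∀ P, (LinCoord.sub b ![1, Polynomial.X, η P] G %ₘ χ P).coeff k =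
        evalReg P₀ P ((g %ₘ χ').coeff k) := by
      intro P
      have h1 : χ'.map (evalReg P₀ P : C.regAt P₀ →+* ℂ) = χ P := by
        simp only [χ, χ', charPoly_sumOf, Polynomial.map_mul, Polynomial.map_sub,
          Polynomial.map_X, Polynomial.map_C]
        rfl
      have h2 : η'.map (evalReg P₀ P : C.regAt P₀ →+* ℂ) = η P := by
        simp only [η, η', Polynomial.map_sum, Polynomial.map_mul, Polynomial.map_C,
          Polynomial.map_pow, Polynomial.map_X]
        rfl
      have h3 : g.map (evalReg P₀ P : C.regAt P₀ →+* ℂ) =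
          LinCoord.sub b ![1, Polynomial.X, η P] G := by
        have := LinCoord.map_sub b (Polynomial.mapAlgHom (evalReg P₀ P)) ![1, Polynomial.X, η'] G
        refine this.trans ?_
        congr 2
        ext j : 1
        fin_cases j
        · simp
        · simp
        · exact h2
      rw [← h1, ← h3, ← Polynomial.map_modByMonic _ hmonic, Polynomial.coeff_map]
      rfl
    have h4 : (fun P => evalReg P₀ P ((g %ₘ χ').coeff k)) =
      (((g %ₘ χ').coeff k : C.regAt P₀) : (Fin 3 → C.Point) → ℂ) := rfl
    have h5 : (fun P => (LinCoord.sub b ![1, Polynomial.X, η P] G %ₘ χ P).coeff k) ∈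
        C.regAt P₀ := by
      rw [_root_.funext key, h4]
      exact ((g %ₘ χ').coeff k).2
    exact h5
  · filter_upwards [hev] with P hP d G hG
    rw [C.mem_forms_iff_dvd b hP.1 (η := η P) (fun p hp => ?_) hP.2.2 hG,
      ← Polynomial.modByMonic_eq_zero_iff_dvd (C.monic_charPoly b _)]
    · constructor
      · intro h k
        change (LinCoord.sub b ![1, Polynomial.X, η P] G %ₘ χ P).coeff k = 0
        rw [h, Polynomial.coeff_zero]
      · intro h
        ext n
        rw [Polynomial.coeff_zero]
        by_cases hn : n < 3
        · exact h ⟨n, hn⟩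
        · refine Polynomial.coeff_eq_zero_of_natDegree_lt ?_
          refine lt_of_lt_of_le (Polynomial.natDegree_modByMonic_lt _ (C.monic_charPoly b _) ?_) ?_
          · intro h1
            have := natDegree_charPoly b (C.sumOf P)
            rw [h1] at this
            simp at this
          · rw [natDegree_charPoly]
            omega
    · obtain ⟨i, rfl⟩ := mem_sumOf.1 hp
      exact hP.2.1 i

theorem exists_isDivisorAlgebra (t : C.Sym3) :
    ∃ (p : Polynomial ℂ) (l : MvPolynomial (Fin 3) ℂ)
      (h : MvPolynomial (Fin 3) ℂ →ₐ[ℂ] (Polynomial ℂ ⧸ Ideal.span {p})),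
      C.IsDivisorAlgebra t l h := by
  obtain ⟨P, rfl⟩ := exists_sumOf_eq t
  obtain ⟨b, hb, -⟩ := C.exists_isAdapted P
  obtain ⟨c, hc, hev⟩ := exists_regular_parametrization b hb
  obtain ⟨h1, h2, h3⟩ := eventually_nhd_self hev
  refine ⟨_, _, _, isDivisorAlgebra_adjoinRoot h1 (fun p hp => ?_) h3⟩
  obtain ⟨i, rfl⟩ := mem_sumOf.1 hp
  exact h2 i

theorem finrank_spanDual {t : C.Sym3} (ht : t ∈ C.U) :
    Module.finrank ℂ (C.spanDual t) = 3 := by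
  obtain ⟨p, l, h, H⟩ := exists_isDivisorAlgebra t
  exact H.finrank_spanDual (C.mem_U.1 ht)

theorem finrank_quadricsThrough {t : C.Sym3} (ht : t ∈ C.U) :
    Module.finrank ℂ (C.quadricsThrough (C.bicanonicalCurve ∪ C.linSpan t)) = 4 := by
  obtain ⟨p, l, h, H⟩ := exists_isDivisorAlgebra t
  exact H.finrank_quadricsThrough (C.mem_U.1 ht)

/-- Determinants of matrices of regular functions are regular. -/
theorem det_mem_regAt {P₀ : Fin 3 → C.Point} {n : Type*} [Fintype n] [DecidableEq n]
    {M : (Fin 3 → C.Point) → Matrix n n ℂ} (hM : ∀ i j, (fun P => M P i j) ∈ C.regAt P₀) :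
    (fun P => (M P).det) ∈ C.regAt P₀ := by
  let M' : Matrix n n (C.regAt P₀) := fun i j => ⟨_, hM i j⟩
  have h : (fun P => (M P).det) = (M'.det : C.regAt P₀) := by
    ext P
    have := (evalReg P₀ P : C.regAt P₀ →+* ℂ).map_det M'
    exact this.symm
  rw [h]
  exact M'.det.2

/-- Adjugates of matrices of regular functions are regular. -/
theorem adjugate_mem_regAt {P₀ : Fin 3 → C.Point} {n : Type*} [Fintype n] [DecidableEq n]
    {M : (Fin 3 → C.Point) → Matrix n n ℂ} (hM : ∀ i j, (fun P => M P i j) ∈ C.regAt P₀)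
    (i j : n) : (fun P => (M P).adjugate i j) ∈ C.regAt P₀ := by
  let M' : Matrix n n (C.regAt P₀) := fun i j => ⟨_, hM i j⟩
  have h : (fun P => (M P).adjugate i j) = (M'.adjugate i j : C.regAt P₀) := by
    ext P
    have := (evalReg P₀ P : C.regAt P₀ →+* ℂ).map_adjugate M'
    exact (congrFun (congrFun this i) j).symm
  rw [h]
  exact (M'.adjugate i j).2

theorem exists_eq_sum_of_isHomogeneous_one {G : MvPolynomial (Fin 3) ℂ} (hG : G.IsHomogeneous 1) :
    ∃ v : Fin 3 → ℂ, G = ∑ j, v j • X j := by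
  have h : G ∈ homogeneousSubmodule (Fin 3) ℂ 1 := hG
  rw [homogeneousSubmodule_one_eq_span_X, Submodule.mem_span_range_iff_exists_fun] at h
  obtain ⟨v, hv⟩ := h
  exact ⟨v, hv.symm⟩

theorem eventually_mem_U {P₀ : Fin 3 → C.Point} (h : C.sumOf P₀ ∈ C.U) :
    ∀ᶠ P in C.nhd P₀, C.sumOf P ∈ C.U := by
  obtain ⟨γ, hγ, hev⟩ := exists_regular_frame P₀
  let M : (Fin 3 → C.Point) → Matrix (Fin 3) (Fin 3) ℂ := fun P => Matrix.of fun k j => γ k P (X j)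
  have hM : (fun P => (M P).det) ∈ C.regAt P₀ := det_mem_regAt fun i j => hγ i (X j)
  have hmul : ∀ P k (v : Fin 3 → ℂ), (M P).mulVec v k = γ k P (∑ j, v j • X j) := by
    intro P k v
    rw [map_sum, Matrix.mulVec, dotProduct]
    refine Finset.sum_congr rfl fun j _ => ?_
    rw [map_smul, smul_eq_mul, mul_comm]
    rfl
  have hdet : (M P₀).det ≠ 0 := by
    intro h0
    obtain ⟨v, hv, hv'⟩ := Matrix.exists_mulVec_eq_zero_iff.2 h0
    have hhom : IsHomogeneous (∑ j, v j • (X j : MvPolynomial (Fin 3) ℂ)) 1 :=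
      (homogeneousSubmodule (Fin 3) ℂ 1).sum_mem fun j _ =>
        (homogeneousSubmodule (Fin 3) ℂ 1).smul_mem _ (isHomogeneous_X ℂ j)
    have h1 := C.mem_U.1 h _ (((eventually_nhd_self hev) hhom).2 fun k => by
      rw [← hmul, hv', Pi.zero_apply])
    apply hv
    ext j
    have := congrArg (coeff (Finsupp.single j 1)) h1
    simpa [coeff_sum, coeff_smul, coeff_X, Finsupp.single_left_inj] using this
  filter_upwards [hev, eventually_ne_zero_of_regAt hM hdet] with P h1 h2
  refine C.mem_U.2 fun G hG => ?_
  obtain ⟨v, rfl⟩ := exists_eq_sum_of_isHomogeneous_one hG.1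
  have h3 := (h1 hG.1).1 hG
  have : v = 0 := by
    by_contra hv
    exact h2 (Matrix.exists_mulVec_eq_zero_iff.1 ⟨v, hv, by
      ext k
      rw [hmul, h3, Pi.zero_apply]⟩)
  simp [this]

variable (C) in
/-- The quadrics of `|I_C(2)|` that contain the span of `t`. -/
def quadricsOn (t : Multiset C.Point) : Submodule ℂ C.QuadricSpace :=
  (C.quadricsThrough (C.linSpan t)).comap (Submodule.subtype _)

theorem mem_quadricsOn {t : Multiset C.Point} {G : C.QuadricSpace} :
    G ∈ C.quadricsOn t ↔ ∀ φ ∈ C.spanDual t, (G : QuadraticForm ℂ C.BicanDual) φ = 0 :=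
  C.mem_quadricsThrough_linSpan

theorem finrank_quadricsOn {t : C.Sym3} (ht : t ∈ C.U) :
    Module.finrank ℂ (C.quadricsOn t) = 4 := by
  rw [← finrank_quadricsThrough ht, quadricsThrough_union, ← Submodule.map_comap_subtype]
  exact (Submodule.equivMapOfInjective _ (Submodule.injective_subtype _) _).finrank_eq

/-- Near every triple of points the quadrics through the span of the divisor are cut out by linear
functionals with regular coefficients. -/
theorem exists_regular_equations (P₀ : Fin 3 → C.Point) :
    ∃ L : (Fin 3 → C.Point) → C.QuadricSpace →ₗ[ℂ] (Fin 3 × Fin 3 → ℂ),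
      (∀ G i, (fun P => L P G i) ∈ C.regAt P₀) ∧
      ∀ᶠ P in C.nhd P₀, LinearMap.ker (L P) = C.quadricsOn (C.sumOf P) := by
  obtain ⟨γ, hγ, hev⟩ := exists_regular_frame P₀
  let φ : Fin 3 → (Fin 3 → C.Point) → C.BicanDual := fun k P => γ k P ∘ₗ C.conic
  let L : (Fin 3 → C.Point) → C.QuadricSpace →ₗ[ℂ] (Fin 3 × Fin 3 → ℂ) := fun P =>
    { toFun := fun G i =>
        QuadraticMap.polar (G : QuadraticForm ℂ C.BicanDual) (φ i.1 P) (φ i.2 P)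
      map_add' := fun G H => by
        ext i
        exact QuadraticMap.polar_add _ _ _ _
      map_smul' := fun c G => by
        ext i
        exact QuadraticMap.polar_smul _ _ _ _ }
  have hL : ∀ P G i, L P G i =
    QuadraticMap.polar (G : QuadraticForm ℂ C.BicanDual) (φ i.1 P) (φ i.2 P) := fun P G i => rfl
  refine ⟨L, fun G i => ?_, ?_⟩
  · let B := Module.finBasis ℂ (C.bicanonicalSections 0)
    have hexp : ∀ k P, φ k P = ∑ a, γ k P (C.conic (B a)) • B.coord a := fun k P =>
      (B.sum_dual_apply_smul_coord (φ k P)).symm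
    have h1 : ∀ P, L P G i = ∑ a, ∑ a', γ i.2 P (C.conic (B a)) * (γ i.1 P (C.conic (B a')) *
        QuadraticMap.polar (G : QuadraticForm ℂ C.BicanDual) (B.coord a') (B.coord a)) := by
      intro P
      rw [hL, ← QuadraticMap.polarBilin_apply_apply, hexp, hexp]
      simp only [map_sum, map_smul, LinearMap.sum_apply, LinearMap.smul_apply, smul_eq_mul,
        QuadraticMap.polarBilin_apply_apply, Finset.mul_sum]
    rw [_root_.funext h1]
    have h2 : (∑ a, ∑ a', (fun P => γ i.2 P (C.conic (B a))) * ((fun P => γ i.1 P (C.conic (B a'))) *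
        algebraMap ℂ _ (QuadraticMap.polar (G : QuadraticForm ℂ C.BicanDual) (B.coord a')
          (B.coord a)))) ∈ C.regAt P₀ :=
      sum_mem fun a _ => sum_mem fun a' _ => mul_mem (hγ _ _) (mul_mem (hγ _ _)
        (Subalgebra.algebraMap_mem _ _))
    convert h2 using 1
    ext P
    simp only [Finset.sum_apply, Pi.mul_apply]
    rfl
  · filter_upwards [hev] with P hP
    have hspan : C.spanDual (C.sumOf P) = Submodule.span ℂ (Set.range fun k => φ k P) := by
      ext ψ
      rw [mem_spanDual]
      constructor
      · intro h
        refine mem_span_of_iInf_ker_le_ker fun s hs => ?_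
        rw [Submodule.mem_iInf] at hs
        exact h s ((hP (C.isHomogeneous_conic s)).2 hs)
      · intro h s hs
        have hs' := (hP (C.isHomogeneous_conic s)).1 hs
        induction h using Submodule.span_induction with
        | mem x hx =>
          obtain ⟨k, rfl⟩ := hx
          exact hs' k
        | zero => rfl
        | add x y _ _ hx hy => rw [LinearMap.add_apply, hx, hy, add_zero]
        | smul c x _ hx => rw [LinearMap.smul_apply, hx, smul_zero]
    ext G
    rw [LinearMap.mem_ker, mem_quadricsOn, hspan]
    constructor
    · intro h ψ hψ
      obtain ⟨v, rfl⟩ := (Submodule.mem_span_range_iff_exists_fun ℂ).1 hψ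
      have h2 : (2 : ℂ) * (G : QuadraticForm ℂ C.BicanDual) (∑ i, v i • φ i P) = 0 := by
        have h3 := QuadraticMap.polar_self (G : QuadraticForm ℂ C.BicanDual) (∑ i, v i • φ i P)
        rw [two_nsmul, ← two_mul] at h3
        rw [← h3, ← QuadraticMap.polarBilin_apply_apply]
        simp only [map_sum, map_smul, LinearMap.sum_apply, LinearMap.smul_apply, smul_eq_mul,
          QuadraticMap.polarBilin_apply_apply]
        refine Finset.sum_eq_zero fun i _ => ?_
        rw [Finset.sum_eq_zero fun j _ => ?_, mul_zero]
        rw [← hL P G (j, i), h, Pi.zero_apply, mul_zero]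
      exact (mul_eq_zero.1 h2).resolve_left two_ne_zero
    · intro h
      ext i
      have hm : ∀ k, φ k P ∈ Submodule.span ℂ (Set.range fun k => φ k P) := fun k =>
        Submodule.subset_span ⟨k, rfl⟩
      rw [hL, QuadraticMap.polar, h _ (Submodule.add_mem _ (hm _) (hm _)), h _ (hm _), h _ (hm _)]
      simp

end SmoothPlaneQuartic
end

open scoped LinearAlgebra.Projectivization TensorProduct

noncomputable section

open MvPolynomial

theorem LinearMap.exists_comp_eq_of_ker_le {E V V' : Type*} [AddCommGroup E] [Module ℂ E]
    [AddCommGroup V] [Module ℂ V] [AddCommGroup V'] [Module ℂ V'] (f : E →ₗ[ℂ] V)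
    (g : E →ₗ[ℂ] V') (h : LinearMap.ker f ≤ LinearMap.ker g) : ∃ τ : V →ₗ[ℂ] V', τ ∘ₗ f = g := by
  obtain ⟨u, hu⟩ := ((LinearMap.ker f).liftQ f le_rfl).exists_leftInverse_of_injective
    (Submodule.ker_liftQ_eq_bot _ _ _ le_rfl)
  refine ⟨(LinearMap.ker f).liftQ g h ∘ₗ u, ?_⟩
  ext x
  have h1 := LinearMap.congr_fun hu ((LinearMap.ker f).mkQ x)
  simp only [LinearMap.comp_apply, LinearMap.id_apply, Submodule.mkQ_apply,
    Submodule.liftQ_apply] at h1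
  rw [LinearMap.comp_apply, LinearMap.comp_apply, h1, Submodule.liftQ_apply]

namespace SmoothPlaneQuartic

variable {C : SmoothPlaneQuartic}

/-! ### The projective bundle -/

/-- The solution spaces of a regular system of linear equations of constant rank have regular
local sections. -/
theorem exists_regular_section {P₁ : Fin 3 → C.Point} {E V : Type} [AddCommGroup E] [Module ℂ E]
    [FiniteDimensional ℂ E] [AddCommGroup V] [Module ℂ V] [FiniteDimensional ℂ V] {ι : Type}
    [Fintype ι]
    {L : (Fin 3 → C.Point) → E →ₗ[ℂ] (ι → ℂ)} (hL : ∀ e i, (fun P => L P e i) ∈ C.regAt P₁)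
    (hdim : ∀ᶠ P in C.nhd P₁, Module.finrank ℂ (LinearMap.ker (L P)) = Module.finrank ℂ V)
    {r : E →ₗ[ℂ] V} {s₁ : V →ₗ[ℂ] E} (hrs : r ∘ₗ s₁ = LinearMap.id)
    (hs₁ : LinearMap.range s₁ = LinearMap.ker (L P₁)) :
    ∃ s : (Fin 3 → C.Point) → V →ₗ[ℂ] E,
      (∀ᶠ P in C.nhd P₁, r ∘ₗ s P = LinearMap.id ∧
        LinearMap.range (s P) = LinearMap.ker (L P)) ∧
      ∀ (v : V) (l : Module.Dual ℂ E), (fun P => l (s P v)) ∈ C.regAt P₁ := by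
  classical
  obtain ⟨τ, hτ⟩ := LinearMap.exists_comp_eq_of_ker_le (L P₁) (LinearMap.id - s₁ ∘ₗ r) (by
    rw [← hs₁]
    rintro _ ⟨v, rfl⟩
    have := LinearMap.congr_fun hrs v
    simp only [LinearMap.comp_apply, LinearMap.id_apply] at this
    simp [this])
  let T : (Fin 3 → C.Point) → E →ₗ[ℂ] E := fun P => s₁ ∘ₗ r + τ ∘ₗ L P
  have hT₁ : T P₁ = LinearMap.id := by
    simp only [T, hτ]
    abel
  let B := Module.finBasis ℂ E
  let M : (Fin 3 → C.Point) → Matrix _ _ ℂ := fun P => LinearMap.toMatrix B B (T P)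
  have hτreg : ∀ (l : Module.Dual ℂ E) (e : E), (fun P => l (τ (L P e))) ∈ C.regAt P₁ := by
    intro l e
    have h1 : ∀ P, l (τ (L P e)) = ∑ i, L P e i * l (τ (Pi.single i 1)) := by
      intro P
      conv_lhs => rw [← Finset.univ_sum_single (L P e), map_sum, map_sum]
      refine Finset.sum_congr rfl fun i _ => ?_
      rw [← mul_one (L P e i), ← smul_eq_mul (L P e i) (1 : ℂ), Pi.single_smul', map_smul, map_smul,
        smul_eq_mul, smul_eq_mul, mul_one]
    have h2 : (∑ i, (fun P => L P e i) * algebraMap ℂ _ (l (τ (Pi.single i 1)))) ∈ C.regAt P₁ :=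
      sum_mem fun i _ => mul_mem (hL e i) (Subalgebra.algebraMap_mem _ _)
    rw [_root_.funext h1]
    convert h2 using 1
    ext P
    simp only [Finset.sum_apply, Pi.mul_apply]
    rfl
  have hMreg : ∀ i j, (fun P => M P i j) ∈ C.regAt P₁ := by
    intro i j
    have h1 : ∀ P, M P i j = B.coord i (s₁ (r (B j))) + B.coord i (τ (L P (B j))) := by
      intro P
      simp [M, T, LinearMap.toMatrix_apply]
    rw [_root_.funext h1]
    exact add_mem (Subalgebra.algebraMap_mem (C.regAt P₁) (B.coord i (s₁ (r (B j))))) (hτreg _ _)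
  have hdet := det_mem_regAt hMreg
  have hdet₁ : (M P₁).det ≠ 0 := by simp [M, hT₁]
  let N : (Fin 3 → C.Point) → E →ₗ[ℂ] E := fun P => Matrix.toLin B B (M P)⁻¹
  have hTN : ∀ P, (M P).det ≠ 0 → T P ∘ₗ N P = LinearMap.id := by
    intro P hP
    have h1 : T P = Matrix.toLin B B (M P) := (Matrix.toLin_toMatrix B B (T P)).symm
    rw [h1]
    simp only [N]
    rw [← Matrix.toLin_mul, Matrix.mul_nonsing_inv _ (isUnit_iff_ne_zero.2 hP), Matrix.toLin_one]
  refine ⟨fun P => N P ∘ₗ s₁, ?_, fun v l => ?_⟩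
  · filter_upwards [eventually_ne_zero_of_regAt hdet hdet₁, hdim] with P hP hd
    have hTN' := hTN P hP
    have hNT : N P ∘ₗ T P = LinearMap.id := (LinearMap.comp_eq_id_comm ℂ E).1 hTN'
    have hTker : ∀ e ∈ LinearMap.ker (L P), T P e = s₁ (r e) := by
      intro e he
      simp only [T, LinearMap.add_apply, LinearMap.comp_apply, LinearMap.mem_ker.1 he, map_zero,
        add_zero]
    have hinj : Function.Injective (r.domRestrict (LinearMap.ker (L P))) := by
      rw [injective_iff_map_eq_zero]
      rintro ⟨e, he⟩ h0
      have h0' : r e = 0 := h0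
      have h1 := hTker e he
      rw [h0', map_zero] at h1
      have h2 := LinearMap.congr_fun hNT e
      rw [LinearMap.comp_apply, h1, map_zero] at h2
      exact Subtype.ext h2.symm
    have hsurj : Function.Surjective (r.domRestrict (LinearMap.ker (L P))) :=
      (LinearMap.injective_iff_surjective_of_finrank_eq_finrank hd).1 hinj
    have hmem : ∀ v, ∃ e ∈ LinearMap.ker (L P), r e = v ∧ N P (s₁ v) = e := by
      intro v
      obtain ⟨⟨e, he⟩, hev⟩ := hsurj v
      refine ⟨e, he, hev, ?_⟩
      have h2 : r e = v := hev
      rw [← h2, ← hTker e he]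
      exact LinearMap.congr_fun hNT e
    constructor
    · ext v
      obtain ⟨e, he, h1, h2⟩ := hmem v
      rw [LinearMap.comp_apply, LinearMap.comp_apply, h2, h1, LinearMap.id_apply]
    · apply le_antisymm
      · rintro _ ⟨v, rfl⟩
        obtain ⟨e, he, h1, h2⟩ := hmem v
        rw [LinearMap.comp_apply, h2]
        exact he
      · intro e he
        refine ⟨r e, ?_⟩
        rw [LinearMap.comp_apply, ← hTker e he]
        exact LinearMap.congr_fun hNT e
  · have h1 : ∀ P, l (N P (s₁ v)) = ((M P).det)⁻¹ *
        ∑ i, ∑ j, l (B i) * ((M P).adjugate i j * B.repr (s₁ v) j) := by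
      intro P
      simp only [N, Matrix.inv_def, Ring.inverse_eq_inv', map_smul, LinearMap.smul_apply,
        smul_eq_mul]
      rw [Matrix.toLin_apply]
      simp only [map_sum, map_smul, smul_eq_mul, Matrix.mulVec, dotProduct, Finset.mul_sum,
        Finset.sum_mul]
      refine Finset.sum_congr rfl fun i _ => Finset.sum_congr rfl fun j _ => ?_
      ring
    have h2 : ((fun P => (M P).det)⁻¹ * ∑ i, ∑ j, algebraMap ℂ _ (l (B i)) *
        ((fun P => (M P).adjugate i j) * algebraMap ℂ _ (B.repr (s₁ v) j))) ∈ C.regAt P₁ :=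
      mul_mem (inv_mem_regAt hdet hdet₁) (sum_mem fun i _ => sum_mem fun j _ =>
        mul_mem (Subalgebra.algebraMap_mem _ _) (mul_mem (adjugate_mem_regAt hMreg i j)
          (Subalgebra.algebraMap_mem _ _)))
    convert h2 using 1
    ext P
    rw [LinearMap.comp_apply, h1]
    simp only [Finset.sum_apply, Pi.mul_apply, Pi.inv_apply]
    rfl

theorem section_unique {E V : Type*} [AddCommGroup E] [Module ℂ E] [AddCommGroup V] [Module ℂ V]
    {r : E →ₗ[ℂ] V} {s s' : V →ₗ[ℂ] E} (h : r ∘ₗ s = LinearMap.id) (h' : r ∘ₗ s' = LinearMap.id)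
    (hr : LinearMap.range s = LinearMap.range s') : s = s' := by
  ext v
  obtain ⟨w, hw⟩ : s v ∈ LinearMap.range s' := hr ▸ LinearMap.mem_range_self s v
  have h1 : r (s v) = v := LinearMap.congr_fun h v
  have h2 : r (s' w) = w := LinearMap.congr_fun h' w
  rw [hw, h1] at h2
  rw [← hw, ← h2]

theorem exists_section {E : Type*} [AddCommGroup E] [Module ℂ E] {n : ℕ} (K : Submodule ℂ E) [FiniteDimensional ℂ K]
    (hd : Module.finrank ℂ K = n) :
    ∃ (r : E →ₗ[ℂ] (Fin n → ℂ)) (s : (Fin n → ℂ) →ₗ[ℂ] E),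
      r ∘ₗ s = LinearMap.id ∧ LinearMap.range s = K := by
  let e : (Fin n → ℂ) ≃ₗ[ℂ] K := LinearEquiv.ofFinrankEq _ _ (by
    rw [hd, Module.finrank_fin_fun])
  have hs : Function.Injective (K.subtype ∘ₗ e.toLinearMap) :=
    Subtype.val_injective.comp e.injective
  obtain ⟨r, hr⟩ := (K.subtype ∘ₗ e.toLinearMap).exists_leftInverse_of_injective
    (LinearMap.ker_eq_bot.2 hs)
  refine ⟨r, _, hr, ?_⟩
  rw [LinearMap.range_comp]
  simp

/-- A family of subspaces of a fixed vector space over `C^[3]` that is locally given by regular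
linear equations. -/
def IsRegularKernel {E : Type} [AddCommGroup E] [Module ℂ E] (N : C.Sym3 → Submodule ℂ E) : Prop :=
  ∀ P₀, ∃ L : (Fin 3 → C.Point) → E →ₗ[ℂ] (Fin 3 × Fin 3 → ℂ),
    (∀ e i, (fun P => L P e i) ∈ C.regAt P₀) ∧
    ∀ᶠ P in C.nhd P₀, LinearMap.ker (L P) = N (C.sumOf P)

section

variable {E : Type} [AddCommGroup E] [Module ℂ E] [FiniteDimensional ℂ E] {n : ℕ}
  {V : Set C.Sym3} {N : C.Sym3 → Submodule ℂ E}

namespace IsRegularKernel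

theorem exists_regular_section (hN : C.IsRegularKernel N)
    (hV : ∀ P, C.sumOf P ∈ V → ∀ᶠ P' in C.nhd P, C.sumOf P' ∈ V)
    (hd : ∀ t ∈ V, Module.finrank ℂ (N t) = n) {P₁ : Fin 3 → C.Point} (hP₁ : C.sumOf P₁ ∈ V)
    {r : E →ₗ[ℂ] (Fin n → ℂ)} {s₁ : (Fin n → ℂ) →ₗ[ℂ] E}
    (hrs : r ∘ₗ s₁ = LinearMap.id) (hs₁ : LinearMap.range s₁ = N (C.sumOf P₁)) :
    ∃ s : (Fin 3 → C.Point) → (Fin n → ℂ) →ₗ[ℂ] E,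
      (∀ᶠ P in C.nhd P₁, r ∘ₗ s P = LinearMap.id ∧
        LinearMap.range (s P) = N (C.sumOf P)) ∧
      ∀ v (l : Module.Dual ℂ E), (fun P => l (s P v)) ∈ C.regAt P₁ := by
  obtain ⟨L, hL, hker⟩ := hN P₁
  have hdim : ∀ᶠ P in C.nhd P₁, Module.finrank ℂ (LinearMap.ker (L P)) =
      Module.finrank ℂ (Fin n → ℂ) := by
    filter_upwards [hker, hV P₁ hP₁] with P h1 h2
    rw [h1, hd _ h2, Module.finrank_fin_fun]
  obtain ⟨s, hs, hreg⟩ := SmoothPlaneQuartic.exists_regular_section hL hdim hrs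
    (hs₁.trans (eventually_nhd_self hker).symm)
  refine ⟨s, ?_, hreg⟩
  filter_upwards [hs, hker] with P h1 h2
  rwa [h2] at h1

theorem isProjectiveBundle (hN : C.IsRegularKernel N)
    (hV : ∀ P, C.sumOf P ∈ V → ∀ᶠ P' in C.nhd P, C.sumOf P' ∈ V)
    (hd : ∀ t ∈ V, Module.finrank ℂ (N t) = n + 1) :
    C.IsProjectiveBundle n V {x : C.Sym3 × ℙ ℂ E | x.1 ∈ V ∧ x.2.submodule ≤ N x.1} := by
  classical
  refine ⟨fun x hx => hx.1, fun t₀ ht₀ => ?_⟩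
  obtain ⟨r, s₀, hrs₀, hs₀⟩ := exists_section (N t₀) (hd t₀ ht₀)
  let W : Set C.Sym3 := {t | t ∈ V ∧ ∃ s : (Fin (n + 1) → ℂ) →ₗ[ℂ] E,
    r ∘ₗ s = LinearMap.id ∧ LinearMap.range s = N t}
  let s : C.Sym3 → (Fin (n + 1) → ℂ) →ₗ[ℂ] E :=
    fun t => if h : t ∈ W then Classical.choose h.2 else 0
  have hs : ∀ t ∈ W, r ∘ₗ s t = LinearMap.id ∧ LinearMap.range (s t) = N t := by
    intro t ht
    simp only [s, dif_pos ht]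
    exact Classical.choose_spec ht.2
  refine ⟨W, isOpenSym3_of_eventually fun P hP => ?_, ⟨ht₀, s₀, hrs₀, hs₀⟩, fun t ht => ht.1,
    s, fun _ => r, ?_, ?_, fun t ht => ⟨(hs t ht).1, fun e => ?_⟩⟩
  · obtain ⟨hU, s₁, h1, h2⟩ := hP
    obtain ⟨s', hs', -⟩ := hN.exists_regular_section hV hd hU h1 h2
    filter_upwards [hs', hV P hU] with P h3 h4
    exact ⟨h4, s' P, h3⟩
  · intro v l
    refine isRegularOn_of_regAt fun P hP => ?_
    have hU := hP.1
    have h1 := hs _ hP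
    obtain ⟨s', hs', hreg⟩ := hN.exists_regular_section hV hd hU h1.1 h1.2
    refine regAt_congr (hreg v l) ?_
    filter_upwards [hs', hV P hU] with P' h3 h4
    have h5 := hs (C.sumOf P') ⟨h4, s' P', h3⟩
    rw [section_unique h5.1 h3.1 (h5.2.trans h3.2.symm)]
  · intro v l
    exact isRegularOn_of_regAt fun P _ => Subalgebra.algebraMap_mem (C.regAt P) (l (r v))
  · rw [(hs t ht).2]
    exact and_iff_right ht.1

end IsRegularKernel

end

theorem isRegularKernel_quadricsOn :
    C.IsRegularKernel (E := C.QuadricSpace) fun t => C.quadricsOn (t : Multiset C.Point) :=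
  exists_regular_equations

theorem submodule_le_iff_rep_mem {E : Type*} [AddCommGroup E] [Module ℂ E] {x : ℙ ℂ E}
    {K : Submodule ℂ E} : x.submodule ≤ K ↔ x.rep ∈ K := by
  rw [Projectivization.submodule_eq, Submodule.span_singleton_le_iff_mem]

theorem Q_eq : C.Q = {x | x.1 ∈ C.U ∧ x.2.submodule ≤ C.quadricsOn (x.1 : Multiset C.Point)} := by
  ext ⟨t, G⟩
  refine and_congr_right fun _ => ?_
  change G.rep ∈ C.quadricsOn (t : Multiset C.Point) ↔ _
  exact (submodule_le_iff_rep_mem (E := C.QuadricSpace)).symm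

variable (C) in
theorem isProjectiveBundle_Q : C.IsProjectiveBundle 3 C.U C.Q := by
  rw [Q_eq]
  exact isRegularKernel_quadricsOn.isProjectiveBundle (fun _ => eventually_mem_U)
    fun _ => finrank_quadricsOn

end SmoothPlaneQuartic
end

open scoped LinearAlgebra.Projectivization TensorProduct

noncomputable section

open MvPolynomial

/-- More than `n` elements integral over an algebra generated by `n` elements are algebraically
dependent. -/
theorem exists_aeval_eq_zero_of_isIntegral {A : Type} [CommRing A] [Algebra ℂ A] {κ ι : Type}
    [Fintype κ] [Fintype ι] (h : Fintype.card κ < Fintype.card ι) (y : κ → A) (e : ι → A)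
    (he : ∀ i, IsIntegral (Algebra.adjoin ℂ (Set.range y)) (e i)) :
    ∃ Φ : MvPolynomial ι ℂ, Φ ≠ 0 ∧ aeval e Φ = 0 := by
  by_contra! hcon
  have hinj : Function.Injective (aeval e : MvPolynomial ι ℂ →ₐ[ℂ] A) := by
    rw [injective_iff_map_eq_zero]
    intro Φ hΦ
    by_contra h0
    exact hcon Φ h0 hΦ
  obtain ⟨p, hp, hpe⟩ := Ideal.exists_comap_eq_of_mem_minimalPrimes_of_injective
    (f := (aeval e : MvPolynomial ι ℂ →ₐ[ℂ] A).toRingHom) hinj ⊥ (by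
      rw [IsDomain.minimalPrimes_eq_singleton_bot]
      rfl)
  let π : A →ₐ[ℂ] A ⧸ p := Ideal.Quotient.mkₐ ℂ p
  have hind : AlgebraicIndependent ℂ fun i => π (e i) := by
    rw [algebraicIndependent_iff_injective_aeval, injective_iff_map_eq_zero]
    intro Φ hΦ
    have h1 : π (aeval e Φ) = 0 := by
      rw [← hΦ, ← AlgHom.comp_apply, comp_aeval]
    have h2 : Φ ∈ p.comap (aeval e : MvPolynomial ι ℂ →ₐ[ℂ] A).toRingHom :=
      Ideal.mem_comap.2 (Ideal.Quotient.eq_zero_iff_mem.1 h1)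
    rw [hpe] at h2
    exact h2
  have hclo : (Set.range fun i => π (e i)) ⊆
      (AlgebraicIndependent.matroid ℂ (A ⧸ p)).closure (Set.range fun k => π (y k)) := by
    rw [AlgebraicIndependent.matroid_closure_eq]
    rintro _ ⟨i, rfl⟩
    have h1 : (Algebra.adjoin ℂ (Set.range y)).map π =
        Algebra.adjoin ℂ (Set.range fun k => π (y k)) := by
      rw [AlgHom.map_adjoin, ← Set.range_comp]
      rfl
    have h2 : IsIntegral (Algebra.adjoin ℂ (Set.range fun k => π (y k))) (π (e i)) := by
      obtain ⟨q, hq, hq0⟩ := he i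
      let ψ : Algebra.adjoin ℂ (Set.range y) →+* Algebra.adjoin ℂ (Set.range fun k => π (y k)) :=
        ((π : A →+* A ⧸ p).comp (Algebra.adjoin ℂ (Set.range y)).val.toRingHom).codRestrict _
          fun a => h1 ▸ ⟨a, a.2, rfl⟩
      refine ⟨q.map ψ, hq.map ψ, ?_⟩
      have h3 := congrArg π hq0
      rw [map_zero, ← AlgHom.coe_toRingHom, Polynomial.hom_eval₂] at h3
      rw [Polynomial.eval₂_map]
      exact h3
    exact h2.isAlgebraic
  have h1 := (AlgebraicIndependent.matroid_indep_iff.2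
    hind.to_subtype_range).encard_le_eRk_of_subset hclo
  rw [Matroid.eRk_closure_eq] at h1
  have h2 := h1.trans (Matroid.eRk_le_encard _ _)
  rw [← Set.image_univ, hind.injective.encard_image, Set.encard_univ, ENat.card_eq_coe_fintype_card]
    at h2
  have h3 : (Set.range fun k => π (y k)).encard ≤ Fintype.card κ := by
    rw [← Set.image_univ]
    refine (Set.encard_image_le _ _).trans ?_
    rw [Set.encard_univ, ENat.card_eq_coe_fintype_card]
  have h4 := h2.trans h3
  norm_cast at h4
  omega

namespace LinCoord

theorem sub_eq_aeval (b : LinCoord) {A : Type*} [CommRing A] [Algebra ℂ A] (u : Fin 3 → A)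
    (G : MvPolynomial (Fin 3) ℂ) :
    sub b u G = aeval u (sub b (X : Fin 3 → MvPolynomial (Fin 3) ℂ) G) := by
  rw [map_sub]
  simp

theorem isHomogeneous_sub_X (b : LinCoord) {G : MvPolynomial (Fin 3) ℂ} {n : ℕ}
    (hG : G.IsHomogeneous n) :
    IsHomogeneous (sub b (X : Fin 3 → MvPolynomial (Fin 3) ℂ) G) n := by
  have := hG.aeval (fun i => ∑ k, b k i • (X k : MvPolynomial (Fin 3) ℂ)) (n := 1) fun i =>
    (homogeneousSubmodule (Fin 3) ℂ 1).sum_mem fun k _ =>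
      (homogeneousSubmodule (Fin 3) ℂ 1).smul_mem _ (isHomogeneous_X ℂ k)
  rw [one_mul] at this
  exact this

/-- A form with a nonzero value at the last basis vector gives an integral equation for the last
coordinate. -/
theorem isIntegral_of_sub_eq_zero (b : LinCoord) {A : Type*} [CommRing A] [Algebra ℂ A]
    {A₀ : Subalgebra ℂ A} {x y : A} (hx : x ∈ A₀) {G : MvPolynomial (Fin 3) ℂ} {n : ℕ}
    (hG : G.IsHomogeneous n) (h0 : eval (b 2) G ≠ 0) (h : sub b ![1, x, y] G = 0) :
    IsIntegral A₀ y := by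
  set H := sub b (X : Fin 3 → MvPolynomial (Fin 3) ℂ) G with hH
  have hdeg : ∀ m ∈ H.support, m 0 + m 1 + m 2 = n := by
    intro m hm
    have h1 := isHomogeneous_sub_X b hG (mem_support_iff.1 hm)
    simpa [Finsupp.weight_apply, Finsupp.sum_fintype, Fin.sum_univ_three] using h1
  have hcoef : coeff (Finsupp.single 2 n) H = eval (b 2) G := by
    have h1 : eval (b 2) G = eval ![0, 0, 1] H := by
      have h2 := sub_eq_aeval b (![0, 0, 1] : Fin 3 → ℂ) G
      rw [sub_apply_eq_eval, aeval_eq_eval] at h2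
      simpa [Fin.sum_univ_three] using h2
    rw [h1, eval_eq', Finset.sum_eq_single (Finsupp.single 2 n)]
    · simp [Fin.prod_univ_three]
    · intro m hm hne
      rw [Fin.prod_univ_three]
      have hdeg := hdeg m hm
      by_cases hm0 : m 0 = 0
      · by_cases hm1 : m 1 = 0
        · exfalso
          apply hne
          ext k
          fin_cases k <;> simp [hm0, hm1]
          omega
        · simp [hm1]
      · simp [hm0]
    · intro hm
      rw [notMem_support_iff.1 hm, zero_mul]
  let q : Polynomial A₀ := ∑ m ∈ H.support,
    Polynomial.C (algebraMap ℂ A₀ (coeff m H) * ⟨x, hx⟩ ^ m 1) * Polynomial.X ^ m 2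
  have hle : ∀ m ∈ H.support, m 2 ≤ n ∧ (m 2 = n → m = Finsupp.single 2 n) := by
    intro m hm
    have hdeg := hdeg m hm
    refine ⟨by omega, fun h => ?_⟩
    ext k
    fin_cases k <;> simp <;> omega
  have hqn : q.coeff n = algebraMap ℂ A₀ (eval (b 2) G) := by
    simp only [q, Polynomial.finsetSum_coeff, Polynomial.coeff_C_mul, Polynomial.coeff_X_pow]
    rw [Finset.sum_eq_single (Finsupp.single 2 n)]
    · simp [hcoef]
    · intro m hm hne
      rw [if_neg fun h => hne ((hle m hm).2 h.symm), mul_zero]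
    · intro hm
      rw [notMem_support_iff.1 hm]
      simp
  have hqd : q.natDegree ≤ n := by
    refine Polynomial.natDegree_sum_le_of_forall_le _ _ fun m hm => ?_
    refine (Polynomial.natDegree_C_mul_le _ _).trans ?_
    exact (Polynomial.natDegree_X_pow_le _).trans (hle m hm).1
  have hq0 : Polynomial.aeval y q = 0 := by
    rw [← h, sub_eq_aeval, aeval_def, eval₂_eq']
    simp only [q, map_sum, map_mul, Polynomial.aeval_C, map_pow, Polynomial.aeval_X]
    refine Finset.sum_congr rfl fun m _ => ?_
    rw [Fin.prod_univ_three]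
    simp only [Matrix.cons_val_zero, Matrix.cons_val_one, Matrix.cons_val, one_pow, one_mul]
    rw [mul_assoc]
    rfl
  refine ⟨Polynomial.C (algebraMap ℂ A₀ (eval (b 2) G)⁻¹) * q, ?_, ?_⟩
  · refine Polynomial.monic_of_natDegree_le_of_coeff_eq_one n
      ((Polynomial.natDegree_C_mul_le _ _).trans hqd) ?_
    rw [Polynomial.coeff_C_mul, hqn, ← map_mul, inv_mul_cancel₀ h0, map_one]
  · change Polynomial.aeval y _ = 0
    rw [map_mul, hq0, mul_zero]

end LinCoord

namespace SmoothPlaneQuartic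

variable {C : SmoothPlaneQuartic}

theorem IsMultiHomogeneous.eval_mul {A : MvPolynomial (Fin 3 × Fin 3) ℂ} {d : Fin 3 → ℕ}
    (hA : IsMultiHomogeneous A d) (c : Fin 3 → ℂ) (u : Fin 3 × Fin 3 → ℂ) :
    eval (fun jk => c jk.1 * u jk) A = (∏ j, c j ^ d j) * eval u A := by
  rw [eval_eq', eval_eq', Finset.mul_sum]
  refine Finset.sum_congr rfl fun m hm => ?_
  have h1 : ∀ j, d j = ∑ k, m (j, k) := by
    intro j
    have := hA j (mem_support_iff.1 hm)
    rw [← this, Finsupp.weight_apply, Finsupp.sum_fintype _ _ (by simp), Fintype.sum_prod_type]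
    rw [Finset.sum_eq_single j]
    · simp
    · intro j' _ hj
      simp [hj]
    · simp
  have h2 : ∏ j, c j ^ d j = ∏ jk : Fin 3 × Fin 3, c jk.1 ^ m jk := by
    rw [Fintype.prod_prod_type]
    refine Finset.prod_congr rfl fun j _ => ?_
    rw [h1 j]
    exact (Finset.prod_pow_eq_pow_sum _ _ _).symm
  simp only [mul_pow, Finset.prod_mul_distrib]
  rw [h2]
  ring

variable (C) in
/-- The affine coordinates of a triple of points. -/
def affTriple (b : LinCoord) (P : Fin 3 → C.Point) : Fin 3 × Fin 3 → ℂ :=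
  fun ik => C.affCoord b (P ik.1) ik.2

/-- Regular functions are quotients of polynomials in affine coordinates. -/
theorem exists_affine_fraction {b : LinCoord} {P₀ : Fin 3 → C.Point}
    (h₀ : ∀ i, b.repr (P₀ i).1.rep 0 ≠ 0) {f : (Fin 3 → C.Point) → ℂ} (hf : f ∈ C.regAt P₀) :
    ∃ A B : MvPolynomial (Fin 3 × Fin 3) ℂ, ∀ᶠ P in C.nhd P₀,
      eval (C.affTriple b P) B ≠ 0 ∧
        f P = eval (C.affTriple b P) A / eval (C.affTriple b P) B := by
  obtain ⟨d, A, B, hA, hB, hB0, hf⟩ := hf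
  let σ : MvPolynomial (Fin 3 × Fin 3) ℂ →ₐ[ℂ] MvPolynomial (Fin 3 × Fin 3) ℂ :=
    aeval fun jk => ∑ l, b l jk.2 • X (jk.1, l)
  have key : ∀ {M : MvPolynomial (Fin 3 × Fin 3) ℂ}, IsMultiHomogeneous M d →
      ∀ P : Fin 3 → C.Point, (∀ i, b.repr (P i).1.rep 0 ≠ 0) →
      C.evalTriple P M = (∏ j, b.repr (P j).1.rep 0 ^ d j) * eval (C.affTriple b P) (σ M) := by
    intro M hM P hP
    have h1 : eval (C.affTriple b P) (σ M) =
        eval (fun jk => ∑ l, b l jk.2 * C.affCoord b (P jk.1) l) M := by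
      have h2 : (aeval (C.affTriple b P)).comp σ =
          (aeval fun jk : Fin 3 × Fin 3 => ∑ l, b l jk.2 * C.affCoord b (P jk.1) l :
            MvPolynomial (Fin 3 × Fin 3) ℂ →ₐ[ℂ] ℂ) := by
        apply algHom_ext
        intro jk
        simp [σ, affTriple]
      have h3 := AlgHom.congr_fun h2 M
      rwa [AlgHom.comp_apply, aeval_eq_eval, aeval_eq_eval] at h3
    rw [h1, ← hM.eval_mul, evalTriple]
    congr 2
    ext jk
    have h4 := congrFun (b.sum_repr (P jk.1).1.rep) jk.2
    rw [← h4, Finset.mul_sum, Finset.sum_apply]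
    refine Finset.sum_congr rfl fun l _ => ?_
    rw [affCoord, Pi.smul_apply, smul_eq_mul]
    field_simp [hP jk.1]
  have hfin : ∀ᶠ P in C.nhd P₀, ∀ i, b.repr (P i).1.rep 0 ≠ 0 := by
    rw [Filter.eventually_all]
    intro i
    have := eventually_eval_ne_zero (P₀ := P₀) (LinCoord.isHomogeneous_lin b 0) (i := i)
      (by rw [LinCoord.eval_lin]; exact h₀ i)
    simpa only [LinCoord.eval_lin] using this
  refine ⟨σ A, σ B, ?_⟩
  filter_upwards [hf, hfin, eventually_evalTriple_ne_zero hB hB0] with P h1 h2 h3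
  rw [key hB P h2] at h3
  refine ⟨right_ne_zero_of_mul h3, ?_⟩
  rw [h1, key hA P h2, key hB P h2, mul_div_mul_left _ _ (left_ne_zero_of_mul h3)]

/-- A finite family of regular functions has a common denominator in affine coordinates. -/
theorem exists_affine_fractions {b : LinCoord} {P₀ : Fin 3 → C.Point}
    (h₀ : ∀ i, b.repr (P₀ i).1.rep 0 ≠ 0) {ι : Type*} [Finite ι]
    {f : ι → (Fin 3 → C.Point) → ℂ} (hf : ∀ j, f j ∈ C.regAt P₀) :
    ∃ (A : ι → MvPolynomial (Fin 3 × Fin 3) ℂ) (B : MvPolynomial (Fin 3 × Fin 3) ℂ),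
      ∀ᶠ P in C.nhd P₀, eval (C.affTriple b P) B ≠ 0 ∧
        ∀ j, f j P = eval (C.affTriple b P) (A j) / eval (C.affTriple b P) B := by
  classical
  have := Fintype.ofFinite ι
  choose A B hAB using fun j => exists_affine_fraction h₀ (hf j)
  refine ⟨fun j => A j * ∏ k ∈ Finset.univ.erase j, B k, ∏ k, B k, ?_⟩
  filter_upwards [Filter.eventually_all.2 hAB] with P hP
  refine ⟨?_, fun j => ?_⟩
  · rw [map_prod]
    exact Finset.prod_ne_zero_iff.2 fun k _ => (hP k).1
  · rw [(hP j).2, ← Finset.mul_prod_erase _ _ (Finset.mem_univ j), map_mul, map_mul,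
      mul_div_mul_right]
    rw [map_prod]
    exact Finset.prod_ne_zero_iff.2 fun k _ => (hP k).1

end SmoothPlaneQuartic
end

open scoped LinearAlgebra.Projectivization TensorProduct

noncomputable section

open MvPolynomial

/-- If every value of `f` satisfies a nontrivial polynomial equation whose coefficients are
polynomials in the values of `g`, then `f` takes finitely many values on a general fibre of `g`. -/
theorem exists_ne_zero_finite_image {X κ : Type} (g : κ → X → ℂ) (f : X → ℂ)
    {Φ : MvPolynomial (Option κ) ℂ} (h0 : Φ ≠ 0)
    (hΦ : aeval (fun o : Option κ => o.elim f g) Φ = 0) :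
    ∃ c : MvPolynomial κ ℂ, c ≠ 0 ∧ ∀ u : κ → ℂ, eval u c ≠ 0 →
      (f '' {x | ∀ k, g k x = u k}).Finite := by
  set q := optionEquivLeft ℂ κ Φ with hq
  have hq0 : q ≠ 0 := by
    rw [hq]
    exact (map_ne_zero_iff _ (optionEquivLeft ℂ κ).injective).2 h0
  refine ⟨q.leadingCoeff, Polynomial.leadingCoeff_ne_zero.2 hq0, fun u hu => ?_⟩
  have hmap : q.map (eval u) ≠ 0 := fun h => hu (by
    have := congrArg (Polynomial.coeff · q.natDegree) h
    simpa using this)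
  refine (q.map (eval u)).roots.toFinset.finite_toSet.subset ?_
  rintro _ ⟨x, hx, rfl⟩
  simp only [Finset.mem_coe, Multiset.mem_toFinset, Polynomial.mem_roots hmap, Polynomial.IsRoot]
  have h1 := congrFun hΦ x
  have h2 : aeval (fun o : Option κ => o.elim f g) Φ x =
      aeval (fun o : Option κ => o.elim (f x) fun k => g k x) Φ := by
    have h3 := comp_aeval (R := ℂ) (fun o : Option κ => o.elim f g)
      (Pi.evalAlgHom ℂ (fun _ : X => ℂ) x)
    have h4 := AlgHom.congr_fun h3 Φ
    rw [AlgHom.comp_apply] at h4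
    refine h4.trans ?_
    congr 2
    ext o
    cases o <;> rfl
  rw [h2] at h1
  have h5 : (((Polynomial.aeval (f x)).restrictScalars ℂ).comp
      (Polynomial.mapAlgHom (aeval u : MvPolynomial κ ℂ →ₐ[ℂ] ℂ))).comp
        (optionEquivLeft ℂ κ).toAlgHom =
      aeval (fun o : Option κ => o.elim (f x) fun k => g k x) := by
    apply algHom_ext
    intro o
    cases o
    · simp [optionEquivLeft_X_none]
    · simp [optionEquivLeft_X_some, show ∀ k, g k x = u k from hx]
  have h6 := AlgHom.congr_fun h5 Φ
  rw [h1] at h6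
  exact h6

namespace SmoothPlaneQuartic

variable {C : SmoothPlaneQuartic}

section

variable {E : Type} [AddCommGroup E] [Module ℂ E] [FiniteDimensional ℂ E] {n : ℕ}
  {V : Set C.Sym3} {N : C.Sym3 → Submodule ℂ E}

theorem IsRegularKernel.exists_patch (hN : C.IsRegularKernel N)
    (hV : ∀ P, C.sumOf P ∈ V → ∀ᶠ P' in C.nhd P, C.sumOf P' ∈ V)
    (hd : ∀ t ∈ V, Module.finrank ℂ (N t) = n) {κ : Type} [Finite κ] (B : Module.Basis κ ℂ E)
    {P₀ : Fin 3 → C.Point} (hP₀ : C.sumOf P₀ ∈ V) :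
    ∃ b : LinCoord, eval (b 2) C.F ≠ 0 ∧
      ∃ A : Fin n → κ → MvPolynomial (Fin 3 × Fin 3) ℂ,
        ∀ᶠ P in C.nhd P₀, (∀ i, b.repr (P i).1.rep 0 ≠ 0) ∧
          ∀ e ∈ N (C.sumOf P), ∃ w : Fin n → ℂ,
            ∀ c, B.repr e c = ∑ a, w a * eval (C.affTriple b P) (A a c) := by
  classical
  obtain ⟨b, hb, hb2⟩ := C.exists_isAdapted P₀
  obtain ⟨r, s₁, hrs, hs₁⟩ := exists_section (N (C.sumOf P₀)) (hd _ hP₀)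
  obtain ⟨s, hs, hreg⟩ := hN.exists_regular_section hV hd hP₀ hrs hs₁
  have h₀ : ∀ i, b.repr (P₀ i).1.rep 0 ≠ 0 := fun i => hb.finite _ (mem_sumOf.2 ⟨i, rfl⟩)
  obtain ⟨A, D, hAD⟩ := exists_affine_fractions (ι := Fin n × κ) h₀
    (f := fun ac P => B.coord ac.2 (s P (Pi.single ac.1 1))) fun ac => hreg _ _
  obtain ⟨c, -, hev⟩ := exists_regular_parametrization b hb
  refine ⟨b, hb2, fun a c => A (a, c), ?_⟩
  filter_upwards [hs, hAD, hev] with P h1 h2 h3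
  refine ⟨fun i => h3.1.finite _ (mem_sumOf.2 ⟨i, rfl⟩), fun e he => ?_⟩
  rw [← h1.2] at he
  obtain ⟨v, rfl⟩ := he
  refine ⟨fun a => v a / eval (C.affTriple b P) D, fun c => ?_⟩
  have hv : v = ∑ a, v a • (Pi.single a (1 : ℂ) : Fin n → ℂ) := by
    ext a
    simp [Finset.sum_apply, Pi.single_apply]
  rw [← Module.Basis.coord_apply]
  conv_lhs => rw [hv, map_sum, map_sum]
  refine Finset.sum_congr rfl fun a _ => ?_
  rw [map_smul, map_smul, smul_eq_mul, h2.2 (a, c)]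
  ring

/-- On one chart a general element lies in the subspaces of finitely many triples of points. -/
theorem exists_ne_zero_finite_triples {b : LinCoord} (hb : eval (b 2) C.F ≠ 0) {κ : Type}
    [Fintype κ] (hκ : Fintype.card κ = n + 3) (A : Fin n → κ → MvPolynomial (Fin 3 × Fin 3) ℂ) :
    ∃ c : MvPolynomial κ ℂ, c ≠ 0 ∧ ∀ u : κ → ℂ, eval u c ≠ 0 →
      {P : Fin 3 → C.Point | (∀ i, b.repr (P i).1.rep 0 ≠ 0) ∧ ∃ w : Fin n → ℂ,
        ∀ k, u k = ∑ a, w a * eval (C.affTriple b P) (A a k)}.Finite := by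
  let T : Type := {x : (Fin 3 → C.Point) × (Fin n → ℂ) // ∀ i, b.repr (x.1 i).1.rep 0 ≠ 0}
  let z : Fin 3 × Fin 3 → T → ℂ := fun ik x => C.affTriple b x.1.1 ik
  let w : Fin n → T → ℂ := fun a x => x.1.2 a
  let g : κ → T → ℂ := fun k x => ∑ a, w a x * eval (fun ik => z ik x) (A a k)
  let y : Fin 3 ⊕ Fin n → T → ℂ := Sum.elim (fun i => z (i, 1)) w
  set R := Algebra.adjoin ℂ (Set.range y) with hR
  have hyR : ∀ j, y j ∈ R := fun j => Algebra.subset_adjoin ⟨j, rfl⟩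
  have hz0 : ∀ i, z (i, 0) = 1 := by
    intro i
    ext x
    exact div_self (x.2 i)
  have hz : ∀ ik, IsIntegral R (z ik) := by
    rintro ⟨i, k⟩
    fin_cases k
    · have := hz0 i
      change IsIntegral R (z (i, 0))
      rw [this]
      exact isIntegral_one
    · exact isIntegral_algebraMap (x := (⟨_, hyR (Sum.inl i)⟩ : R))
    · refine LinCoord.isIntegral_of_sub_eq_zero b (x := z (i, 1)) (hyR (Sum.inl i)) C.homogeneous hb ?_
      ext x
      have h1 := LinCoord.map_sub b (Pi.evalAlgHom ℂ (fun _ : T => ℂ) x) ![1, z (i, 1), z (i, 2)] C.F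
      have h2 : (fun k => (Pi.evalAlgHom ℂ (fun _ : T => ℂ) x)
          ((![1, z (i, 1), z (i, 2)] : Fin 3 → T → ℂ) k)) =
          ![1, C.affCoord b (x.1.1 i) 1, C.affCoord b (x.1.1 i) 2] := by
        ext k
        fin_cases k <;> rfl
      rw [h2] at h1
      refine h1.trans ?_
      have h3 := C.eval_rep_eq b (x.2 i) C.homogeneous
      rw [(x.1.1 i).2] at h3
      exact (mul_eq_zero.1 h3.symm).resolve_left (pow_ne_zero _ (x.2 i))
  have hpoly : ∀ M : MvPolynomial (Fin 3 × Fin 3) ℂ,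
      IsIntegral R (fun x => eval (fun ik => z ik x) M) := by
    intro M
    have h1 : (fun x => eval (fun ik => z ik x) M) = aeval z M := by
      ext x
      have h2 := AlgHom.congr_fun (comp_aeval (R := ℂ) z (Pi.evalAlgHom ℂ (fun _ : T => ℂ) x)) M
      rw [AlgHom.comp_apply] at h2
      refine Eq.trans ?_ h2.symm
      rw [aeval_eq_eval]
      rfl
    rw [h1]
    clear h1
    have h3 : aeval z M ∈ (integralClosure R (T → ℂ)).restrictScalars ℂ := by
      induction M using MvPolynomial.induction_on with
      | C a =>
        rw [aeval_C]
        exact Subalgebra.algebraMap_mem _ _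
      | add p q hp hq =>
        rw [map_add]
        exact add_mem hp hq
      | mul_X p i hp =>
        rw [map_mul, aeval_X]
        exact mul_mem hp (hz i)
    exact h3
  have hg : ∀ k, IsIntegral R (g k) := by
    intro k
    have : g k = ∑ a, w a * fun x => eval (fun ik => z ik x) (A a k) := by
      ext x
      simp [g]
    rw [this]
    refine IsIntegral.sum _ fun a _ => IsIntegral.mul ?_ (hpoly _)
    exact isIntegral_algebraMap (x := (⟨_, hyR (Sum.inr a)⟩ : R))
  have hdep : ∀ ik, ∃ c : MvPolynomial κ ℂ, c ≠ 0 ∧ ∀ u : κ → ℂ, eval u c ≠ 0 →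
      (z ik '' {x | ∀ k, g k x = u k}).Finite := by
    intro ik
    obtain ⟨Φ, h0, hΦ⟩ := exists_aeval_eq_zero_of_isIntegral (κ := Fin 3 ⊕ Fin n) (ι := Option κ)
      (by simp [hκ]; omega) y (fun o => o.elim (z ik) g) (by
        rintro (_ | k)
        · exact hz ik
        · exact hg k)
    exact exists_ne_zero_finite_image g (z ik) h0 hΦ
  choose c hc0 hc using hdep
  refine ⟨∏ ik, c ik, Finset.prod_ne_zero_iff.2 fun ik _ => hc0 ik, fun u hu => ?_⟩
  rw [map_prod, Finset.prod_ne_zero_iff] at hu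
  have hfin : (Set.pi Set.univ fun ik => z ik '' {x | ∀ k, g k x = u k}).Finite :=
    Set.Finite.pi fun ik => hc ik u (hu ik (Finset.mem_univ _))
  refine Set.Finite.of_finite_image (f := C.affTriple b) (hfin.subset ?_) ?_
  · rintro _ ⟨P, ⟨hP, w', hw⟩, rfl⟩ ik -
    exact ⟨⟨(P, w'), hP⟩, fun k => (hw k).symm, rfl⟩
  · rintro P ⟨hP, -⟩ P' ⟨hP', -⟩ h
    ext1 i
    exact eq_of_affCoord b (hP i) (hP' i) (congrFun h (i, 1)) (congrFun h (i, 2))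

theorem IsRegularKernel.exists_ne_zero_finite (hN : C.IsRegularKernel N)
    (hV : ∀ P, C.sumOf P ∈ V → ∀ᶠ P' in C.nhd P, C.sumOf P' ∈ V)
    (hd : ∀ t ∈ V, Module.finrank ℂ (N t) = n) {κ : Type} [Fintype κ]
    (hκ : Fintype.card κ = n + 3) (B : Module.Basis κ ℂ E) :
    ∃ c : MvPolynomial κ ℂ, c ≠ 0 ∧ ∀ e : E, eval (fun k => B.repr e k) c ≠ 0 →
      {t | t ∈ V ∧ e ∈ N t}.Finite := by
  classical
  let 𝒟 : Set (MvPolynomial (Fin 3 × Fin 3) ℂ) := {D | ∃ c : MvPolynomial κ ℂ, c ≠ 0 ∧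
    ∀ e : E, eval (fun k => B.repr e k) c ≠ 0 →
      {P | C.evalTriple P D ≠ 0 ∧ e ∈ N (C.sumOf P)}.Finite}
  have hcover : ∀ P, C.sumOf P ∈ V → ∃ D ∈ 𝒟, C.evalTriple P D ≠ 0 := by
    intro P hP
    obtain ⟨b, hb, A, D, d, -, hD0, hD⟩ := hN.exists_patch hV hd B hP
    obtain ⟨c, hc0, hc⟩ := exists_ne_zero_finite_triples hb hκ A
    refine ⟨D, ⟨c, hc0, fun e he => (hc _ he).subset ?_⟩, hD0⟩
    rintro P' ⟨hP', heN⟩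
    exact ⟨(hD P' hP').1, (hD P' hP').2 e heN⟩
  obtain ⟨S, hS, hspan⟩ := (Submodule.fg_span_iff_fg_span_finset_subset 𝒟).1
    (IsNoetherian.noetherian (Submodule.span (MvPolynomial (Fin 3 × Fin 3) ℂ) 𝒟))
  have hcover' : ∀ P, C.sumOf P ∈ V → ∃ D ∈ S, C.evalTriple P D ≠ 0 := by
    intro P hP
    obtain ⟨D, hD, hDP⟩ := hcover P hP
    by_contra! hcon
    apply hDP
    have h1 : Submodule.span (MvPolynomial (Fin 3 × Fin 3) ℂ) (S : Set _) ≤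
        RingHom.ker (eval fun jk : Fin 3 × Fin 3 => (P jk.1).1.rep jk.2) :=
      Submodule.span_le.2 fun D' hD' => hcon D' hD'
    exact h1 (hspan ▸ Submodule.subset_span hD)
  choose! c hc0 hc using fun D (hD : D ∈ S) => hS hD
  refine ⟨∏ D ∈ S, c D, Finset.prod_ne_zero_iff.2 hc0, fun e he => ?_⟩
  rw [map_prod, Finset.prod_ne_zero_iff] at he
  refine ((S.finite_toSet.biUnion fun D hD => hc D hD e (he D hD)).image C.sumOf).subset ?_
  rintro t ⟨ht, hte⟩
  obtain ⟨P, rfl⟩ := exists_sumOf_eq t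
  obtain ⟨D, hD, hDP⟩ := hcover' P ht
  exact ⟨P, Set.mem_biUnion hD ⟨hDP, hte⟩, rfl⟩

theorem exists_eval_smul_ne_zero {κ : Type} {c : MvPolynomial κ ℂ} {u : κ → ℂ} {d : ℕ}
    (h : eval u (homogeneousComponent d c) ≠ 0) : ∃ a : ℂ, a ≠ 0 ∧ eval (a • u) c ≠ 0 := by
  let q : Polynomial ℂ := aeval (fun k => Polynomial.C (u k) * Polynomial.X) c
  have hq : ∀ a, q.eval a = eval (a • u) c := by
    intro a
    have h1 := AlgHom.congr_fun (comp_aeval (R := ℂ)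
      (fun k => Polynomial.C (u k) * Polynomial.X) (Polynomial.aeval a)) c
    rw [AlgHom.comp_apply, Polynomial.coe_aeval_eq_eval] at h1
    have h2 : (fun k => Polynomial.eval a (Polynomial.C (u k) * Polynomial.X)) = a • u := by
      ext k
      rw [Polynomial.eval_mul, Polynomial.eval_C, Polynomial.eval_X]
      exact mul_comm _ _
    rw [h2] at h1
    exact h1.trans (by rw [aeval_eq_eval])
  have hcoef : q.coeff d = eval u (homogeneousComponent d c) := by
    have h2 : q = ∑ j ∈ Finset.range (c.totalDegree + 1),
        Polynomial.C (eval u (homogeneousComponent j c)) * Polynomial.X ^ j := by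
      simp only [q]
      conv_lhs => rw [← sum_homogeneousComponent c]
      rw [map_sum]
      refine Finset.sum_congr rfl fun j _ => ?_
      have h3 := (homogeneousComponent_isHomogeneous j c)
      rw [aeval_def, eval₂_eq, eval_eq, map_sum, Finset.sum_mul]
      refine Finset.sum_congr rfl fun m hm => ?_
      have h4 : ∑ k ∈ m.support, m k = j := by
        have := h3 (mem_support_iff.1 hm)
        rw [Finsupp.weight_apply] at this
        simpa [Finsupp.sum] using this
      simp only [mul_pow, Finset.prod_mul_distrib, Finset.prod_pow_eq_pow_sum, h4, map_mul, map_prod,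
        map_pow]
      rw [← mul_assoc]
      rfl
    rw [h2, Polynomial.finsetSum_coeff]
    simp only [Polynomial.coeff_C_mul, Polynomial.coeff_X_pow, mul_ite, mul_one, mul_zero]
    rw [Finset.sum_ite_eq]
    split_ifs with hd
    · rfl
    · rw [homogeneousComponent_eq_zero _ _ (by simpa using hd), map_zero]
  have hq0 : Polynomial.X * q ≠ 0 := mul_ne_zero Polynomial.X_ne_zero fun h0 => h (by
    rw [← hcoef, h0, Polynomial.coeff_zero])
  obtain ⟨a, ha⟩ := Polynomial.exists_eval_ne_zero_of_natDegree_lt_card _ hq0 (by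
    exact (Cardinal.natCast_lt_aleph0).trans_le (Cardinal.aleph0_le_mk ℂ))
  rw [Polynomial.eval_mul, Polynomial.eval_X, hq] at ha
  exact ⟨a, left_ne_zero_of_mul ha, right_ne_zero_of_mul ha⟩

theorem IsRegularKernel.exists_isZariskiOpenProj_finite (hN : C.IsRegularKernel N)
    (hV : ∀ P, C.sumOf P ∈ V → ∀ᶠ P' in C.nhd P, C.sumOf P' ∈ V)
    (hd : ∀ t ∈ V, Module.finrank ℂ (N t) = n) (hE : Module.finrank ℂ E = n + 3) :
    ∃ O : Set (ℙ ℂ E), IsZariskiOpenProj O ∧ O.Nonempty ∧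
      ∀ G ∈ O, {t | t ∈ V ∧ G.submodule ≤ N t}.Finite := by
  let B : Module.Basis (Fin (n + 3)) ℂ E := Module.finBasisOfFinrankEq ℂ E hE
  obtain ⟨c, hc0, hc⟩ := hN.exists_ne_zero_finite hV hd (by simp) B
  have hcoord : ∀ (d : ℕ) (e : E), eval (fun l : Module.Dual ℂ E => l e)
      (rename B.coord (homogeneousComponent d c)) =
        eval (fun k => B.repr e k) (homogeneousComponent d c) := by
    intro d e
    rw [eval_rename]
    rfl
  refine ⟨{x | ∃ d, eval (fun k => B.repr x.rep k) (homogeneousComponent d c) ≠ 0},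
    ⟨Set.range fun d => rename B.coord (homogeneousComponent d c), ?_, fun x => ?_⟩, ?_, ?_⟩
  · rintro _ ⟨d, rfl⟩
    exact ⟨d, (homogeneousComponent_isHomogeneous d c).rename_isHomogeneous⟩
  · rw [Set.exists_range_iff]
    simp only [hcoord]
    rfl
  · have h1 : c * X 0 ≠ 0 := mul_ne_zero hc0 (X_ne_zero 0)
    obtain ⟨u, hu⟩ : ∃ u, eval u (c * X 0) ≠ 0 := by
      by_contra! hcon
      exact h1 (MvPolynomial.funext fun u => by rw [hcon, map_zero])
    rw [map_mul, eval_X] at hu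
    have hu1 := left_ne_zero_of_mul hu
    have hu0 : u ≠ 0 := fun h => right_ne_zero_of_mul hu (by rw [h, Pi.zero_apply])
    let e : E := B.equivFun.symm u
    have he0 : e ≠ 0 := (map_ne_zero_iff _ B.equivFun.symm.injective).2 hu0
    refine ⟨Projectivization.mk ℂ e he0, ?_⟩
    obtain ⟨d, hdu⟩ : ∃ d, eval u (homogeneousComponent d c) ≠ 0 := by
      by_contra! hcon
      apply hu1
      rw [← sum_homogeneousComponent c, map_sum]
      exact Finset.sum_eq_zero fun d _ => hcon d
    refine ⟨d, ?_⟩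
    obtain ⟨a, ha⟩ := Projectivization.exists_smul_eq_mk_rep ℂ e he0
    have h2 : (fun k => B.repr (Projectivization.mk ℂ e he0).rep k) = (a : ℂ) • u := by
      rw [← ha]
      ext k
      have h3 : B.repr e k = u k := congrFun (B.equivFun.apply_symm_apply u) k
      rw [Units.smul_def, map_smul, Finsupp.smul_apply, h3, Pi.smul_apply]
    rw [h2, (homogeneousComponent_isHomogeneous d c).eval_smul_vec]
    exact mul_ne_zero (pow_ne_zero _ a.ne_zero) hdu
  · rintro x ⟨d, hx⟩
    obtain ⟨a, ha0, ha⟩ := exists_eval_smul_ne_zero hx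
    refine (hc (a • x.rep) ?_).subset ?_
    · convert ha using 3
      ext k
      simp
    · rintro t ⟨ht, hle⟩
      exact ⟨ht, (N t).smul_mem _ (submodule_le_iff_rep_mem.1 hle)⟩

end

variable (C) in
theorem exists_isZariskiOpenProj_finite_fibre : ∃ O : Set C.P6, IsZariskiOpenProj O ∧ O.Nonempty ∧
    ∀ G ∈ O, {t | (t, G) ∈ C.Q}.Finite := by
  rw [Q_eq]
  exact isRegularKernel_quadricsOn.exists_isZariskiOpenProj_finite (fun _ => eventually_mem_U)
    (fun _ => finrank_quadricsOn) C.finrank_quadricSpace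

end SmoothPlaneQuartic
end

open scoped LinearAlgebra.Projectivization TensorProduct

noncomputable section

namespace SmoothPlaneQuartic

variable {C : SmoothPlaneQuartic}

theorem mem_Q_iff_union_subset {t : C.Sym3} (ht : t ∈ C.U) {G : C.P6} :
    (t, G) ∈ C.Q ↔ C.bicanonicalCurve ∪ C.linSpan t ⊆ C.quadric G := by
  rw [Set.union_subset_iff]
  exact (and_iff_right ht).trans (and_iff_right (C.subset_quadric_iff.2 G.rep.2)).symm

theorem mem_Q_iff_map_le {t : C.Sym3} (ht : t ∈ C.U) {G : C.P6} :
    (t, G) ∈ C.Q ↔ G.submodule.map (Submodule.subtype (C.quadricsThrough C.bicanonicalCurve)) ≤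
      C.quadricsThrough (C.bicanonicalCurve ∪ C.linSpan t) := by
  rw [mem_Q_iff_union_subset ht, subset_quadric_iff, Submodule.map_le_iff_le_comap]
  change G.rep ∈ (C.quadricsThrough (C.bicanonicalCurve ∪ C.linSpan t)).comap
    (Submodule.subtype (C.quadricsThrough C.bicanonicalCurve)) ↔ _
  exact (submodule_le_iff_rep_mem (E := C.QuadricSpace)).symm

end SmoothPlaneQuartic
end

theorem planes_in_quadrics_bundle (C : SmoothPlaneQuartic) :
    -- `ℙ⁵` and `ℙ⁶ = |I_{C|ℙ⁵}(2)|` have dimensions five and six, and `P_t` is a plane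
    Module.finrank ℂ C.BicanDual = 6 ∧ Module.finrank ℂ C.QuadricSpace = 7 ∧
    (∀ t ∈ C.U, Module.finrank ℂ (C.spanDual t) = 3) ∧
    -- the first projection `Q → U` is a `ℙ³`-bundle
    C.IsProjectiveBundle 3 C.U C.Q ∧
    -- its fibre over `t` is the three-dimensional linear system of quadrics through `C ∪ P_t`
    (∀ t ∈ C.U,
      {G | (t, G) ∈ C.Q} = {G | C.bicanonicalCurve ∪ C.linSpan t ⊆ C.quadric G} ∧
      {G | (t, G) ∈ C.Q} =
        {G | G.submodule.map (Submodule.subtype (C.quadricsThrough C.bicanonicalCurve)) ≤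
          C.quadricsThrough (C.bicanonicalCurve ∪ C.linSpan t)} ∧
      Module.finrank ℂ (C.quadricsThrough (C.bicanonicalCurve ∪ C.linSpan t)) = 4) ∧
    -- the second projection `Q → ℙ⁶` has finite fibre over a general quadric
    ∃ O : Set C.P6, IsZariskiOpenProj O ∧ O.Nonempty ∧
      ∀ G ∈ O, {t | (t, G) ∈ C.Q}.Finite := by
  refine ⟨C.finrank_bicanDual, C.finrank_quadricSpace,
    fun t ht => SmoothPlaneQuartic.finrank_spanDual ht, C.isProjectiveBundle_Q,
    fun t ht => ⟨?_, ?_, SmoothPlaneQuartic.finrank_quadricsThrough ht⟩,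
    C.exists_isZariskiOpenProj_finite_fibre⟩
  · ext G
    exact SmoothPlaneQuartic.mem_Q_iff_union_subset ht
  · ext G
    exact SmoothPlaneQuartic.mem_Q_iff_map_le ht
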